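/- For all integers ℓ ≥ 3, k ≥ 1, and n ≥ ℓ·2^k + 1, every k-coloring of the edges of the complete graph K_n contains either a rainbow triangle or a monochromatic copy of the cycle C_{2ℓ+1}. -/

import Mathlib

open SimpleGraph

/-- The edge coloring `c` of the complete graph on `V` contains a rainbow triangle. -/
def HasRainbowTriangle {V α : Type*} (c : Sym2 V → α) : Prop :=
  ∃ x y z : V, x ≠ y ∧ x ≠ z ∧ y ≠ z ∧
    c s(x, y) ≠ c s(x, z) ∧ c s(x, y) ≠ c s(y, z) ∧ c s(x, z) ≠ c s(y, z)

/-- The edge coloring `c` contains a copy of `H` all of whose edges have color `i`. -/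
def HasMonoCopyIn {V W α : Type*} (c : Sym2 V → α) (H : SimpleGraph W) (i : α) : Prop :=
  ∃ f : W ↪ V, ∀ u v, H.Adj u v → c s(f u, f v) = i

/-- The edge coloring `c` contains a monochromatic copy of `H`. -/
def HasMonoCopy {V W α : Type*} (c : Sym2 V → α) (H : SimpleGraph W) : Prop :=
  ∃ i, HasMonoCopyIn c H i

/-- Every `k`-coloring of the edges of `K_n` contains a rainbow triangle or a
monochromatic copy of `H`. -/
def grProp {W : Type*} (k : ℕ) (H : SimpleGraph W) (n : ℕ) : Prop :=
  ∀ c : Sym2 (Fin n) → Fin k, HasRainbowTriangle c ∨ HasMonoCopy c H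

/-- The `k`-color Gallai–Ramsey number `gr_k(K₃ : H)`: the minimum `N` such that for all
`n ≥ N`, every `k`-coloring of the edges of `K_n` contains a rainbow triangle or a
monochromatic copy of `H`. -/
noncomputable def gr {W : Type*} (k : ℕ) (H : SimpleGraph W) : ℕ :=
  sInf {N | ∀ n, N ≤ n → grProp k H n}

set_option linter.unusedSectionVars false

namespace GR
variable {α : Type*} [DecidableEq α]

def Cy (R : α → α → Prop) (n : ℕ) : Prop :=
  ∃ g : ℕ → α, (∀ s t, s < t → t < n → g s ≠ g t) ∧
    (∀ t, t + 1 < n → R (g t) (g (t+1))) ∧ R (g (n-1)) (g 0)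

def CyL (R : α → α → Prop) (l : List α) : Prop :=
  l.Nodup ∧ l.IsChain R ∧ ∀ x ∈ l.getLast?, ∀ y ∈ l.head?, R x y

lemma CyL.cy {R : α → α → Prop} {l : List α} (h : CyL R l) {n : ℕ} (hn : l.length = n)
    (h0 : 0 < n) : Cy R n := by
  subst hn
  obtain ⟨h1, h2, h3⟩ := h
  have : Nonempty α := ⟨l[0]⟩
  let d : α := l[0]
  refine ⟨fun i => l.getD i d, ?_, ?_, ?_⟩
  · intro s t hst ht
    have hs : s < l.length := by omega
    simp only [List.getD_eq_getElem?_getD, List.getElem?_eq_getElem hs, List.getElem?_eq_getElem ht, Option.getD_some]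
    intro he
    have := (List.Nodup.getElem_inj_iff h1).1 he
    omega
  · intro t ht
    have hs : t < l.length := by omega
    simp only [List.getD_eq_getElem?_getD, List.getElem?_eq_getElem hs, List.getElem?_eq_getElem ht, Option.getD_some]
    exact h2.getElem t ht
  · have hs : l.length - 1 < l.length := by omega
    simp only [List.getD_eq_getElem?_getD, List.getElem?_eq_getElem hs, List.getElem?_eq_getElem h0, Option.getD_some]
    apply h3
    · simp [List.getLast?_eq_getElem?, List.getElem?_eq_getElem hs]
    · simp [List.head?_eq_getElem?, List.getElem?_eq_getElem h0]

lemma Cy.list {R : α → α → Prop} {n : ℕ} (h : Cy R n) (h0 : 0 < n) :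
    ∃ l : List α, l.length = n ∧ CyL R l := by
  obtain ⟨g, h1, h2, h3⟩ := h
  refine ⟨(List.range n).map g, by simp, ?_, ?_, ?_⟩
  · refine List.Nodup.map_on ?_ List.nodup_range
    intro x hx y hy hxy
    simp at hx hy
    rcases lt_trichotomy x y with h | h | h
    · exact absurd hxy (h1 _ _ h hy)
    · exact h
    · exact absurd hxy.symm (h1 _ _ h hx)
  · rw [List.isChain_iff_getElem]
    intro i hi
    simp at hi ⊢
    exact h2 i hi
  · intro x hx y hy
    obtain ⟨m, rfl⟩ : ∃ m, n = m + 1 := ⟨n - 1, by omega⟩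
    simp [List.range_succ, List.getLast?_append] at hx
    simp [List.range_succ_eq_map] at hy
    subst hx hy
    simpa using h3

lemma Cy.mono {R S : α → α → Prop} {n : ℕ} (h : Cy R n) (hRS : ∀ u v, R u v → S u v) :
    Cy S n := by
  obtain ⟨g, h1, h2, h3⟩ := h
  exact ⟨g, h1, fun t ht => hRS _ _ (h2 t ht), hRS _ _ h3⟩

lemma alt_list {R : α → α → Prop} (hs : ∀ u v, R u v → R v u) (j : ℕ) :
    ∀ (P Q : Finset α), Disjoint P Q → (∀ p ∈ P, ∀ q ∈ Q, R p q) → j + 1 ≤ P.card → j ≤ Q.card →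
    ∃ l : List α, l.length = 2 * j + 1 ∧ l.Nodup ∧ l.IsChain R ∧ (∀ x ∈ l, x ∈ P ∨ x ∈ Q) ∧
      (∀ x ∈ l.head?, x ∈ P) ∧ (∀ x ∈ l.getLast?, x ∈ P) := by
  induction j with
  | zero =>
    intro P Q hd hR hP hQ
    obtain ⟨p, hp⟩ := Finset.card_pos.1 (by omega : 0 < P.card)
    exact ⟨[p], by simp [hp]⟩
  | succ j ih =>
    intro P Q hd hR hP hQ
    obtain ⟨p, hp⟩ := Finset.card_pos.1 (by omega : 0 < P.card)
    obtain ⟨q, hq⟩ := Finset.card_pos.1 (by omega : 0 < Q.card)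
    have hpq : p ≠ q := fun h => Finset.disjoint_left.1 hd hp (h ▸ hq)
    obtain ⟨l, h1, h2, h3, h4, h5, h6⟩ := ih (P.erase p) (Q.erase q)
      (Finset.disjoint_of_subset_left (Finset.erase_subset _ _)
        (Finset.disjoint_of_subset_right (Finset.erase_subset _ _) hd))
      (fun a ha b hb => hR a (Finset.mem_of_mem_erase ha) b (Finset.mem_of_mem_erase hb))
      (by rw [Finset.card_erase_of_mem hp]; omega) (by rw [Finset.card_erase_of_mem hq]; omega)
    rw [Finset.disjoint_left] at hd
    refine ⟨p :: q :: l, by simp [h1]; ring, ?_, ?_, ?_, ?_, ?_⟩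
    · simp only [List.nodup_cons, List.mem_cons, not_or]
      refine ⟨⟨hpq, fun h => ?_⟩, fun h => ?_, h2⟩
      · have := h4 _ h
        simp at this
        exact hd hp this.2
      · have := h4 _ h
        simp at this
        exact hd this.2 hq
    · rw [List.isChain_cons, List.isChain_cons]
      refine ⟨by simpa using hR p hp q hq, fun y hy => ?_, h3⟩
      exact hs _ _ (hR _ (Finset.mem_of_mem_erase (h5 y hy)) q hq)
    · intro x hx
      simp at hx
      rcases hx with rfl | rfl | hx
      · exact Or.inl hp
      · exact Or.inr hq
      · have := h4 _ hx
        simp at this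
        tauto
    · simp [hp]
    · intro x hx
      have hne : l ≠ [] := by rintro rfl; simp at h1
      rw [List.getLast?_cons_of_ne_nil (by simp), List.getLast?_cons_of_ne_nil hne] at hx
      exact Finset.mem_of_mem_erase (h6 x hx)

lemma alt_cycle {R : α → α → Prop} (hs : ∀ u v, R u v → R v u) (j : ℕ)
    (P Q : Finset α) (t : List α) (hd : Disjoint P Q) (hR : ∀ p ∈ P, ∀ q ∈ Q, R p q)
    (hP : j + 1 ≤ P.card) (hQ : j ≤ Q.card) (htn : t.Nodup) (htc : t.IsChain R)
    (htP : ∀ x ∈ t, x ∉ P ∧ x ∉ Q) (hth : ∀ x ∈ t.head?, ∀ p ∈ P, R p x)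
    (htl : ∀ x ∈ t.getLast?, ∀ p ∈ P, R p x) (n : ℕ) (hn : t.length + 2 * j + 1 = n) (ht0 : t ≠ []) :
    Cy R n := by
  obtain ⟨l, h1, h2, h3, h4, h5, h6⟩ := alt_list hs j P Q hd hR hP hQ
  have hne : l ≠ [] := by rintro rfl; simp at h1
  refine CyL.cy (l := t ++ l) ⟨?_, ?_, ?_⟩ (by simp; omega) (by omega)
  · rw [List.nodup_append']
    refine ⟨htn, h2, fun x hx hx' => ?_⟩
    have := htP x hx
    have := h4 x hx'
    tauto
  · rw [List.isChain_append]
    exact ⟨htc, h3, fun x hx y hy => hs _ _ (htl x hx y (h5 y hy))⟩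
  · intro x hx y hy
    rw [List.getLast?_append_of_ne_nil _ hne] at hx
    rw [List.head?_append_of_ne_nil _ ht0] at hy
    exact hth y hy x (h6 x hx)

lemma c1 {R : α → α → Prop} (hs : ∀ u v, R u v → R v u) (ρ : ℕ) (hρ : 1 ≤ ρ)
    (P Q : Finset α) (hd : Disjoint P Q) (hR : ∀ p ∈ P, ∀ q ∈ Q, R p q)
    (hP : ρ ≤ P.card) (hQ : ρ + 1 ≤ Q.card) (u v : α) (hu : u ∈ Q) (hv : v ∈ Q) (huv : u ≠ v)
    (h : R u v) : Cy R (2 * ρ + 1) := by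
  have hd' := Finset.disjoint_left.1 hd
  refine alt_cycle hs (ρ - 1) P (Q \ {u, v}) [u, v] ?_ ?_ (by omega) ?_ (by simpa using huv)
    (by simpa using h) ?_ ?_ ?_ _ (by simp; omega) (by simp)
  · exact Finset.disjoint_of_subset_right Finset.sdiff_subset hd
  · intro p hp q hq
    exact hR p hp q (Finset.mem_sdiff.1 hq).1
  · have := Finset.le_card_sdiff {u, v} Q
    have h2 : ({u, v} : Finset α).card = 2 := Finset.card_pair huv
    omega
  · intro x hx
    simp at hx
    constructor
    · intro hxP
      rcases hx with rfl | rfl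
      · exact hd' hxP hu
      · exact hd' hxP hv
    · simp; tauto
  · simpa using fun p hp => hR p hp u hu
  · simpa using fun p hp => hR p hp v hv

lemma c2 {R : α → α → Prop} (hs : ∀ u v, R u v → R v u) (ρ : ℕ) (hρ : 1 ≤ ρ)
    (P Q : Finset α) (hd : Disjoint P Q) (hR : ∀ p ∈ P, ∀ q ∈ Q, R p q)
    (hP : ρ ≤ P.card) (hQ : ρ ≤ Q.card) (y p0 q0 : α) (hyP : y ∉ P) (hyQ : y ∉ Q)
    (hp0 : p0 ∈ P) (hq0 : q0 ∈ Q) (hyp : R y p0) (hyq : R y q0) : Cy R (2 * ρ + 1) := by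
  have hd' := Finset.disjoint_left.1 hd
  have hp0q : p0 ∉ Q := hd' hp0
  have hq0p : q0 ∉ P := fun h => hd' h hq0
  have hne : p0 ≠ q0 := by rintro rfl; exact hp0q hq0
  have hyp' : y ≠ p0 := by rintro rfl; exact hyP hp0
  have hyq' : y ≠ q0 := by rintro rfl; exact hyQ hq0
  rcases Nat.lt_or_ge ρ 2 with h | h
  · obtain rfl : ρ = 1 := by omega
    refine CyL.cy (l := [p0, y, q0]) ⟨?_, ?_, ?_⟩ (by simp) (by omega)
    · simp [hne, hyq', hyp'.symm]
    · simp [hs _ _ hyp, hyq]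
    · simpa using hs _ _ (hR p0 hp0 q0 hq0)
  · obtain ⟨q', hq', hqq⟩ := Finset.exists_mem_ne (by omega : 1 < Q.card) q0
    have hq'p : q' ∉ P := fun h => hd' h hq'
    have hyq2 : y ≠ q' := by rintro rfl; exact hyQ hq'
    have hpq2 : p0 ≠ q' := by rintro rfl; exact hp0q hq'
    refine alt_cycle hs (ρ - 2) (P.erase p0) (Q \ {q0, q'}) [q', p0, y, q0] ?_ ?_ ?_ ?_ ?_
      ?_ ?_ ?_ ?_ _ (by simp; omega) (by simp)
    · exact Finset.disjoint_of_subset_right Finset.sdiff_subset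
        (Finset.disjoint_of_subset_left (Finset.erase_subset _ _) hd)
    · intro p hp q hq
      exact hR p (Finset.mem_of_mem_erase hp) q (Finset.mem_sdiff.1 hq).1
    · rw [Finset.card_erase_of_mem hp0]; omega
    · have := Finset.le_card_sdiff {q0, q'} Q
      have h2 : ({q0, q'} : Finset α).card = 2 := Finset.card_pair hqq.symm
      omega
    · simp [hqq, hyq2.symm, hpq2.symm, hyp'.symm, hne, hyq']
    · simp [hs _ _ (hR p0 hp0 q' hq'), hs _ _ hyp, hyq]
    · intro x hx
      simp at hx
      rcases hx with rfl | rfl | rfl | rfl <;> simp <;> tauto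
    · simpa using fun p _ hp => hR p hp q' hq'
    · simpa using fun p _ hp => hR p hp q0 hq0

/-- `r1 - b1 - b2 - r2` attached to `P` through `r1, r2 ∈ Q`. -/
lemma c3 {R : α → α → Prop} (hs : ∀ u v, R u v → R v u) (ρ : ℕ) (hρ : 2 ≤ ρ)
    (P Q : Finset α) (hd : Disjoint P Q) (hR : ∀ p ∈ P, ∀ q ∈ Q, R p q)
    (hP : ρ - 1 ≤ P.card) (hQ : ρ ≤ Q.card) (r1 b1 b2 r2 : α) (hr1 : r1 ∈ Q) (hr2 : r2 ∈ Q)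
    (hb1P : b1 ∉ P) (hb1Q : b1 ∉ Q) (hb2P : b2 ∉ P) (hb2Q : b2 ∉ Q) (hr : r1 ≠ r2) (hb : b1 ≠ b2)
    (h1 : R r1 b1) (h2 : R b1 b2) (h3 : R b2 r2) : Cy R (2 * ρ + 1) := by
  have hd' := Finset.disjoint_left.1 hd
  have e1 : r1 ≠ b1 := by rintro rfl; exact hb1Q hr1
  have e2 : r1 ≠ b2 := by rintro rfl; exact hb2Q hr1
  have e3 : b1 ≠ r2 := by rintro rfl; exact hb1Q hr2
  have e4 : b2 ≠ r2 := by rintro rfl; exact hb2Q hr2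
  refine alt_cycle hs (ρ - 2) P (Q \ {r1, r2}) [r1, b1, b2, r2] ?_ ?_ (by omega) ?_ ?_
      ?_ ?_ ?_ ?_ _ (by simp; omega) (by simp)
  · exact Finset.disjoint_of_subset_right Finset.sdiff_subset hd
  · intro p hp q hq
    exact hR p hp q (Finset.mem_sdiff.1 hq).1
  · have := Finset.le_card_sdiff {r1, r2} Q
    have h2 : ({r1, r2} : Finset α).card = 2 := Finset.card_pair hr
    omega
  · simp; tauto
  · simp [h1, h2, h3]
  · intro x hx
    simp at hx
    have := fun h => hd' h hr1
    have := fun h => hd' h hr2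
    rcases hx with rfl | rfl | rfl | rfl <;> simp <;> tauto
  · simpa using fun p hp => hR p hp r1 hr1
  · simpa using fun p hp => hR p hp r2 hr2
end GR

namespace GR
variable {α : Type*} [DecidableEq α]

lemma sorted_enum {ι : Type*} (U : Finset α) (cl : α → ι) (hne : U.Nonempty) :
    ∃ v : ℕ → α, (∀ i < U.card, v i ∈ U) ∧ (∀ i j, i < j → j < U.card → v i ≠ v j) ∧
      ∀ i j m, i ≤ j → j ≤ m → m < U.card → cl (v i) = cl (v m) → cl (v j) = cl (v i) := by
  classical
  obtain ⟨d, hd⟩ := hne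
  let key : α → ℕ := fun x => (U.toList.map cl).idxOf (cl x)
  have hkey : ∀ x ∈ U, ∀ y, key x = key y → cl x = cl y := by
    intro x hx y h
    exact (List.idxOf_inj (List.mem_map.2 ⟨x, by simpa using hx, rfl⟩)).1 h
  let L := U.toList.mergeSort (fun a b => decide (key a ≤ key b))
  have hperm : L.Perm U.toList := List.mergeSort_perm _ _
  have hsort : L.Pairwise (fun a b => key a ≤ key b) := by
    have := List.pairwise_mergeSort (le := fun a b => decide (key a ≤ key b))
      (by intro a b c; simp; omega) (by intro a b; simp; omega) U.toList
    refine this.imp ?_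
    intro a b h
    simpa using h
  have hlen : L.length = U.card := by rw [hperm.length_eq]; simp
  have hnd : L.Nodup := hperm.nodup_iff.2 U.nodup_toList
  have hmem : ∀ x, x ∈ L → x ∈ U := fun x hx => by simpa using hperm.mem_iff.1 hx
  have hget : ∀ i (h : i < U.card), L.getD i d = L[i]'(by omega) := by
    intro i h
    rw [List.getD_eq_getElem?_getD, List.getElem?_eq_getElem (by omega : i < L.length)]
    rfl
  have hmono : ∀ i j, i ≤ j → j < U.card → key (L.getD i d) ≤ key (L.getD j d) := by
    intro i j hij hj
    rw [hget i (by omega), hget j hj]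
    rcases hij.eq_or_lt with rfl | hlt
    · exact le_rfl
    · exact List.pairwise_iff_getElem.1 hsort i j (by omega) (by omega) hlt
  have hU : ∀ i < U.card, L.getD i d ∈ U := by
    intro i hi
    rw [hget i hi]
    exact hmem _ (List.getElem_mem _)
  refine ⟨fun i => L.getD i d, hU, ?_, ?_⟩
  · intro i j hij hj
    simp only
    rw [hget i (by omega), hget j hj]
    intro he
    have := (List.Nodup.getElem_inj_iff hnd).1 he
    omega
  · intro i j m hij hjm hm h
    have h1 := hmono i j hij (by omega)
    have h2 := hmono j m hjm (by omega)
    have h3 : key (L.getD i d) = key (L.getD m d) := by simp only [key]; rw [h]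
    exact hkey _ (hU j (by omega)) (L.getD i d) (by omega)

lemma lemM {ι : Type*} [DecidableEq ι] {R : α → α → Prop} (hs : ∀ u v, R u v → R v u) (ρ : ℕ)
    (hρ : 1 ≤ ρ) (U : Finset α) (cl : α → ι)
    (hR : ∀ u ∈ U, ∀ v ∈ U, cl u ≠ cl v → R u v) (hU : 2 * ρ + 1 ≤ U.card)
    (h1 : ∀ a, ρ + 1 ≤ (U.filter (fun x => cl x ≠ a)).card)
    (h2 : ∀ a b, ∃ u ∈ U, cl u ≠ a ∧ cl u ≠ b) : Cy R (2 * ρ + 1) := by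
  by_cases hbig : ∃ a, ρ ≤ (U.filter (fun x => cl x = a)).card
  · obtain ⟨a, ha⟩ := hbig
    obtain ⟨u, hu, hua, -⟩ := h2 a a
    obtain ⟨v, hv, hva, hvu⟩ := h2 a (cl u)
    refine c1 hs ρ hρ _ (U.filter (fun x => cl x ≠ a)) ?_ ?_ ha (h1 a) u v ?_ ?_ ?_ ?_
    · rw [Finset.disjoint_left]; simp; tauto
    · intro p hp q hq
      simp at hp hq
      exact hR p hp.1 q hq.1 (by rw [hp.2]; exact fun h => hq.2 h.symm)
    · simp [hu, hua]
    · simp [hv, hva]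
    · rintro rfl; exact hvu rfl
    · exact hR u hu v hv (fun h => hvu h.symm)
  · push Not at hbig
    obtain ⟨v, hv, hinj, hmono⟩ := sorted_enum U cl (Finset.card_pos.1 (by omega))
    have key : ∀ i j, i + ρ ≤ j → j < U.card → cl (v i) ≠ cl (v j) := by
      intro i j hij hj he
      have h3 := hbig (cl (v i))
      have h4 : ((Finset.Icc i j).image v).card = j + 1 - i := by
        rw [Finset.card_image_of_injOn, Nat.card_Icc]
        intro x hx y hy hxy
        simp at hx hy
        rcases lt_trichotomy x y with h | h | h
        · exact absurd hxy (hinj _ _ h (by omega))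
        · exact h
        · exact absurd hxy.symm (hinj _ _ h (by omega))
      have h5 : ((Finset.Icc i j).image v) ⊆ U.filter (fun x => cl x = cl (v i)) := by
        intro x hx
        simp at hx ⊢
        obtain ⟨t, ht, rfl⟩ := hx
        exact ⟨hv t (by omega), hmono i t j ht.1 ht.2 hj he⟩
      have := Finset.card_le_card h5
      omega
    let pos : ℕ → ℕ := fun t => if t = 0 then 0 else if t % 2 = 0 then 2 * ρ + 1 - t / 2 else ρ - t / 2
    have adj : ∀ i j, (i + ρ ≤ j ∧ j < U.card) ∨ (j + ρ ≤ i ∧ i < U.card) → R (v i) (v j) := by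
      rintro i j (⟨h, h'⟩ | ⟨h, h'⟩)
      · exact hR _ (hv _ (by omega)) _ (hv _ (by omega)) (key i j h h')
      · exact hR _ (hv _ (by omega)) _ (hv _ (by omega)) (key j i h h').symm
    have vinj : ∀ i j, i < U.card → j < U.card → i ≠ j → v i ≠ v j := by
      intro i j hi hj hij
      rcases lt_or_gt_of_ne hij with h | h
      · exact hinj _ _ h hj
      · exact (hinj _ _ h hi).symm
    refine ⟨fun t => v (pos t), ?_, ?_, ?_⟩
    · intro s t hst ht
      apply vinj <;> simp only [pos] <;> split_ifs <;> omega
    · intro t ht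
      apply adj
      simp only [pos]; split_ifs <;> first | omega | grind
    · apply adj
      simp only [pos]; split_ifs <;> omega

/-- reduced two-coloured structure -/
structure TC {ι : Type*} (U : Finset α) (red blue : α → α → Prop) (part : α → ι) : Prop where
  rs : ∀ u v, red u v → red v u
  bs : ∀ u v, blue u v → blue v u
  cross : ∀ u ∈ U, ∀ v ∈ U, part u ≠ part v → red u v ∨ blue u v
  homR : ∀ u ∈ U, ∀ u' ∈ U, ∀ v ∈ U, part u = part u' → part u ≠ part v → red u v → red u' v
  homB : ∀ u ∈ U, ∀ u' ∈ U, ∀ v ∈ U, part u = part u' → part u ≠ part v → blue u v → blue u' v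

lemma TC.symm {ι : Type*} {U : Finset α} {red blue : α → α → Prop} {part : α → ι}
    (h : TC U red blue part) : TC U blue red part :=
  ⟨h.bs, h.rs, fun u hu v hv e => (h.cross u hu v hv e).symm, h.homB, h.homR⟩

lemma card_two_parts {ι : Type*} [DecidableEq ι] (V : Finset α) (part : α → ι) (ℓ : ℕ)
    (hp : ∀ a, (V.filter (fun x => part x = a)).card ≤ ℓ) (hV : 2 * ℓ + 1 ≤ V.card) (a b : ι) :
    ∃ u ∈ V, part u ≠ a ∧ part u ≠ b := by
  by_contra hcon
  push Not at hcon
  have h3 : V ⊆ V.filter (fun x => part x = a) ∪ V.filter (fun x => part x = b) := by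
    intro x hx
    simp only [Finset.mem_union, Finset.mem_filter]
    have := hcon x hx
    tauto
  have h4 := Finset.card_le_card h3
  have h5 := Finset.card_union_le (V.filter (fun x => part x = a)) (V.filter (fun x => part x = b))
  have := hp a
  have := hp b
  omega

lemma card_one_part {ι : Type*} [DecidableEq ι] (V : Finset α) (part : α → ι) (ℓ m : ℕ)
    (hp : ∀ a, (V.filter (fun x => part x = a)).card ≤ ℓ) (hV : ℓ + m ≤ V.card) (a : ι) :
    m ≤ (V.filter (fun x => part x ≠ a)).card := by
  have := Finset.card_filter_add_card_filter_not (s := V) (fun x => part x = a)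
  have := hp a
  simp only [ne_eq]
  omega

lemma hp_mono {ι : Type*} [DecidableEq ι] {U V : Finset α} {part : α → ι} {ℓ : ℕ}
    (hp : ∀ a, (U.filter (fun x => part x = a)).card ≤ ℓ) (h : V ⊆ U) (a : ι) :
    (V.filter (fun x => part x = a)).card ≤ ℓ :=
  (Finset.card_le_card (Finset.filter_subset_filter _ h)).trans (hp a)

lemma lemS2 {ι : Type*} [DecidableEq ι] {U : Finset α} {red blue : α → α → Prop} {part : α → ι}
    (h : TC U red blue part) (ℓ ρ : ℕ) (hρ : 1 ≤ ρ) (hρℓ : ρ ≤ ℓ)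
    (hp : ∀ a, (U.filter (fun x => part x = a)).card ≤ ℓ) (P V : Finset α) (hPV : P ⊆ V)
    (hVU : V ⊆ U) (hP : ℓ + 1 ≤ P.card) (hV : 2 * ℓ + 1 ≤ V.card)
    (hb : ∀ y ∈ V, ∀ p ∈ P, part y ≠ part p → ¬ blue y p) : Cy red (2 * ρ + 1) := by
  classical
  let cl : α → Option ι := fun x => if ∃ p ∈ P, part p = part x then some (part x) else none
  have hcl : ∀ x a, cl x = some a → part x = a ∧ ∃ p ∈ P, part p = a := by
    intro x a hx
    simp only [cl] at hx
    split_ifs at hx with h'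
    simp at hx
    subst hx
    exact ⟨rfl, h'⟩
  have hclP : ∀ x ∈ P, cl x = some (part x) := by
    intro x hx
    simp only [cl]
    rw [if_pos ⟨x, hx, rfl⟩]
  have hclne : ∀ x y, cl x ≠ cl y → part x ≠ part y := by
    intro x y hxy he
    apply hxy
    simp only [cl]
    rw [he]
  have key : ∀ u ∈ V, ∀ v ∈ V, cl u ≠ cl v → (∃ p ∈ P, part p = part u) → red u v := by
    rintro u hu v hv huv ⟨p, hpP, hpu⟩
    have hne := hclne _ _ huv
    have hpv : part p ≠ part v := by rw [hpu]; exact hne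
    have : red p v := by
      rcases h.cross p (hVU (hPV hpP)) v (hVU hv) hpv with h' | h'
      · exact h'
      · exact absurd (h.bs _ _ h') (hb v hv p hpP hpv.symm)
    exact h.homR p (hVU (hPV hpP)) u (hVU hu) v (hVU hv) hpu hpv this
  refine lemM h.rs ρ hρ V cl ?_ (by omega) ?_ ?_
  · intro u hu v hv huv
    by_cases hu' : ∃ p ∈ P, part p = part u
    · exact key u hu v hv huv hu'
    · by_cases hv' : ∃ p ∈ P, part p = part v
      · exact h.rs _ _ (key v hv u hu huv.symm hv')
      · exfalso
        apply huv
        simp only [cl]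
        rw [if_neg hu', if_neg hv']
  · intro a
    rcases a with _ | a
    · have : P ⊆ V.filter (fun x => cl x ≠ none) := by
        intro x hx
        simp [hPV hx, hclP x hx]
      have := Finset.card_le_card this
      omega
    · have h1 := card_one_part V part ℓ (ℓ + 1) (hp_mono hp hVU) (by omega) a
      have : V.filter (fun x => part x ≠ a) ⊆ V.filter (fun x => cl x ≠ some a) := by
        intro x hx
        simp only [Finset.mem_filter] at hx ⊢
        exact ⟨hx.1, fun h' => hx.2 (hcl x a h').1⟩
      have := Finset.card_le_card this
      omega
  · have two := card_two_parts V part ℓ (hp_mono hp hVU) hV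
    have one : ∀ a, ∃ u ∈ V, cl u ≠ none ∧ cl u ≠ some a := by
      intro a
      have h1 := card_one_part P part ℓ 1 (hp_mono hp (hPV.trans hVU)) (by omega) a
      obtain ⟨u, hu⟩ := Finset.card_pos.1 h1
      simp only [Finset.mem_filter] at hu
      refine ⟨u, hPV hu.1, ?_, ?_⟩
      · rw [hclP u hu.1]; simp
      · rw [hclP u hu.1]; simpa using hu.2
    obtain ⟨p0, hp0⟩ := Finset.card_pos.1 (by omega : 0 < P.card)
    intro a b
    rcases a with _ | a <;> rcases b with _ | b
    · exact ⟨p0, hPV hp0, by simp [hclP p0 hp0]⟩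
    · exact one b
    · obtain ⟨u, hu, h1, h2⟩ := one a
      exact ⟨u, hu, h2, h1⟩
    · obtain ⟨u, hu, h1, h2⟩ := two a b
      exact ⟨u, hu, fun h' => h1 (hcl _ _ h').1, fun h' => h2 (hcl _ _ h').1⟩

lemma lemS {ι : Type*} [DecidableEq ι] {U : Finset α} {red blue : α → α → Prop} {part : α → ι}
    (h : TC U red blue part) (ℓ ρ : ℕ) (hρ : 1 ≤ ρ) (hρℓ : ρ ≤ ℓ)
    (hp : ∀ a, (U.filter (fun x => part x = a)).card ≤ ℓ) (hU : 4 * ℓ + 1 ≤ U.card)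
    (P1 P2 : Finset α) (hP1 : P1 ⊆ U) (hP2 : P2 ⊆ U) (hd : Disjoint P1 P2)
    (h1 : ℓ + 1 ≤ P1.card) (h2 : ℓ + 1 ≤ P2.card)
    (hb : ∀ p ∈ P1, ∀ q ∈ P2, part p ≠ part q → blue p q) :
    Cy red (2 * ρ + 1) ∨ Cy blue (2 * ρ + 1) := by
  classical
  have hd' := Finset.disjoint_left.1 hd
  by_cases hmeet : ∃ p ∈ P1, ∃ q ∈ P2, part p = part q
  · right
    obtain ⟨p0, hp0, q0, hq0, hpq0⟩ := hmeet
    let M : α → Prop := fun x => (∃ p ∈ P1, part p = part x) ∧ (∃ q ∈ P2, part q = part x)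
    let cl : α → ι ⊕ Bool := fun x => if M x then .inl (part x) else .inr (decide (x ∈ P1))
    have hclM : ∀ x, M x → cl x = .inl (part x) := fun x hx => by simp only [cl]; rw [if_pos hx]
    have hclN : ∀ x, ¬ M x → cl x = .inr (decide (x ∈ P1)) :=
      fun x hx => by simp only [cl]; rw [if_neg hx]
    have hcl : ∀ x a, cl x = .inl a → part x = a := by
      intro x a hx
      by_cases hM : M x
      · rw [hclM x hM] at hx; simpa using hx
      · rw [hclN x hM] at hx; simp at hx
    have hMne : ∀ x y, M x → cl x ≠ cl y → part x ≠ part y := by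
      intro x y hx hxy he
      apply hxy
      have hy : M y := by simp only [M] at hx ⊢; rw [← he]; exact hx
      rw [hclM x hx, hclM y hy, he]
    have key : ∀ u ∈ P1 ∪ P2, ∀ v ∈ P1 ∪ P2, M u → cl u ≠ cl v → blue u v := by
      intro u hu v hv hM huv
      have hne := hMne u v hM huv
      obtain ⟨⟨p, hpP, hpu⟩, ⟨q, hqP, hqu⟩⟩ := hM
      have hU' : ∀ x ∈ P1 ∪ P2, x ∈ U := Finset.union_subset hP1 hP2
      rcases Finset.mem_union.1 hv with hv' | hv'
      · have : blue q v := h.bs _ _ (hb v hv' q hqP (by rw [hqu]; exact hne.symm))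
        exact h.homB q (hP2 hqP) u (hU' u hu) v (hU' v hv) hqu (by rw [hqu]; exact hne) this
      · have : blue p v := hb p hpP v hv' (by rw [hpu]; exact hne)
        exact h.homB p (hP1 hpP) u (hU' u hu) v (hU' v hv) hpu (by rw [hpu]; exact hne) this
    have hcard : (P1 ∪ P2).card = P1.card + P2.card := Finset.card_union_of_disjoint hd
    have hsub : P1 ∪ P2 ⊆ U := Finset.union_subset hP1 hP2
    have hT : ∀ x ∈ P2, cl x ≠ .inr true := by
      intro x hx
      by_cases hM : M x
      · rw [hclM x hM]; simp
      · rw [hclN x hM]; simpa using fun h' => hd' h' hx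
    have hF : ∀ x ∈ P1, cl x ≠ .inr false := by
      intro x hx
      by_cases hM : M x
      · rw [hclM x hM]; simp
      · rw [hclN x hM]; simpa using hx
    refine lemM h.bs ρ hρ (P1 ∪ P2) cl ?_ (by omega) ?_ ?_
    · intro u hu v hv huv
      by_cases hMu : M u
      · exact key u hu v hv hMu huv
      by_cases hMv : M v
      · exact h.bs _ _ (key v hv u hu hMv huv.symm)
      rw [hclN u hMu, hclN v hMv] at huv
      rcases Finset.mem_union.1 hu with hu' | hu' <;> rcases Finset.mem_union.1 hv with hv' | hv'
      · simp [hu', hv'] at huv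
      · exact hb u hu' v hv' (fun he => hMu ⟨⟨u, hu', rfl⟩, ⟨v, hv', he.symm⟩⟩)
      · exact h.bs _ _ (hb v hv' u hu' (fun he => hMu ⟨⟨v, hv', he⟩, ⟨u, hu', rfl⟩⟩))
      · have := fun h' => hd' h' hu'
        have := fun h' => hd' h' hv'
        simp_all
    · intro a
      rcases a with a | (_ | _)
      · have h1 := card_one_part (P1 ∪ P2) part ℓ (ℓ + 1) (hp_mono hp hsub) (by omega) a
        have : (P1 ∪ P2).filter (fun x => part x ≠ a) ⊆ (P1 ∪ P2).filter (fun x => cl x ≠ .inl a) := by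
          intro x hx
          simp only [Finset.mem_filter] at hx ⊢
          exact ⟨hx.1, fun h' => hx.2 (hcl x a h')⟩
        have := Finset.card_le_card this
        omega
      · have : P1 ⊆ (P1 ∪ P2).filter (fun x => cl x ≠ .inr false) := by
          intro x hx
          simp only [Finset.mem_filter, Finset.mem_union]
          exact ⟨Or.inl hx, hF x hx⟩
        have := Finset.card_le_card this
        omega
      · have : P2 ⊆ (P1 ∪ P2).filter (fun x => cl x ≠ .inr true) := by
          intro x hx
          simp only [Finset.mem_filter, Finset.mem_union]
          exact ⟨Or.inr hx, hT x hx⟩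
        have := Finset.card_le_card this
        omega
    · have hM0 : M p0 := ⟨⟨p0, hp0, rfl⟩, ⟨q0, hq0, hpq0.symm⟩⟩
      have two := card_two_parts (P1 ∪ P2) part ℓ (hp_mono hp hsub) (by omega)
      have one : ∀ a s, ∃ u ∈ P1 ∪ P2, cl u ≠ .inl a ∧ cl u ≠ .inr s := by
        intro a s
        rcases s with _ | _
        · have h1 := card_one_part P1 part ℓ 1 (hp_mono hp hP1) (by omega) a
          obtain ⟨u, hu⟩ := Finset.card_pos.1 h1
          simp only [Finset.mem_filter] at hu
          exact ⟨u, by simp [hu.1], fun h' => hu.2 (hcl u a h'), hF u hu.1⟩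
        · have h1 := card_one_part P2 part ℓ 1 (hp_mono hp hP2) (by omega) a
          obtain ⟨u, hu⟩ := Finset.card_pos.1 h1
          simp only [Finset.mem_filter] at hu
          exact ⟨u, by simp [hu.1], fun h' => hu.2 (hcl u a h'), hT u hu.1⟩
      intro a b
      rcases a with a | s <;> rcases b with b | s'
      · obtain ⟨u, hu, h1, h2⟩ := two a b
        exact ⟨u, hu, fun h' => h1 (hcl _ _ h'), fun h' => h2 (hcl _ _ h')⟩
      · exact one a s'
      · obtain ⟨u, hu, h1, h2⟩ := one b s
        exact ⟨u, hu, h2, h1⟩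
      · refine ⟨p0, by simp [hp0], ?_⟩
        rw [hclM p0 hM0]
        simp
  · push Not at hmeet
    have hfull : ∀ p ∈ P1, ∀ q ∈ P2, blue p q := fun p hp q hq => hb p hp q hq (hmeet p hp q hq)
    by_cases hcy : Cy blue (2 * ρ + 1)
    · exact Or.inr hcy
    left
    have i2 : ∀ u ∈ P2, ∀ v ∈ P2, u ≠ v → ¬ blue u v := by
      intro u hu v hv huv hbl
      exact hcy (c1 h.bs ρ hρ P1 P2 hd hfull (by omega) (by omega) u v hu hv huv hbl)
    have i1 : ∀ u ∈ P1, ∀ v ∈ P1, u ≠ v → ¬ blue u v := by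
      intro u hu v hv huv hbl
      exact hcy (c1 h.bs ρ hρ P2 P1 hd.symm (fun p hp q hq => h.bs _ _ (hfull q hq p hp))
        (by omega) (by omega) u v hu hv huv hbl)
    have i3 : ∀ y ∈ U, y ∉ P1 → y ∉ P2 → (∀ p ∈ P1, ¬ blue y p) ∨ (∀ q ∈ P2, ¬ blue y q) := by
      intro y hy hy1 hy2
      by_contra hcon
      push Not at hcon
      obtain ⟨⟨p, hpP, hbp⟩, ⟨q, hqP, hbq⟩⟩ := hcon
      exact hcy (c2 h.bs ρ hρ P1 P2 hd hfull (by omega) (by omega) y p q hy1 hy2 hpP hqP hbp hbq)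
    let V1 := P1 ∪ (U \ (P1 ∪ P2)).filter (fun y => ∀ p ∈ P1, ¬ blue y p)
    let V2 := P2 ∪ (U \ (P1 ∪ P2)).filter (fun y => ∀ p ∈ P2, ¬ blue y p)
    have hcov : U ⊆ V1 ∪ V2 := by
      intro y hy
      simp only [V1, V2, Finset.mem_union, Finset.mem_filter, Finset.mem_sdiff]
      have := i3 y hy
      tauto
    have hc := Finset.card_le_card hcov
    have hc' := Finset.card_union_le V1 V2
    rcases le_or_gt (2 * ℓ + 1) V1.card with hV | hV
    · refine lemS2 h ℓ ρ hρ hρℓ hp P1 V1 Finset.subset_union_left ?_ h1 hV ?_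
      · intro x hx
        simp only [V1, Finset.mem_union, Finset.mem_filter, Finset.mem_sdiff] at hx
        rcases hx with hx | hx
        · exact hP1 hx
        · exact hx.1.1
      · intro y hy p hpP hne
        simp only [V1, Finset.mem_union, Finset.mem_filter, Finset.mem_sdiff] at hy
        rcases hy with hy | hy
        · exact i1 y hy p hpP (fun he => hne (by rw [he]))
        · exact hy.2 p hpP
    · refine lemS2 h ℓ ρ hρ hρℓ hp P2 V2 Finset.subset_union_left ?_ h2 (by omega) ?_
      · intro x hx
        simp only [V2, Finset.mem_union, Finset.mem_filter, Finset.mem_sdiff] at hx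
        rcases hx with hx | hx
        · exact hP2 hx
        · exact hx.1.1
      · intro y hy p hpP hne
        simp only [V2, Finset.mem_union, Finset.mem_filter, Finset.mem_sdiff] at hy
        rcases hy with hy | hy
        · exact i2 y hy p hpP (fun he => hne (by rw [he]))
        · exact hy.2 p hpP
end GR

namespace GR
variable {α : Type*} [DecidableEq α]

lemma Cy.periodic {R : α → α → Prop} {m : ℕ} (h : Cy R m) (hm : 1 ≤ m) :
    ∃ g : ℕ → α, (∀ t, g (t + m) = g t) ∧ (∀ s t, s < t → t < s + m → g s ≠ g t) ∧
      (∀ t, R (g t) (g (t + 1))) := by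
  obtain ⟨g, h1, h2, h3⟩ := h
  refine ⟨fun t => g (t % m), ?_, ?_, ?_⟩
  · intro t; simp
  · intro s t hst ht he
    have hs := Nat.mod_lt s (show m > 0 by omega)
    have ht' := Nat.mod_lt t (show m > 0 by omega)
    have hne : s % m ≠ t % m := by
      intro he
      have : m ∣ t - s := (Nat.modEq_iff_dvd' hst.le).1 he
      have := Nat.le_of_dvd (by omega) this
      omega
    rcases lt_or_gt_of_ne hne with h | h
    · exact h1 _ _ h ht' he
    · exact h1 _ _ h hs he.symm
  · intro t
    have ht' := Nat.mod_lt t (show m > 0 by omega)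
    simp only
    rw [Nat.add_mod_eq_ite]
    rcases Nat.lt_or_ge m 2 with hm2 | hm2
    · obtain rfl : m = 1 := by omega
      simp [Nat.mod_one] at h3 ⊢
      exact h3
    · rw [Nat.mod_eq_of_lt (show 1 < m by omega)]
      split_ifs with hc
      · have e : t % m = m - 1 := by omega
        rw [e]
        have : m - 1 + 1 - m = 0 := by omega
        rw [this]
        exact h3
      · exact h2 _ (by omega)

lemma insert_edge {R : α → α → Prop} {m : ℕ} (hm : 1 ≤ m) (g : ℕ → α)
    (hp : ∀ t, g (t + m) = g t)
    (hd : ∀ s t, s < t → t < s + m → g s ≠ g t) (hR : ∀ t, R (g t) (g (t + 1))) (i : ℕ) (z z' : α)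
    (hz : ∀ t, g t ≠ z) (hz' : ∀ t, g t ≠ z') (hzz : z ≠ z') (h1 : R (g i) z) (h2 : R z z')
    (h3 : R z' (g (i + 1))) : Cy R (m + 2) := by
  refine ⟨fun t => if t < m then g (i + 1 + t) else if t = m then z else z', ?_, ?_, ?_⟩
  · intro s t hst ht
    simp only
    split_ifs <;> first | omega | skip
    · exact hd _ _ (by omega) (by omega)
    · exact hz _
    · exact hz' _
  · intro t ht
    simp only
    split_ifs <;> first | omega | skip
    · exact hR _
    · have : i + 1 + t = i + m := by omega
      rw [this, hp]; exact h1
  · have : m + 2 - 1 = m + 1 := by omega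
    simp only [this]
    simp only [show ¬ (m + 1 < m) by omega, show ¬ (m + 1 = m) by omega, show 0 < m by omega, if_true, if_false]
    exact h3

lemma insert_two {R : α → α → Prop} {m : ℕ} (hm : 1 ≤ m) (g : ℕ → α)
    (hp : ∀ t, g (t + m) = g t)
    (hd : ∀ s t, s < t → t < s + m → g s ≠ g t) (hR : ∀ t, R (g t) (g (t + 1))) (i d : ℕ)
    (hdm : d + 1 < m) (z z' : α)
    (hz : ∀ t, g t ≠ z) (hz' : ∀ t, g t ≠ z') (hzz : z ≠ z') (h1 : R (g i) z) (h2 : R z (g (i + 1)))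
    (h3 : R (g (i + 1 + d)) z') (h4 : R z' (g (i + 1 + d + 1))) : Cy R (m + 2) := by
  refine ⟨fun t => if t ≤ d then g (i + 1 + t) else if t = d + 1 then z' else
    if t ≤ m then g (i + t) else z, ?_, ?_, ?_⟩
  · intro s t hst ht
    simp only
    split_ifs <;> first | omega | skip
    · exact hd _ _ (by omega) (by omega)
    · exact hz' _
    · exact hd _ _ (by omega) (by omega)
    · exact hz _
    · exact (hz' _).symm
    · exact hzz.symm
    · exact hd _ _ (by omega) (by omega)
    · exact hz _
  · intro t ht
    simp only
    split_ifs <;> first | omega | skip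
    · exact hR _
    · have : t = d := by omega
      subst this; exact h3
    · have : i + (t + 1) = i + 1 + d + 1 := by omega
      rw [this]; exact h4
    · exact hR _
    · have : i + t = i + m := by omega
      rw [this, hp]; exact h1
  · have : m + 2 - 1 = m + 1 := by omega
    simp only [this]
    simp only [show ¬ (m + 1 ≤ d) by omega, show ¬ (m + 1 = d + 1) by omega,
      show ¬ (m + 1 ≤ m) by omega, show 0 ≤ d by omega, if_true, if_false]
    exact h2

lemma disj_subsets (A B : Finset α) (a : ℕ) (hA : a ≤ A.card) (hB : a ≤ B.card)
    (hAB : 2 * a ≤ (A ∪ B).card) : ∃ A' B', A' ⊆ A ∧ B' ⊆ B ∧ Disjoint A' B' ∧ a ≤ A'.card ∧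
      a ≤ B'.card := by
  rcases le_or_gt a (A \ B).card with h | h
  · exact ⟨A \ B, B, Finset.sdiff_subset, subset_rfl, Finset.sdiff_disjoint, h, hB⟩
  · obtain ⟨A', h1, h2, h3⟩ := Finset.exists_subsuperset_card_eq (Finset.sdiff_subset (s := A) (t := B)) h.le hA
    refine ⟨A', B \ A', h2, Finset.sdiff_subset, Finset.disjoint_sdiff, h3.ge, ?_⟩
    have : (A ∪ B) \ A' ⊆ B \ A' := by
      intro x hx
      simp only [Finset.mem_sdiff, Finset.mem_union] at hx ⊢
      refine ⟨?_, hx.2⟩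
      by_contra hxB
      exact hx.2 (h1 (by simp only [Finset.mem_sdiff]; tauto))
    have h4 := Finset.card_le_card this
    have h5 := Finset.le_card_sdiff A' (A ∪ B)
    omega

/-- greedy blue path through prescribed vertices -/
lemma greedy {B : α → α → Prop} (hs : ∀ u v, B u v → B v u) (Z : Finset α) (N : α → Finset α)
    (hNZ : ∀ g, N g ⊆ Z)
    (hN : ∀ g, ∀ z ∈ N g, B g z) (K : ℕ) (gs : List α) : ∀ (g : α) (F : Finset α),
    (g :: gs).Nodup → (∀ x ∈ g :: gs, x ∉ Z) →
    (∀ x ∈ g :: gs, ∀ y ∈ g :: gs, x ≠ y → K ≤ (N x ∩ N y).card) → F.card + gs.length ≤ K →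
    ∃ l : List α, l.length = 2 * gs.length + 1 ∧ l.Nodup ∧ l.IsChain B ∧
      l.head? = some g ∧ l.getLast? = (g :: gs).getLast? ∧
      (∀ x ∈ l, x ∈ Z → x ∉ F) ∧ (∀ x ∈ l, x ∉ Z → x ∈ g :: gs) ∧ (l.filter (· ∈ Z)).length = gs.length := by
  induction gs with
  | nil =>
    intro g F h1 h2 h3 h4
    have := h2 g (by simp)
    exact ⟨[g], by simp [this]⟩
  | cons g' gs ih =>
    intro g F h1 h2 h3 h4
    have hgg' : g ≠ g' := by simp at h1; tauto
    have hc := h3 g (by simp) g' (by simp) hgg'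
    have : 0 < ((N g ∩ N g') \ F).card := by
      have := Finset.le_card_sdiff F (N g ∩ N g')
      simp at h4
      omega
    obtain ⟨z, hz⟩ := Finset.card_pos.1 this
    simp only [Finset.mem_sdiff, Finset.mem_inter] at hz
    have hzZ : z ∈ Z := hNZ g hz.1.1
    have hgZ : g ∉ Z := h2 g (by simp)
    have h1' := (List.nodup_cons.1 h1)
    obtain ⟨l, a1, a2, a3, a4, a5, a6, a7, a8⟩ := ih g' (insert z F) h1'.2
      (fun x hx => h2 x (List.mem_cons_of_mem _ hx))
      (fun x hx y hy => h3 x (List.mem_cons_of_mem _ hx) y (List.mem_cons_of_mem _ hy))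
      (by rw [Finset.card_insert_of_notMem hz.2]; simp at h4; omega)
    have hzl : z ∉ l := fun h => a6 z h hzZ (by simp)
    have hgl : g ∉ l := fun h => h1'.1 (a7 g h hgZ)
    have hgz : g ≠ z := by rintro rfl; exact hgZ hzZ
    have hlne : l ≠ [] := by rintro rfl; simp at a1
    refine ⟨g :: z :: l, by simp [a1]; omega, ?_, ?_, by simp, ?_, ?_, ?_, ?_⟩
    · simp [hgz, hgl, hzl, a2]
    · rw [List.isChain_cons, List.isChain_cons]
      refine ⟨by simpa using hN g z hz.1.1, ?_, a3⟩
      rw [a4]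
      simpa using hs _ _ (hN g' z hz.1.2)
    · rw [List.getLast?_cons_of_ne_nil (by simp), List.getLast?_cons_of_ne_nil hlne, a5,
        List.getLast?_cons_of_ne_nil (xs := g' :: gs) (by simp)]
    · intro x hx hxZ
      simp only [List.mem_cons] at hx
      rcases hx with rfl | rfl | hx
      · exact absurd hxZ hgZ
      · exact hz.2
      · have := a6 x hx hxZ
        simp at this
        tauto
    · intro x hx hxZ
      simp only [List.mem_cons] at hx
      rcases hx with rfl | rfl | hx
      · simp
      · exact absurd hzZ hxZ
      · exact List.mem_cons_of_mem _ (a7 x hx hxZ)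
    · simp [hgZ, hzZ, a8]
end GR

namespace GR
variable {α : Type*} [DecidableEq α]

lemma W_base {ι : Type*} [DecidableEq ι] {U : Finset α} {red blue : α → α → Prop} {part : α → ι}
    (h : TC U red blue part) (ℓ : ℕ) (hℓ : 1 ≤ ℓ)
    (hp : ∀ a, (U.filter (fun x => part x = a)).card ≤ ℓ) (hU : 4 * ℓ + 1 ≤ U.card) (v : α)
    (X : Finset α) (hXU : X ⊆ U) (hX : 2 * ℓ + 2 ≤ X.card) (hv : ∀ x ∈ X, x ≠ v ∧ red v x) :
    Cy red 3 ∨ Cy blue 3 := by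
  obtain ⟨P, hPX, hP⟩ := Finset.exists_subset_card_eq (by omega : ℓ + 1 ≤ X.card)
  by_contra hcon
  push Not at hcon
  have := lemS h ℓ 1 le_rfl hℓ hp hU P (X \ P) (hPX.trans hXU) (Finset.sdiff_subset.trans hXU)
    Finset.disjoint_sdiff (by omega) (by rw [Finset.card_sdiff_of_subset hPX]; omega) ?_
  · exact this.elim hcon.1 hcon.2
  · intro p hpP q hq hne
    have hqX := (Finset.mem_sdiff.1 hq).1
    rcases h.cross p (hXU (hPX hpP)) q (hXU hqX) hne with hr | hb
    · exfalso
      apply hcon.1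
      have hpv := hv p (hPX hpP)
      have hqv := hv q hqX
      refine CyL.cy (l := [v, p, q]) ⟨?_, ?_, ?_⟩ (by simp) (by omega)
      · have : p ≠ q := fun he => hne (by rw [he])
        simp [this, hpv.1.symm, hqv.1.symm]
      · simp [hpv.2, hr]
      · simpa using h.rs _ _ hqv.2
    · exact hb

lemma W_step {ι : Type*} [DecidableEq ι] {U : Finset α} {red blue : α → α → Prop} {part : α → ι}
    (h : TC U red blue part) (hrU : ∀ u v, red u v → u ∈ U) (ℓ ρ : ℕ) (hρ : 1 ≤ ρ)
    (hρℓ : ρ + 1 ≤ ℓ)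
    (hp : ∀ a, (U.filter (fun x => part x = a)).card ≤ ℓ) (hU : 7 * ℓ + 2 ≤ U.card)
    (hc : Cy red (2 * ρ + 1)) : Cy red (2 * (ρ + 1) + 1) ∨ Cy blue (2 * (ρ + 1) + 1) := by
  classical
  by_contra hcon
  rw [not_or] at hcon
  obtain ⟨hnr, hnb⟩ := hcon
  obtain ⟨g, gp, gd, gR⟩ := hc.periodic (by omega)
  set m := 2 * ρ + 1 with hm
  have gmod : ∀ t, g (t % m) = g t := fun t => Function.Periodic.map_mod_nat (f := g) gp t
  have ginj : ∀ i < m, ∀ j < m, g i = g j → i = j := by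
    intro i hi j hj he
    rcases lt_trichotomy i j with h' | h' | h'
    · exact absurd he (gd _ _ h' (by omega))
    · exact h'
    · exact absurd he.symm (gd _ _ h' (by omega))
  have gU : ∀ t, g t ∈ U := fun t => hrU _ _ (gR t)
  let Γ := (Finset.range m).image g
  have hΓ : ∀ t, g t ∈ Γ := by
    intro t
    rw [← gmod]
    exact Finset.mem_image_of_mem _ (Finset.mem_range.2 (Nat.mod_lt _ (by omega)))
  have hΓc : Γ.card ≤ m := Finset.card_image_le.trans (by simp)
  let Z := U \ Γ
  have hZU : Z ⊆ U := Finset.sdiff_subset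
  have hZc : 5 * ℓ + 3 ≤ Z.card := by
    have := Finset.le_card_sdiff Γ U
    simp only [Z]
    omega
  have gZ : ∀ t, g t ∉ Z := fun t ht => (Finset.mem_sdiff.1 ht).2 (hΓ t)
  have gz : ∀ z ∈ Z, ∀ t, g t ≠ z := fun z hz t he => gZ t (he ▸ hz)
  let X : ℕ → Finset α := fun i => Z.filter (fun z => red (g i) z)
  have hX : ∀ i z, z ∈ X i ↔ z ∈ Z ∧ red (g i) z := fun i z => by simp [X]
  have hXZ : ∀ i, X i ⊆ Z := fun i => Finset.filter_subset _ _
  have hno : ∀ i, ∀ z ∈ X i, ∀ z' ∈ X (i + 1), z ≠ z' → ¬ red z z' := by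
    intro i z hz z' hz' hne hr
    rw [hX] at hz hz'
    exact hnr (insert_edge (m := m) (by omega) g gp gd gR i z z' (gz z hz.1) (gz z' hz'.1) hne hz.2 hr
      (h.rs _ _ hz'.2))
  have hdis : ∀ i A B, A ⊆ X i → B ⊆ X (i + 1) → Disjoint A B → ℓ + 1 ≤ A.card → ℓ + 1 ≤ B.card →
      False := by
    intro i A B hA hB hAB hAc hBc
    have := lemS h ℓ (ρ + 1) (by omega) hρℓ hp (by omega) A B ((hA.trans (hXZ i)).trans hZU)
      ((hB.trans (hXZ _)).trans hZU) hAB hAc hBc ?_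
    · exact this.elim hnr hnb
    · intro p hpA q hq hne
      rcases h.cross p (hZU (hXZ _ (hA hpA))) q (hZU (hXZ _ (hB hq))) hne with hr | hb
      · exact absurd hr (hno i p (hA hpA) q (hB hq) (fun he => hne (by rw [he])))
      · exact hb
  have hun : ∀ i, ℓ + 2 ≤ (X i).card → ℓ + 2 ≤ (X (i + 1)).card →
      (X i ∪ X (i + 1)).card ≤ 2 * ℓ + 1 := by
    intro i h1 h2
    by_contra h3
    obtain ⟨A, B, a1, a2, a3, a4, a5⟩ := disj_subsets (X i) (X (i + 1)) (ℓ + 1) (by omega)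
      (by omega) (by omega)
    exact hdis i A B a1 a2 a3 a4 a5
  have hinter : ∀ i, ℓ + 2 ≤ (X i).card → ℓ + 2 ≤ (X (i + 1)).card →
      1 < (X i ∩ X (i + 1)).card := by
    intro i h1 h2
    have := hun i h1 h2
    have := Finset.card_union_add_card_inter (X i) (X (i + 1))
    omega
  have hone : ∀ i j, i < j → j < m → ℓ + 2 ≤ (X i).card → ℓ + 2 ≤ (X (i + 1)).card →
      ℓ + 2 ≤ (X j).card → ℓ + 2 ≤ (X (j + 1)).card → False := by
    intro i j hij hj h1 h2 h3 h4
    obtain ⟨z, hz⟩ := Finset.card_pos.1 (by have := hinter i h1 h2; omega : 0 < (X i ∩ X (i + 1)).card)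
    obtain ⟨z', hz', hne⟩ := Finset.exists_mem_ne (hinter j h3 h4) z
    rw [Finset.mem_inter, hX, hX] at hz hz'
    obtain ⟨d, rfl⟩ : ∃ d, j = i + 1 + d := ⟨j - i - 1, by omega⟩
    exact hnr (insert_two (m := m) (by omega) g gp gd gR i d (by omega) z z' (gz z hz.1.1) (gz z' hz'.1.1)
      hne.symm hz.1.2 (h.rs _ _ hz.2.2) hz'.1.2 (h.rs _ _ hz'.2.2))
  have hXmod : ∀ i, X (i % m) = X i := fun i => by simp only [X]; rw [gmod]
  -- selection of good vertices
  have hsel : ∃ a < m, (X a).card ≤ 2 * ℓ + 1 ∧ ∃ G ⊆ Finset.range m, a ∉ G ∧ G.card = ρ ∧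
      ∀ i ∈ G, (X i).card ≤ ℓ + 1 := by
    let N := (Finset.range m).filter (fun i => ¬ (X i).card ≤ ℓ + 1)
    let Gd := (Finset.range m).filter (fun i => (X i).card ≤ ℓ + 1)
    have hsum : Gd.card + N.card = m := by
      have := Finset.card_filter_add_card_filter_not (s := Finset.range m) (fun i => (X i).card ≤ ℓ + 1)
      rw [Finset.card_range] at this
      exact this
    let N' := N.filter (fun i => (X (i + 1)).card ≤ ℓ + 1)
    let N'' := N.filter (fun i => ¬ (X (i + 1)).card ≤ ℓ + 1)
    have hsum' : N'.card + N''.card = N.card :=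
      Finset.card_filter_add_card_filter_not (s := N) (fun i => (X (i + 1)).card ≤ ℓ + 1)
    have hN' : N'.card ≤ Gd.card := by
      refine Finset.card_le_card_of_injOn (fun i => (i + 1) % m) ?_ ?_
      · intro i hi
        simp only [N', N, Finset.coe_filter, Finset.mem_filter, Finset.mem_range, Set.mem_ofPred_eq] at hi
        simp only [Gd, Finset.coe_filter, Finset.mem_range, Set.mem_ofPred_eq]
        refine ⟨Nat.mod_lt _ (by omega), ?_⟩
        rw [hXmod]
        exact hi.2
      · intro i hi j hj he
        simp only [N', N, Finset.coe_filter, Finset.mem_filter, Finset.mem_range, Set.mem_ofPred_eq] at hi hj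
        have e : g (i + 1) = g (j + 1) := by rw [← gmod (i + 1), ← gmod (j + 1)]; simp only at he; rw [he]
        rcases lt_trichotomy i j with h' | h' | h'
        · exact absurd e (gd _ _ (by omega) (by omega))
        · exact h'
        · exact absurd e.symm (gd _ _ (by omega) (by omega))
    have memN'' : ∀ i, i ∈ N'' ↔ i < m ∧ ℓ + 2 ≤ (X i).card ∧ ℓ + 2 ≤ (X (i + 1)).card := by
      intro i
      simp only [N'', N, Finset.mem_filter, Finset.mem_range]
      constructor
      · rintro ⟨⟨h1, h2⟩, h3⟩; omega
      · rintro ⟨h1, h2, h3⟩; omega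
    have hN'' : N''.card ≤ 1 := by
      rw [Finset.card_le_one]
      intro i hi j hj
      rw [memN''] at hi hj
      rcases lt_trichotomy i j with h' | h' | h'
      · exact (hone i j h' hj.1 hi.2.1 hi.2.2 hj.2.1 hj.2.2).elim
      · exact h'
      · exact (hone j i h' hi.1 hj.2.1 hj.2.2 hi.2.1 hi.2.2).elim
    have mem_Gd : ∀ i ∈ Gd, i < m ∧ (X i).card ≤ ℓ + 1 := by
      intro i hi
      simpa [Gd] using hi
    rcases N''.eq_empty_or_nonempty with he | ⟨a, ha⟩
    · rw [he, Finset.card_empty] at hsum'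
      obtain ⟨a, ha⟩ := Finset.card_pos.1 (by omega : 0 < Gd.card)
      obtain ⟨G, hG, hGc⟩ := Finset.exists_subset_card_eq
        (by rw [Finset.card_erase_of_mem ha]; omega : ρ ≤ (Gd.erase a).card)
      refine ⟨a, (mem_Gd a ha).1, by have := (mem_Gd a ha).2; omega, G, ?_, ?_, hGc, ?_⟩
      · intro i hi
        exact Finset.mem_range.2 (mem_Gd i (Finset.mem_of_mem_erase (hG hi))).1
      · intro hi
        exact Finset.notMem_erase a _ (hG hi)
      · intro i hi
        exact (mem_Gd i (Finset.mem_of_mem_erase (hG hi))).2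
    · rw [memN''] at ha
      obtain ⟨G, hG, hGc⟩ := Finset.exists_subset_card_eq (by omega : ρ ≤ Gd.card)
      refine ⟨a, ha.1, ?_, G, ?_, ?_, hGc, ?_⟩
      · exact (Finset.card_le_card Finset.subset_union_left).trans (hun a ha.2.1 ha.2.2)
      · intro i hi
        exact Finset.mem_range.2 (mem_Gd i (hG hi)).1
      · intro hi
        have := (mem_Gd a (hG hi)).2
        omega
      · intro i hi
        exact (mem_Gd i (hG hi)).2
  obtain ⟨a, ham, hXa, G, hGm, haG, hGc, hGX⟩ := hsel
  let N : α → Finset α := fun x => Z.filter (fun z => blue x z)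
  have hNZ : ∀ x, N x ⊆ Z := fun x => Finset.filter_subset _ _
  have hN : ∀ x, ∀ z ∈ N x, blue x z := fun x z hz => by simp [N] at hz; exact hz.2
  have hNc : ∀ i, Z.card + 1 ≤ (N (g i)).card + (X i).card + ℓ := by
    intro i
    have h1 : Z ⊆ N (g i) ∪ X i ∪ Z.filter (fun x => part x = part (g i)) := by
      intro z hz
      simp only [N, X, Finset.mem_union, Finset.mem_filter]
      by_cases he : part z = part (g i)
      · tauto
      · have := h.cross (g i) (gU i) z (hZU hz) (fun h' => he h'.symm)
        tauto
    have h2 := Finset.card_le_card h1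
    have h3 := Finset.card_union_le (N (g i) ∪ X i) (Z.filter (fun x => part x = part (g i)))
    have h4 := Finset.card_union_le (N (g i)) (X i)
    have h5 : insert (g i) (Z.filter (fun x => part x = part (g i))) ⊆
        U.filter (fun x => part x = part (g i)) := by
      intro x hx
      simp only [Finset.mem_insert, Finset.mem_filter] at hx ⊢
      rcases hx with rfl | hx
      · exact ⟨gU i, rfl⟩
      · exact ⟨hZU hx.1, hx.2⟩
    have h6 := Finset.card_le_card h5
    rw [Finset.card_insert_of_notMem (by simp [gZ i])] at h6
    have := hp (part (g i))
    omega
  have hNi : ∀ x y, (N x).card + (N y).card ≤ (N x ∩ N y).card + Z.card := by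
    intro x y
    have h1 := Finset.card_union_add_card_inter (N x) (N y)
    have h2 := Finset.card_le_card (Finset.union_subset (hNZ x) (hNZ y))
    omega
  -- list of good vertices
  obtain ⟨js, hjs⟩ : ∃ js : List ℕ, js = G.toList := ⟨_, rfl⟩
  have hjl : js.length = ρ := by rw [hjs]; simpa using hGc
  have hjm : ∀ j ∈ js, j ∈ G := by rw [hjs]; simp
  have hjn : js.Nodup := by rw [hjs]; exact G.nodup_toList
  rcases js with _ | ⟨b, bs⟩
  · simp at hjl; omega
  have hgs : ((b :: bs).map g).Nodup := by
    refine List.Nodup.map_on ?_ hjn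
    intro x hx y hy he
    exact ginj x (Finset.mem_range.1 (hGm (hjm x hx))) y (Finset.mem_range.1 (hGm (hjm y hy))) he
  have hgood : ∀ x ∈ (b :: bs).map g, Z.card ≤ (N x).card + 2 * ℓ := by
    intro x hx
    obtain ⟨j, hj, rfl⟩ := List.mem_map.1 hx
    have := hGX j (hjm j hj)
    have := hNc j
    omega
  have hxZ : ∀ x ∈ (b :: bs).map g, x ∉ Z := by
    intro x hx
    obtain ⟨j, hj, rfl⟩ := List.mem_map.1 hx
    exact gZ j
  have hane : ∀ x ∈ (b :: bs).map g, g a ≠ x := by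
    intro x hx
    obtain ⟨j, hj, rfl⟩ := List.mem_map.1 hx
    intro he
    have := ginj a ham j (Finset.mem_range.1 (hGm (hjm j hj))) he
    subst this
    exact haG (hjm a hj)
  have hNa := hNc a
  obtain ⟨z1, hz1⟩ := Finset.card_pos.1 (by
    have := hNi (g a) (g b)
    have := hgood (g b) (by simp)
    omega : 0 < (N (g a) ∩ N (g b)).card)
  rw [Finset.mem_inter] at hz1
  have hz1Z : z1 ∈ Z := hNZ _ hz1.1
  rw [List.map_cons] at hgs hgood hxZ hane
  obtain ⟨l, l1, l2, l3, l4, l5, l6, l7, l8⟩ := greedy h.bs Z N hNZ hN (ℓ + 3) (bs.map g) (g b) {z1} hgs hxZ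
    (by
      intro x hx y hy hxy
      have := hNi x y
      have := hgood x hx
      have := hgood y hy
      omega) (by simp at hjl ⊢; omega)
  have hlne : l ≠ [] := by rintro rfl; simp at l1
  let L := g a :: z1 :: l
  obtain ⟨e, he⟩ : ∃ e, l.getLast? = some e := by
    rw [l5]; exact ⟨_, List.getLast?_eq_some_getLast (by simp)⟩
  have heg : e ∈ g b :: bs.map g := by
    rw [l5] at he
    exact List.mem_of_getLast? he
  have hused : ((N (g a)) \ ((L.filter (· ∈ Z)).toFinset)).card + ρ ≥ (N (g a)).card ∧
      ((N e) \ ((L.filter (· ∈ Z)).toFinset)).card + ρ ≥ (N e).card := by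
    have h1 : (L.filter (· ∈ Z)).toFinset.card ≤ ρ := by
      refine (List.toFinset_card_le _).trans ?_
      simp only [L, List.filter_cons, gZ a, hz1Z]
      simp at hjl l8 ⊢
      omega
    have := Finset.le_card_sdiff (L.filter (· ∈ Z)).toFinset (N (g a))
    have := Finset.le_card_sdiff (L.filter (· ∈ Z)).toFinset (N e)
    omega
  set U0 := (N (g a)) \ ((L.filter (· ∈ Z)).toFinset) with hU0
  set U1 := (N e) \ ((L.filter (· ∈ Z)).toFinset) with hU1
  have mem0 : ∀ x ∈ U0, x ∈ Z ∧ blue (g a) x ∧ x ∉ L := by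
    intro x hx
    rw [hU0, Finset.mem_sdiff] at hx
    have hxZ := hNZ _ hx.1
    refine ⟨hxZ, hN _ _ hx.1, fun h' => hx.2 ?_⟩
    simp [h', hxZ]
  have mem1 : ∀ x ∈ U1, x ∈ Z ∧ blue e x ∧ x ∉ L := by
    intro x hx
    rw [hU1, Finset.mem_sdiff] at hx
    have hxZ := hNZ _ hx.1
    refine ⟨hxZ, hN _ _ hx.1, fun h' => hx.2 ?_⟩
    simp [h', hxZ]
  have hNe := hgood e heg
  obtain ⟨P, hPX, hP⟩ := Finset.exists_subset_card_eq (by omega : ℓ + 1 ≤ U0.card)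
  have := lemS h.symm ℓ (ρ + 1) (by omega) hρℓ hp (by omega) P (U1 \ P)
    (fun x hx => hZU (mem0 x (hPX hx)).1) (fun x hx => hZU (mem1 x (Finset.mem_sdiff.1 hx).1).1)
    Finset.disjoint_sdiff (by omega) (by have := Finset.le_card_sdiff P U1; omega) ?_
  · exact this.elim hnb hnr
  intro p hpP q hq hne
  have hp0 := mem0 p (hPX hpP)
  have hq0 := mem1 q (Finset.mem_sdiff.1 hq).1
  rcases h.cross p (hZU hp0.1) q (hZU hq0.1) hne with hr | hb
  · exact hr
  exfalso
  apply hnb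
  have hpq : p ≠ q := fun he => hne (by rw [he])
  have hgal : g a ∉ l := by
    intro hh
    exact hane _ (l7 _ hh (gZ a)) rfl
  have hz1l : z1 ∉ l := fun hh => l6 _ hh hz1Z (by simp)
  refine CyL.cy (l := (p :: L) ++ [q]) ⟨?_, ?_, ?_⟩ (by simp [L, l1] at hjl ⊢; omega) (by omega)
  · rw [List.nodup_append']
    have hne1 : g a ≠ z1 := gz z1 hz1Z a
    refine ⟨?_, by simp, ?_⟩
    · rw [List.nodup_cons]
      refine ⟨hp0.2.2, ?_⟩
      simp [L, hne1, hgal, hz1l, l2]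
    · intro x hx hx'
      simp only [List.mem_singleton] at hx'
      subst hx'
      rw [List.mem_cons] at hx
      rcases hx with rfl | hx
      · exact hpq rfl
      · exact hq0.2.2 hx
  · rw [List.isChain_append]
    refine ⟨?_, by simp, ?_⟩
    · simp only [L, List.isChain_cons]
      refine ⟨by simpa using h.bs _ _ hp0.2.1, by simpa using hN _ _ hz1.1, ?_, l3⟩
      rw [l4]
      simpa using h.bs _ _ (hN _ _ hz1.2)
    · intro x hx y hy
      simp at hy
      subst hy
      simp only [L] at hx
      rw [List.getLast?_cons_of_ne_nil (by simp), List.getLast?_cons_of_ne_nil (by simp),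
        List.getLast?_cons_of_ne_nil hlne, he] at hx
      simp at hx
      subst hx
      exact hq0.2.1
  · intro x hx y hy
    rw [List.getLast?_append_of_ne_nil _ (by simp)] at hx
    simp at hx hy
    subst hx hy
    exact h.bs _ _ hb

lemma W_lemma {ι : Type*} [DecidableEq ι] {U : Finset α} {red blue : α → α → Prop} {part : α → ι}
    (h : TC U red blue part) (hrU : ∀ u v, red u v → u ∈ U) (hbU : ∀ u v, blue u v → u ∈ U)
    (ℓ ρ : ℕ) (hρ : 1 ≤ ρ) (hρℓ : ρ ≤ ℓ)
    (hp : ∀ a, (U.filter (fun x => part x = a)).card ≤ ℓ) (hU : 7 * ℓ + 2 ≤ U.card) :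
    Cy red (2 * ρ + 1) ∨ Cy blue (2 * ρ + 1) := by
  classical
  induction ρ, hρ using Nat.le_induction with
  | base =>
    obtain ⟨v, hv⟩ := Finset.card_pos.1 (by omega : 0 < U.card)
    have h1 := card_one_part U part ℓ (4 * ℓ + 4) hp (by omega) (part v)
    let Y := U.filter (fun x => part x ≠ part v)
    have h2 := Finset.card_filter_add_card_filter_not (s := Y) (fun x => red v x)
    have hY : ∀ x ∈ Y, x ∈ U ∧ part x ≠ part v := fun x hx => by simpa [Y] using hx
    rcases le_or_gt (2 * ℓ + 2) (Y.filter (fun x => red v x)).card with h3 | h3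
    · refine W_base h ℓ hρℓ hp (by omega) v _ ?_ h3 ?_
      · exact (Finset.filter_subset _ _).trans (Finset.filter_subset _ _)
      · intro x hx
        rw [Finset.mem_filter] at hx
        exact ⟨fun he => (hY x hx.1).2 (by rw [he]), hx.2⟩
    · refine (W_base h.symm ℓ hρℓ hp (by omega) v (Y.filter (fun x => ¬ red v x)) ?_ ?_ ?_).symm
      · exact (Finset.filter_subset _ _).trans (Finset.filter_subset _ _)
      · simp only [Y] at h2 h3 ⊢; omega
      · intro x hx
        rw [Finset.mem_filter] at hx
        have hx' := hY x hx.1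
        refine ⟨fun he => hx'.2 (by rw [he]), ?_⟩
        rcases h.cross v hv x hx'.1 hx'.2.symm with h' | h'
        · exact absurd h' hx.2
        · exact h'
  | succ ρ hρ ih =>
    rcases ih (by omega) with h' | h'
    · exact W_step h hrU ℓ ρ hρ hρℓ hp hU h'
    · exact (W_step h.symm hbU ℓ ρ hρ hρℓ hp hU h').symm
end GR

namespace GR
variable {α : Type*} [DecidableEq α]

structure BC (U : Finset α) (red blue : α → α → Prop) : Prop where
  rs : ∀ u v, red u v → red v u
  bs : ∀ u v, blue u v → blue v u
  cross : ∀ u ∈ U, ∀ v ∈ U, u ≠ v → red u v ∨ blue u v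
  rU : ∀ u v, red u v → u ∈ U
  bU : ∀ u v, blue u v → u ∈ U

lemma BC.symm {U : Finset α} {red blue : α → α → Prop} (h : BC U red blue) : BC U blue red :=
  ⟨h.bs, h.rs, fun u hu v hv e => (h.cross u hu v hv e).symm, h.bU, h.rU⟩

lemma clique_list {R : α → α → Prop} (S : Finset α) (hS : ∀ x ∈ S, ∀ y ∈ S, x ≠ y → R x y) (n : ℕ)
    (hn : n ≤ S.card) :
    ∃ l : List α, l.length = n ∧ l.Nodup ∧ l.IsChain R ∧ ∀ x ∈ l, x ∈ S := by
  obtain ⟨T, hT, hTc⟩ := Finset.exists_subset_card_eq hn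
  refine ⟨T.toList, by simpa using hTc, T.nodup_toList, ?_, fun x hx => hT (by simpa using hx)⟩
  apply List.Pairwise.isChain
  refine List.Pairwise.imp_of_mem ?_ T.nodup_toList
  intro a b ha hb hab
  exact hS a (hT (by simpa using ha)) b (hT (by simpa using hb)) hab

lemma clique_path {R : α → α → Prop} (S : Finset α) (hS : ∀ x ∈ S, ∀ y ∈ S, x ≠ y → R x y) (n : ℕ)
    (u v : α) (hu : u ∈ S) (hv : v ∈ S) (huv : u ≠ v) (hn : n + 2 ≤ S.card) :
    ∃ l : List α, l.length = n + 2 ∧ l.Nodup ∧ l.IsChain R ∧ (∀ x ∈ l, x ∈ S) ∧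
      l.head? = some u ∧ l.getLast? = some v := by
  obtain ⟨l, l1, l2, l3, l4⟩ := clique_list (R := R) (S \ {u, v}) (fun x hx y hy => hS x (Finset.mem_sdiff.1 hx).1 y
    (Finset.mem_sdiff.1 hy).1) n (by
      have := Finset.le_card_sdiff {u, v} S
      have h2 : ({u, v} : Finset α).card = 2 := Finset.card_pair huv
      omega)
  simp only [Finset.mem_sdiff, Finset.mem_insert, Finset.mem_singleton, not_or] at l4
  have hnd : (u :: (l ++ [v])).Nodup := by
    rw [List.nodup_cons, List.nodup_append']
    refine ⟨?_, l2, by simp, ?_⟩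
    · simp only [List.mem_append, List.mem_singleton, not_or]
      exact ⟨fun h => (l4 u h).2.1 rfl, huv⟩
    · intro x hx hx'
      simp at hx'
      exact (l4 x hx).2.2 hx'
  have hmem : ∀ x ∈ u :: (l ++ [v]), x ∈ S := by
    intro x hx
    simp at hx
    rcases hx with rfl | hx | rfl
    · exact hu
    · exact (l4 x hx).1
    · exact hv
  refine ⟨u :: (l ++ [v]), by simp [l1], hnd, ?_, hmem, by simp, ?_⟩
  · apply List.Pairwise.isChain
    refine List.Pairwise.imp_of_mem ?_ hnd
    intro a b ha hb hab
    exact hS a (hmem a ha) b (hmem b hb) hab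
  · rw [← List.cons_append, List.getLast?_append_of_ne_nil _ (by simp)]
    simp

lemma cy_two_lists {R : α → α → Prop} (l l' : List α) (n : ℕ) (hn : l.length + l'.length = n) (h0 : l ≠ [])
    (h0' : l' ≠ []) (hd : l.Nodup) (hd' : l'.Nodup) (hdd : ∀ x ∈ l, x ∉ l') (hc : l.IsChain R)
    (hc' : l'.IsChain R) (h1 : ∀ x ∈ l.getLast?, ∀ y ∈ l'.head?, R x y)
    (h2 : ∀ x ∈ l'.getLast?, ∀ y ∈ l.head?, R x y) : Cy R n := by
  have : 0 < l.length := List.length_pos_iff.2 h0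
  refine CyL.cy (l := l ++ l') ⟨?_, ?_, ?_⟩ (by simpa using hn) (by omega)
  · rw [List.nodup_append']
    exact ⟨hd, hd', fun x hx hx' => hdd x hx hx'⟩
  · rw [List.isChain_append]
    exact ⟨hc, hc', h1⟩
  · rw [List.getLast?_append_of_ne_nil _ h0', List.head?_append_of_ne_nil _ h0]
    exact h2

lemma fin2 {U : Finset α} {red blue : α → α → Prop} (h : BC U red blue) (ℓ : ℕ) (hℓ : 3 ≤ ℓ)
    (hU : 4 * ℓ + 1 ≤ U.card) (P1 P2 : Finset α) (hP1 : P1 ⊆ U) (hP2 : P2 ⊆ U)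
    (hd : Disjoint P1 P2) (h1 : P1.card = ℓ) (h2 : P2.card = ℓ + 1)
    (k1 : ∀ x ∈ P1, ∀ y ∈ P1, x ≠ y → blue x y) (k2 : ∀ x ∈ P2, ∀ y ∈ P2, x ≠ y → blue x y)
    (hr : ∀ p ∈ P1, ∀ q ∈ P2, red p q) : Cy red (2 * ℓ + 1) ∨ Cy blue (2 * ℓ + 1) := by
  classical
  by_contra hcon
  rw [not_or] at hcon
  obtain ⟨hnr, hnb⟩ := hcon
  let Y := (U \ (P1 ∪ P2)).filter (fun y => ∀ p ∈ P2, blue y p)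
  have memY : ∀ y, y ∈ Y ↔ (y ∈ U ∧ y ∉ P1 ∧ y ∉ P2) ∧ ∀ p ∈ P2, blue y p := by
    intro y; simp [Y]
  have hY : Y.card < ℓ := by
    by_contra hY
    obtain ⟨p0, hp0⟩ := Finset.card_pos.1 (by omega : 0 < P2.card)
    obtain ⟨y, hy⟩ := Finset.card_pos.1 (by omega : 0 < Y.card)
    have hp0Y : p0 ∉ Y := fun h' => ((memY p0).1 h').1.2.2 hp0
    refine hnb (c1 h.bs ℓ (by omega) (P2.erase p0) (insert p0 Y) ?_ ?_ ?_ ?_ p0 y (by simp)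
      (by simp [hy]) ?_ ?_)
    · rw [Finset.disjoint_left]
      intro x hx hx'
      rw [Finset.mem_insert] at hx'
      rcases hx' with rfl | hx'
      · simp at hx
      · exact ((memY x).1 hx').1.2.2 (Finset.mem_of_mem_erase hx)
    · intro p hp q hq
      rw [Finset.mem_insert] at hq
      have hpP := Finset.mem_of_mem_erase hp
      rcases hq with rfl | hq
      · exact k2 p hpP q hp0 (Finset.ne_of_mem_erase hp)
      · exact h.bs _ _ (((memY q).1 hq).2 p hpP)
    · rw [Finset.card_erase_of_mem hp0]; omega
    · rw [Finset.card_insert_of_notMem hp0Y]; omega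
    · rintro rfl; exact hp0Y hy
    · exact h.bs _ _ (((memY y).1 hy).2 p0 hp0)
  let S := U \ (P1 ∪ P2 ∪ Y)
  have memS : ∀ y, y ∈ S ↔ y ∈ U ∧ y ∉ P1 ∧ y ∉ P2 ∧ y ∉ Y := by
    intro y; simp only [S, Finset.mem_sdiff, Finset.mem_union, not_or]; tauto
  have hS : ℓ + 1 ≤ S.card := by
    have a1 := Finset.le_card_sdiff (P1 ∪ P2 ∪ Y) U
    have a2 := Finset.card_union_le (P1 ∪ P2) Y
    have a3 := Finset.card_union_le P1 P2
    simp only [S]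
    omega
  have hSr : ∀ s ∈ S, ∃ o ∈ P2, red s o := by
    intro s hs
    rw [memS] at hs
    by_contra hcon
    push Not at hcon
    apply hs.2.2.2
    rw [memY]
    refine ⟨⟨hs.1, hs.2.1, hs.2.2.1⟩, fun p hp => ?_⟩
    rcases h.cross s hs.1 p (hP2 hp) (by rintro rfl; exact hs.2.2.1 hp) with h' | h'
    · exact absurd h' (hcon p hp)
    · exact h'
  have hSb : ∀ s ∈ S, ∀ p ∈ P1, blue s p := by
    intro s hs p hp
    obtain ⟨o, ho, hso⟩ := hSr s hs
    rw [memS] at hs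
    rcases h.cross s hs.1 p (hP1 hp) (by rintro rfl; exact hs.2.1 hp) with h' | h'
    · exact absurd (c2 h.rs ℓ (by omega) P1 P2 hd hr (by omega) (by omega) s p o hs.2.1 hs.2.2.1
        hp ho h' hso) hnr
    · exact h'
  have hSred : ∀ s ∈ S, ∀ s' ∈ S, s ≠ s' → red s s' := by
    intro s hs s' hs' hne
    rcases h.cross s ((memS s).1 hs).1 s' ((memS s').1 hs').1 hne with h' | h'
    · exact h'
    · refine absurd (c1 h.bs ℓ (by omega) P1 S ?_ ?_ (by omega) (by omega) s s' hs hs' hne h') hnb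
      · rw [Finset.disjoint_left]
        intro x hx hx'
        exact ((memS x).1 hx').2.1 hx
      · intro p hp q hq
        exact h.bs _ _ (hSb q hq p hp)
  have hSS : ∀ s ∈ S, ∀ s' ∈ S, s ≠ s' → ∀ o ∈ P2, ∀ o' ∈ P2, red s o → red s' o' → o = o' := by
    intro s hs s' hs' hne o ho o' ho' h1 h2
    by_contra hoo
    have hs1 := (memS s).1 hs
    have hs2 := (memS s').1 hs'
    exact hnr (c3 h.rs ℓ (by omega) P1 P2 hd hr (by omega) (by omega) o s s' o' ho ho' hs1.2.1
      hs1.2.2.1 hs2.2.1 hs2.2.2.1 hoo hne (h.rs _ _ h1) (hSred s hs s' hs' hne) h2)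
  obtain ⟨s, hs, s', hs', hne⟩ := Finset.one_lt_card.1 (by omega : 1 < S.card)
  obtain ⟨o, ho, hso⟩ := hSr s hs
  obtain ⟨o', ho', hso'⟩ := hSr s' hs'
  obtain rfl := hSS s hs s' hs' hne o ho o' ho' hso hso'
  have b1 : ∀ q ∈ P2.erase o, blue s q := by
    intro q hq
    have hqP := Finset.mem_of_mem_erase hq
    rcases h.cross s ((memS s).1 hs).1 q (hP2 hqP) (by rintro rfl; exact ((memS _).1 hs).2.2.1 hqP) with h' | h'
    · exact absurd (hSS s hs s' hs' hne q hqP o ho h' hso') (Finset.ne_of_mem_erase hq)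
    · exact h'
  have b2 : ∀ q ∈ P2.erase o, blue s' q := by
    intro q hq
    have hqP := Finset.mem_of_mem_erase hq
    rcases h.cross s' ((memS s').1 hs').1 q (hP2 hqP) (by rintro rfl; exact ((memS _).1 hs').2.2.1 hqP) with h' | h'
    · exact absurd (hSS s hs s' hs' hne o ho q hqP hso h').symm (Finset.ne_of_mem_erase hq)
    · exact h'
  obtain ⟨l, l1, l2, l3, l4⟩ := clique_list P1 k1 ℓ (by omega)
  obtain ⟨m, m1, m2, m3, m4⟩ := clique_list (R := blue) (P2.erase o) (fun x hx y hy => k2 x (Finset.mem_of_mem_erase hx)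
    y (Finset.mem_of_mem_erase hy)) (ℓ - 1) (by rw [Finset.card_erase_of_mem ho]; omega)
  have hs1 := (memS s).1 hs
  have hs2 := (memS s').1 hs'
  have ml : ∀ {x}, x ∈ l.getLast? → x ∈ l := fun hx => List.mem_of_getLast? hx
  have ml' : ∀ {x}, x ∈ l.head? → x ∈ l := fun hx => List.mem_of_mem_head? hx
  have mm : ∀ {x}, x ∈ m.getLast? → x ∈ m := fun hx => List.mem_of_getLast? hx
  have mm' : ∀ {x}, x ∈ m.head? → x ∈ m := fun hx => List.mem_of_mem_head? hx
  have hl0 : l ≠ [] := by rintro rfl; simp at l1; omega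
  have hm0 : m ≠ [] := by rintro rfl; simp at m1; omega
  refine hnb (cy_two_lists (s :: l) (s' :: m) _ (by simp [l1, m1]; omega) (by simp) (by simp) ?_ ?_ ?_ ?_ ?_ ?_ ?_)
  · rw [List.nodup_cons]
    exact ⟨fun h' => hs1.2.1 (l4 _ h'), l2⟩
  · rw [List.nodup_cons]
    exact ⟨fun h' => hs2.2.2.1 (Finset.mem_of_mem_erase (m4 _ h')), m2⟩
  · intro x hx hx'
    rw [List.mem_cons] at hx hx'
    rcases hx with rfl | hx <;> rcases hx' with rfl | hx'
    · exact hne rfl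
    · exact hs1.2.2.1 (Finset.mem_of_mem_erase (m4 _ hx'))
    · exact hs2.2.1 (l4 _ hx)
    · exact Finset.disjoint_left.1 hd (l4 _ hx) (Finset.mem_of_mem_erase (m4 _ hx'))
  · rw [List.isChain_cons]
    exact ⟨fun y hy => hSb s hs y (l4 _ (ml' hy)), l3⟩
  · rw [List.isChain_cons]
    exact ⟨fun y hy => b2 y (m4 _ (mm' hy)), m3⟩
  · intro x hx y hy
    rw [List.getLast?_cons_of_ne_nil hl0] at hx
    simp at hy
    subst hy
    exact h.bs _ _ (hSb _ hs' x (l4 _ (ml hx)))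
  · intro x hx y hy
    rw [List.getLast?_cons_of_ne_nil hm0] at hx
    simp at hy
    subst hy
    exact h.bs _ _ (b1 x (m4 _ (mm hx)))

lemma fin1 {U : Finset α} {red blue : α → α → Prop} (h : BC U red blue) (ℓ : ℕ) (hℓ : 3 ≤ ℓ)
    (hU : 4 * ℓ + 1 ≤ U.card) (E O : Finset α) (hE : E ⊆ U) (hO : O ⊆ U)
    (hd : Disjoint E O) (h1 : ℓ + 1 ≤ E.card) (h2 : ℓ + 1 ≤ O.card)
    (k1 : ∀ x ∈ E, ∀ y ∈ E, x ≠ y → blue x y) (k2 : ∀ x ∈ O, ∀ y ∈ O, x ≠ y → blue x y) :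
    Cy red (2 * ℓ + 1) ∨ Cy blue (2 * ℓ + 1) := by
  classical
  by_contra hcon
  rw [not_or] at hcon
  obtain ⟨hnr, hnb⟩ := hcon
  have hd' := Finset.disjoint_left.1 hd
  have hdisj : ∀ e1 ∈ E, ∀ e2 ∈ E, ∀ o1 ∈ O, ∀ o2 ∈ O, blue e1 o1 → blue e2 o2 → e1 ≠ e2 → o1 ≠ o2 →
      False := by
    intro e1 he1 e2 he2 o1 ho1 o2 ho2 b1 b2 hne hno
    obtain ⟨l, l1, l2, l3, l4, l5, l6⟩ := clique_path (R := blue) E k1 (ℓ - 1) e1 e2 he1 he2 hne (by omega)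
    obtain ⟨m, m1, m2, m3, m4, m5, m6⟩ := clique_path (R := blue) O k2 (ℓ - 2) o2 o1 ho2 ho1 hno.symm (by omega)
    refine hnb (cy_two_lists l m _ (by omega) (by rintro rfl; simp at l1) (by rintro rfl; simp at m1)
      l2 m2 (fun x hx hx' => hd' (l4 x hx) (m4 x hx')) l3 m3 ?_ ?_)
    · rw [l6, m5]; simpa using b2
    · rw [m6, l5]; simpa using h.bs _ _ b1
  have fin : ∀ E O : Finset α, E ⊆ U → O ⊆ U → Disjoint E O → ℓ + 1 ≤ E.card → ℓ + 1 ≤ O.card →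
      (∀ x ∈ E, ∀ y ∈ E, x ≠ y → blue x y) → (∀ x ∈ O, ∀ y ∈ O, x ≠ y → blue x y) →
      ∀ e0, (∀ e ∈ E, ∀ o ∈ O, blue e o → e = e0) → False := by
    intro E O hE hO hd h1 h2 k1 k2 e0 he0
    obtain ⟨P1, p1, p1'⟩ := Finset.exists_subset_card_eq (by
      have := Finset.pred_card_le_card_erase (s := E) (a := e0); omega : ℓ ≤ (E.erase e0).card)
    obtain ⟨P2, p2, p2'⟩ := Finset.exists_subset_card_eq h2
    have p1E := p1.trans (Finset.erase_subset _ _)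
    have := fin2 h ℓ hℓ hU P1 P2 (p1E.trans hE) (p2.trans hO)
      (Finset.disjoint_of_subset_left p1E (Finset.disjoint_of_subset_right p2 hd)) p1' p2'
      (fun x hx y hy => k1 x (p1E hx) y (p1E hy)) (fun x hx y hy => k2 x (p2 hx) y (p2 hy)) ?_
    · exact this.elim hnr hnb
    · intro p hp q hq
      rcases h.cross p (hE (p1E hp)) q (hO (p2 hq)) (by
        rintro rfl; exact Finset.disjoint_left.1 hd (p1E hp) (p2 hq)) with h' | h'
      · exact h'
      · exact absurd (he0 p (p1E hp) q (p2 hq) h') (Finset.ne_of_mem_erase (p1 hp))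
  by_cases hany : ∃ e1 ∈ E, ∃ o1 ∈ O, blue e1 o1
  · obtain ⟨e1, he1, o1, ho1, b1⟩ := hany
    by_cases hall : ∀ e ∈ E, ∀ o ∈ O, blue e o → e = e1
    · exact fin E O hE hO hd h1 h2 k1 k2 e1 hall
    · push Not at hall
      obtain ⟨e2, he2, o2, ho2, b2, hne⟩ := hall
      have ho : o2 = o1 := by
        by_contra hc
        exact hdisj e2 he2 e1 he1 o2 ho2 o1 ho1 b2 b1 hne hc
      subst ho
      refine fin O E hO hE hd.symm h2 h1 k2 k1 o2 ?_
      intro o ho e he hb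
      by_contra hc
      by_cases hee : e = e1
      · subst hee
        exact hdisj e he e2 he2 o ho o2 ho2 (h.bs _ _ hb) b2 hne.symm hc
      · exact hdisj e he e1 he1 o ho o2 ho2 (h.bs _ _ hb) b1 hee hc
  · push Not at hany
    obtain ⟨e0, he0⟩ := Finset.card_pos.1 (by omega : 0 < E.card)
    exact fin E O hE hO hd h1 h2 k1 k2 e0 (fun e he o ho hb => absurd hb (hany e he o ho))
end GR

namespace GR
variable {α : Type*} [DecidableEq α]

lemma chord2 {R : α → α → Prop} {κ : ℕ} (hκ : 3 ≤ κ) (f : ℕ → α) (fp : ∀ t, f (t + κ) = f t)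
    (fd : ∀ s t, s < t → t < s + κ → f s ≠ f t) (fR : ∀ t, R (f t) (f (t + 1))) (i : ℕ)
    (h : R (f i) (f (i + 2))) : Cy R (κ - 1) := by
  refine ⟨fun t => f (i + 2 + t), ?_, ?_, ?_⟩
  · intro s t hst ht
    exact fd _ _ (by omega) (by omega)
  · intro t ht
    exact fR _
  · have : i + 2 + (κ - 1 - 1) = i + κ := by omega
    simp only [this, fp]
    exact h

lemma descent_odd {U : Finset α} {red blue : α → α → Prop} (h : BC U red blue) (κ : ℕ)
    (hκ : 8 ≤ κ) (hodd : κ % 2 = 1) (f : ℕ → α) (fp : ∀ t, f (t + κ) = f t)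
    (fd : ∀ s t, s < t → t < s + κ → f s ≠ f t) (fR : ∀ t, red (f t) (f (t + 1))) :
    Cy red (κ - 1) ∨ Cy blue (κ - 1) := by
  by_contra hcon
  rw [not_or] at hcon
  obtain ⟨hnr, hnb⟩ := hcon
  have fU : ∀ t, f t ∈ U := fun t => h.rU _ _ (fR t)
  have s2 : ∀ i, blue (f i) (f (i + 2)) := by
    intro i
    rcases h.cross _ (fU i) _ (fU (i + 2)) (fd _ _ (by omega) (by omega)) with h' | h'
    · exact absurd (chord2 (by omega) f fp fd fR i h') hnr
    · exact h'
  have s4e : ∀ i, red (f (2 * i)) (f (2 * i + 4)) := by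
    intro i
    rcases h.cross _ (fU (2 * i)) _ (fU (2 * i + 4)) (fd _ _ (by omega) (by omega)) with h' | h'
    · exact h'
    · refine absurd (chord2 (R := blue) (κ := κ) (by omega) (fun t => f (2 * t)) ?_ ?_ ?_ i ?_) hnb
      · intro t
        have : 2 * (t + κ) = 2 * t + κ + κ := by ring
        simp only [this, fp]
      · intro s t hst ht
        rcases Nat.lt_or_ge (2 * t) (2 * s + κ) with hh | hh
        · exact fd _ _ (by omega) hh
        · obtain ⟨u, hu⟩ : ∃ u, 2 * t = u + κ := ⟨2 * t - κ, by omega⟩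
          rw [hu, fp]
          exact fd _ _ (by omega) (by omega)
      · intro t
        exact s2 _
      · exact h'
  have s4 : ∀ i, red (f i) (f (i + 4)) := by
    intro i
    rcases Nat.even_or_odd' i with ⟨c, rfl | rfl⟩
    · exact s4e c
    · have := s4e (c + (κ + 1) / 2)
      have e : 2 * (c + (κ + 1) / 2) = 2 * c + 1 + κ := by omega
      rw [e, fp, show 2 * c + 1 + κ + 4 = 2 * c + 1 + 4 + κ by ring, fp] at this
      exact this
  apply hnr
  let π : ℕ → ℕ := fun t => if t = 0 then 0 else if t = 1 then 4 else if t = 2 then 5 else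
    if t = 3 then 1 else if t = 4 then 2 else if t = 5 then 3 else t + 1
  have fne : ∀ i j, i ≠ j → i < κ → j < κ → f i ≠ f j := by
    intro i j hij hi hj
    rcases lt_or_gt_of_ne hij with h' | h'
    · exact fd _ _ h' (by omega)
    · exact (fd _ _ h' (by omega)).symm
  refine ⟨fun t => f (π t), ?_, ?_, ?_⟩
  · intro s t hst ht
    apply fne
    · simp only [π]; split_ifs <;> omega
    · simp only [π]; split_ifs <;> omega
    · simp only [π]; split_ifs <;> omega
  · intro t ht
    by_cases h6 : t < 6
    · interval_cases t
      · exact s4 0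
      · exact fR 4
      · exact h.rs _ _ (s4 1)
      · exact fR 1
      · exact fR 2
      · exact s4 3
    · have e1 : π t = t + 1 := by simp only [π]; split_ifs <;> omega
      have e2 : π (t + 1) = t + 1 + 1 := by simp only [π]; split_ifs <;> omega
      simp only [e1, e2]
      exact fR _
  · have e1 : π (κ - 1 - 1) = κ - 1 := by simp only [π]; split_ifs <;> omega
    simp only [e1]
    have := fR (κ - 1)
    rw [show κ - 1 + 1 = 0 + κ by omega, fp] at this
    exact this

lemma descent_even {U : Finset α} {red blue : α → α → Prop} (h : BC U red blue) (m : ℕ)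
    (hm : 4 ≤ m) (f : ℕ → α) (fp : ∀ t, f (t + 2 * m) = f t)
    (fd : ∀ s t, s < t → t < s + 2 * m → f s ≠ f t) (fR : ∀ t, red (f t) (f (t + 1)))
    (s2 : ∀ i, blue (f i) (f (i + 2))) (q : ℕ) (hq : 2 ≤ q) (hqm : q + 2 ≤ m)
    (hred : red (f 0) (f (2 * q))) :
    Cy red (2 * m - 1) ∨ Cy blue (2 * m - 1) := by
  by_contra hcon
  rw [not_or] at hcon
  obtain ⟨hnr, hnb⟩ := hcon
  have fU : ∀ t, f t ∈ U := fun t => h.rU _ _ (fR t)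
  have fne : ∀ i j, i ≠ j → i < 2 * m → j < 2 * m → f i ≠ f j := by
    intro i j hij hi hj
    rcases lt_or_gt_of_ne hij with h' | h'
    · exact fd _ _ h' (by omega)
    · exact (fd _ _ h' (by omega)).symm
  have flast : red (f (2 * m - 1)) (f 0) := by
    have := fR (2 * m - 1)
    rw [show 2 * m - 1 + 1 = 0 + 2 * m by omega, fp] at this
    exact this
  have b1 : blue (f 1) (f (2 * q + 2)) := by
    rcases h.cross _ (fU 1) _ (fU (2 * q + 2)) (fd _ _ (by omega) (by omega)) with h' | h'
    swap
    · exact h'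
    exfalso
    apply hnr
    let π : ℕ → ℕ := fun t => if t = 0 then 0 else if t ≤ 2 * q then 2 * q + 1 - t else t + 1
    refine ⟨fun t => f (π t), ?_, ?_, ?_⟩
    · intro s t hst ht
      apply fne
      · simp only [π]; split_ifs <;> omega
      · simp only [π]; split_ifs <;> omega
      · simp only [π]; split_ifs <;> omega
    · intro t ht
      simp only
      rcases Nat.eq_zero_or_pos t with rfl | h0
      · have e : π (0 + 1) = 2 * q := by simp only [π]; split_ifs <;> first | omega | grind
        have e0 : π 0 = 0 := by simp [π]
        rw [e, e0]; exact hred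
      rcases lt_trichotomy t (2 * q) with hh | hh | hh
      · have e1 : π t = 2 * q - t + 1 := by simp only [π]; split_ifs <;> omega
        have e2 : π (t + 1) = 2 * q - t := by simp only [π]; split_ifs <;> first | omega | grind
        rw [e1, e2]
        exact h.rs _ _ (fR _)
      · have e1 : π t = 1 := by simp only [π]; split_ifs <;> omega
        have e2 : π (t + 1) = 2 * q + 2 := by simp only [π]; split_ifs <;> omega
        rw [e1, e2]; exact h'
      · have e1 : π t = t + 1 := by simp only [π]; split_ifs <;> omega
        have e2 : π (t + 1) = t + 1 + 1 := by simp only [π]; split_ifs <;> omega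
        rw [e1, e2]
        exact fR _
    · have e1 : π (2 * m - 1 - 1) = 2 * m - 1 := by simp only [π]; split_ifs <;> omega
      have e0 : π 0 = 0 := by simp [π]
      simp only [e1, e0]
      exact flast
  have b2 : blue (f (2 * m - 1)) (f (2 * q - 2)) := by
    rcases h.cross _ (fU (2 * m - 1)) _ (fU (2 * q - 2)) (fd _ _ (by omega) (by omega)).symm with h' | h'
    swap
    · exact h'
    exfalso
    apply hnr
    let π : ℕ → ℕ := fun t => if t = 0 then 0 else if t ≤ 2 * m - 2 * q then 2 * q - 1 + t
      else 2 * m - 1 - t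
    refine ⟨fun t => f (π t), ?_, ?_, ?_⟩
    · intro s t hst ht
      apply fne
      · simp only [π]; split_ifs <;> omega
      · simp only [π]; split_ifs <;> omega
      · simp only [π]; split_ifs <;> omega
    · intro t ht
      simp only
      rcases Nat.eq_zero_or_pos t with rfl | h0
      · have e : π (0 + 1) = 2 * q := by simp only [π]; split_ifs <;> first | omega | grind
        have e0 : π 0 = 0 := by simp [π]
        rw [e, e0]; exact hred
      rcases lt_trichotomy t (2 * m - 2 * q) with hh | hh | hh
      · have e1 : π t = 2 * q - 1 + t := by simp only [π]; split_ifs <;> omega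
        have e2 : π (t + 1) = 2 * q - 1 + t + 1 := by simp only [π]; split_ifs <;> omega
        rw [e1, e2]
        exact (fR _)
      · have e1 : π t = 2 * m - 1 := by simp only [π]; split_ifs <;> omega
        have e2 : π (t + 1) = 2 * q - 2 := by simp only [π]; split_ifs <;> first | omega | grind
        rw [e1, e2]; exact h'
      · have e1 : π t = 2 * m - 2 - t + 1 := by simp only [π]; split_ifs <;> omega
        have e2 : π (t + 1) = 2 * m - 2 - t := by simp only [π]; split_ifs <;> first | omega | grind
        rw [e1, e2]
        exact h.rs _ _ (fR _)
    · have e1 : π (2 * m - 1 - 1) = 1 := by simp only [π]; split_ifs <;> omega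
      have e0 : π 0 = 0 := by simp [π]
      simp only [e1, e0]
      exact h.rs _ _ (fR 0)
  apply hnb
  let π : ℕ → ℕ := fun t => if t < m then 2 * t + 1 else
    if 2 * (t - m) ≤ 2 * q - 2 then 2 * q - 2 - 2 * (t - m) else 2 * m + 2 * q - 2 - 2 * (t - m)
  refine ⟨fun t => f (π t), ?_, ?_, ?_⟩
  · intro s t hst ht
    apply fne
    · simp only [π]; split_ifs <;> omega
    · simp only [π]; split_ifs <;> omega
    · simp only [π]; split_ifs <;> omega
  · intro t ht
    simp only
    rcases lt_trichotomy (t + 1) m with hh | hh | hh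
    · have e1 : π t = 2 * t + 1 := by simp only [π]; split_ifs <;> omega
      have e2 : π (t + 1) = 2 * t + 1 + 2 := by simp only [π]; split_ifs <;> omega
      rw [e1, e2]; exact s2 _
    · have e1 : π t = 2 * m - 1 := by simp only [π]; split_ifs <;> omega
      have e2 : π (t + 1) = 2 * q - 2 := by simp only [π]; split_ifs <;> omega
      rw [e1, e2]; exact b2
    · rcases lt_trichotomy (2 * (t - m)) (2 * q - 2) with h' | h' | h'
      · have e1 : π t = 2 * q - 4 - 2 * (t - m) + 2 := by simp only [π]; split_ifs <;> omega
        have e2 : π (t + 1) = 2 * q - 4 - 2 * (t - m) := by simp only [π]; split_ifs <;> omega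
        rw [e1, e2]; exact h.bs _ _ (s2 _)
      · have e1 : π t = 0 := by simp only [π]; split_ifs <;> omega
        have e2 : π (t + 1) = 2 * m - 2 := by simp only [π]; split_ifs <;> omega
        rw [e1, e2]
        have := s2 (2 * m - 2)
        rw [show 2 * m - 2 + 2 = 0 + 2 * m by omega, fp] at this
        exact h.bs _ _ this
      · have e1 : π t = 2 * m + 2 * q - 4 - 2 * (t - m) + 2 := by simp only [π]; split_ifs <;> omega
        have e2 : π (t + 1) = 2 * m + 2 * q - 4 - 2 * (t - m) := by simp only [π]; split_ifs <;> omega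
        rw [e1, e2]; exact h.bs _ _ (s2 _)
  · have e1 : π (2 * m - 1 - 1) = 2 * q + 2 := by simp only [π]; split_ifs <;> omega
    have e0 : π 0 = 1 := by simp only [π]; split_ifs <;> omega
    simp only [e1, e0]
    exact h.bs _ _ b1

lemma descent {U : Finset α} {red blue : α → α → Prop} (h : BC U red blue) (ℓ κ : ℕ)
    (hℓ : 3 ≤ ℓ) (hκ : 2 * ℓ + 2 ≤ κ) (hU : 4 * ℓ + 1 ≤ U.card) (hc : Cy red κ) :
    (Cy red (κ - 1) ∨ Cy blue (κ - 1)) ∨ (Cy red (2 * ℓ + 1) ∨ Cy blue (2 * ℓ + 1)) := by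
  obtain ⟨f, fp, fd, fR⟩ := hc.periodic (by omega)
  rcases Nat.mod_two_eq_zero_or_one κ with hpar | hpar
  swap
  · exact Or.inl (descent_odd h κ (by omega) hpar f fp fd fR)
  obtain ⟨m, rfl⟩ : ∃ m, κ = 2 * m := ⟨κ / 2, by omega⟩
  by_contra hcon
  rw [not_or] at hcon
  obtain ⟨hn, hn'⟩ := hcon
  have fU : ∀ t, f t ∈ U := fun t => h.rU _ _ (fR t)
  have s2 : ∀ i, blue (f i) (f (i + 2)) := by
    intro i
    rcases h.cross _ (fU i) _ (fU (i + 2)) (fd _ _ (by omega) (by omega)) with h' | h'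
    · exact absurd (Or.inl (chord2 (by omega) f fp fd fR i h')) hn
    · exact h'
  have sall : ∀ i q, 1 ≤ q → q < m → blue (f i) (f (i + 2 * q)) := by
    intro i q hq hqm
    rcases Nat.lt_or_ge 1 q with h1 | h1
    · rcases Nat.lt_or_ge (q + 1) m with h2 | h2
      · rcases h.cross _ (fU i) _ (fU (i + 2 * q)) (fd _ _ (by omega) (by omega)) with h' | h'
        · refine absurd (descent_even h m (by omega) (fun t => f (i + t)) ?_ ?_ ?_ ?_ q (by omega) (by omega) ?_) hn
          · intro t
            simp only [← add_assoc, fp]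
          · intro s t hst ht
            exact fd _ _ (by omega) (by omega)
          · intro t
            exact fR _
          · intro t
            exact s2 _
          · exact h'
        · exact h'
      · have := s2 (i + 2 * q)
        rw [show i + 2 * q + 2 = i + 2 * m by omega, fp] at this
        exact h.bs _ _ this
    · obtain rfl : q = 1 := by omega
      exact s2 i
  have fne : ∀ i j, i ≠ j → i < 2 * m → j < 2 * m → f i ≠ f j := by
    intro i j hij hi hj
    rcases lt_or_gt_of_ne hij with h' | h'
    · exact fd _ _ h' (by omega)
    · exact (fd _ _ h' (by omega)).symm
  have hclq : ∀ e, ∀ x ∈ (Finset.range m).image (fun t => f (2 * t + e)),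
      ∀ y ∈ (Finset.range m).image (fun t => f (2 * t + e)), x ≠ y → blue x y := by
    intro e x hx y hy hxy
    simp only [Finset.mem_image, Finset.mem_range] at hx hy
    obtain ⟨s, hs, rfl⟩ := hx
    obtain ⟨t, ht, rfl⟩ := hy
    rcases lt_trichotomy s t with h' | h' | h'
    · have := sall (2 * s + e) (t - s) (by omega) (by omega)
      rwa [show 2 * s + e + 2 * (t - s) = 2 * t + e by omega] at this
    · subst h'; exact absurd rfl hxy
    · have := sall (2 * t + e) (s - t) (by omega) (by omega)
      rw [show 2 * t + e + 2 * (s - t) = 2 * s + e by omega] at this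
      exact h.bs _ _ this
  have hsub : ∀ e, (Finset.range m).image (fun t => f (2 * t + e)) ⊆ U := by
    intro e x hx
    simp only [Finset.mem_image, Finset.mem_range] at hx
    obtain ⟨s, hs, rfl⟩ := hx
    exact fU _
  have hcard : ∀ e < 2, ((Finset.range m).image (fun t => f (2 * t + e))).card = m := by
    intro e he
    rw [Finset.card_image_of_injOn, Finset.card_range]
    intro s hs t ht hst
    simp only [Finset.coe_range, Set.mem_Iio] at hs ht
    by_contra hne
    exact fne _ _ (by omega) (by omega) (by omega) hst
  refine hn' (fin1 h ℓ hℓ hU _ _ (hsub 0) (hsub 1) ?_ ?_ ?_ (hclq 0) (hclq 1))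
  · rw [Finset.disjoint_left]
    intro x hx hy
    simp only [Finset.mem_image, Finset.mem_range] at hx hy
    obtain ⟨s, hs, rfl⟩ := hx
    obtain ⟨t, ht, e⟩ := hy
    exact fne _ _ (by omega) (by omega) (by omega) e
  · rw [hcard 0 (by omega)]; omega
  · rw [hcard 1 (by omega)]; omega

lemma descent_all {U : Finset α} {red blue : α → α → Prop} (h : BC U red blue) (ℓ κ : ℕ)
    (hℓ : 3 ≤ ℓ) (hκ : 2 * ℓ + 1 ≤ κ) (hU : 4 * ℓ + 1 ≤ U.card) (hc : Cy red κ ∨ Cy blue κ) :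
    Cy red (2 * ℓ + 1) ∨ Cy blue (2 * ℓ + 1) := by
  induction κ, hκ using Nat.le_induction with
  | base => exact hc
  | succ κ hκ ih =>
    rcases hc with hc | hc
    · rcases descent h ℓ (κ + 1) hℓ (by omega) hU hc with h' | h'
      · exact ih h'
      · exact h'
    · rcases descent h.symm ℓ (κ + 1) hℓ (by omega) hU hc with h' | h'
      · exact ih h'.symm
      · exact h'.symm

lemma ham {U : Finset α} {red blue : α → α → Prop} (h : BC U red blue) (V : Finset α) :
    V ⊆ U → V.Nonempty → ∃ (x : α) (A B : List α), (x :: A).IsChain red ∧ (x :: B).IsChain blue ∧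
      (x :: (A ++ B)).Nodup ∧ ∀ y, y ∈ x :: (A ++ B) ↔ y ∈ V := by
  induction V using Finset.induction_on with
  | empty => intro _ h; simp at h
  | insert v V hv ih =>
    intro hVU _
    rcases V.eq_empty_or_nonempty with rfl | hne
    · exact ⟨v, [], [], by simp⟩
    obtain ⟨x, A, B, h1, h2, h3, h4⟩ := ih ((Finset.subset_insert _ _).trans hVU) hne
    have hvx : ∀ y ∈ V, v ≠ y := by rintro y hy rfl; exact hv hy
    have hvU : v ∈ U := hVU (by simp)
    have hin : ∀ y ∈ V, y ∈ U := fun y hy => hVU (by simp [hy])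
    have hnd : (v :: x :: (A ++ B)).Nodup := by
      rw [List.nodup_cons]
      exact ⟨fun h' => hv ((h4 v).1 h'), h3⟩
    have hmem : ∀ y, y ∈ v :: x :: (A ++ B) ↔ y ∈ insert v V := by
      intro y
      rw [List.mem_cons, h4, Finset.mem_insert]
    have hxV : x ∈ V := (h4 x).1 (by simp)
    have fin : ∀ x' A' B', (x' :: A').IsChain red → (x' :: B').IsChain blue →
        (x' :: (A' ++ B')).Perm (v :: x :: (A ++ B)) →
        ∃ (x : α) (A B : List α), (x :: A).IsChain red ∧ (x :: B).IsChain blue ∧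
      (x :: (A ++ B)).Nodup ∧ ∀ y, y ∈ x :: (A ++ B) ↔ y ∈ insert v V := by
      intro x' A' B' a1 a2 a3
      exact ⟨x', A', B', a1, a2, a3.nodup_iff.2 hnd, fun y => (a3.mem_iff).trans (hmem y)⟩
    rcases h.cross v hvU x (hin x hxV) (hvx x hxV) with hr | hb
    · rcases B with _ | ⟨b, B⟩
      · exact fin v (x :: A) [] (by simp [List.isChain_cons_cons, hr, h1]) (by simp) (by simp)
      · have hbV : b ∈ V := (h4 b).1 (by simp)
        have h2' := List.isChain_cons_cons.1 h2
        rcases h.cross v hvU b (hin b hbV) (hvx b hbV) with hr' | hb'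
        · refine fin b (v :: x :: A) B ?_ h2'.2 ?_
          · rw [List.isChain_cons_cons, List.isChain_cons_cons]
            exact ⟨h.rs _ _ hr', hr, h1⟩
          · have := (List.perm_middle (a := b) (l₁ := v :: x :: A) (l₂ := B)).symm
            simpa using this
        · refine fin v (x :: A) (b :: B) ?_ ?_ (by simp)
          · rw [List.isChain_cons_cons]; exact ⟨hr, h1⟩
          · rw [List.isChain_cons_cons]; exact ⟨hb', h2'.2⟩
    · rcases A with _ | ⟨a, A⟩
      · exact fin v [] (x :: B) (by simp) (by simp [List.isChain_cons_cons, hb, h2]) (by simp)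
      · have haV : a ∈ V := (h4 a).1 (by simp)
        have h1' := List.isChain_cons_cons.1 h1
        rcases h.cross v hvU a (hin a haV) (hvx a haV) with hr' | hb'
        · refine fin v (a :: A) (x :: B) ?_ ?_ ?_
          · rw [List.isChain_cons_cons]; exact ⟨hr', h1'.2⟩
          · rw [List.isChain_cons_cons]; exact ⟨hb, h2⟩
          · refine List.Perm.cons _ ?_
            exact (List.perm_middle (a := x) (l₁ := a :: A) (l₂ := B))
        · refine fin a A (v :: x :: B) h1'.2 ?_ ?_
          · rw [List.isChain_cons_cons, List.isChain_cons_cons]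
            exact ⟨h.bs _ _ hb', hb, h2⟩
          · have e1 : (a :: (A ++ v :: x :: B)).Perm (v :: ((a :: A) ++ x :: B)) :=
              List.perm_middle (a := v) (l₁ := a :: A) (l₂ := x :: B)
            refine e1.trans (List.Perm.cons _ ?_)
            exact (List.perm_middle (a := x) (l₁ := a :: A) (l₂ := B))

lemma long {red blue : α → α → Prop} {U : Finset α} (h : BC U red blue) (ℓ a b : ℕ) (hℓ : 3 ≤ ℓ)
    (f : ℕ → α) (hab : a + b = 4 * ℓ + 1) (ha : 2 * ℓ + 1 ≤ a) (fU : ∀ t ≤ a + b, f t ∈ U)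
    (fd : ∀ s t, s < t → t < a + b → f s ≠ f t) (f0 : f (a + b) = f 0)
    (fr : ∀ t < a, red (f t) (f (t + 1))) (fb : ∀ t, a ≤ t → t < a + b → blue (f t) (f (t + 1))) :
    ∃ κ, 2 * ℓ + 1 ≤ κ ∧ (Cy red κ ∨ Cy blue κ) := by
  rcases Nat.eq_zero_or_pos b with rfl | hb
  · refine ⟨a, ha, Or.inl ⟨f, by simpa using fd, fun t ht => fr t (by omega), ?_⟩⟩
    have := fr (a - 1) (by omega)
    rw [show a - 1 + 1 = a + 0 by omega, f0] at this
    exact this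
  rcases h.cross _ (fU 0 (by omega)) _ (fU a (by omega)) (fd _ _ (by omega) (by omega)) with h' | h'
  · refine ⟨a + 1, by omega, Or.inl ⟨f, fun s t hst ht => fd s t hst (by omega),
      fun t ht => fr t (by omega), ?_⟩⟩
    exact h.rs _ _ h'
  rcases Nat.lt_or_ge a (2 * ℓ + 2) with ha2 | ha2
  · refine ⟨2 * ℓ + 1, le_rfl, Or.inr ⟨fun t => if t = b then f 0 else f (a + t), ?_, ?_, ?_⟩⟩
    · intro s t hst ht
      simp only
      split_ifs with h1 h2 h2
      · omega
      · omega
      · exact (fd _ _ (by omega) (by omega)).symm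
      · exact fd _ _ (by omega) (by omega)
    · intro t ht
      simp only
      rw [if_neg (by omega)]
      split_ifs with h2
      · have := fb (a + t) (by omega) (by omega)
        rw [show a + t + 1 = a + b by omega, f0] at this
        exact this
      · exact fb (a + t) (by omega) (by omega)
    · simp only
      rw [if_pos (by omega), if_neg (by omega)]
      exact h'
  by_cases hch : ∃ i, i + 2 * ℓ ≤ a ∧ red (f i) (f (i + 2 * ℓ))
  · obtain ⟨i, hi, hr⟩ := hch
    refine ⟨2 * ℓ + 1, le_rfl, Or.inl ⟨fun t => f (i + t), ?_, ?_, ?_⟩⟩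
    · intro s t hst ht
      exact fd _ _ (by omega) (by omega)
    · intro t ht
      exact fr _ (by omega)
    · exact h.rs _ _ hr
  by_cases hch' : ∃ i, i + (2 * ℓ + 1) ≤ a ∧ red (f i) (f (i + (2 * ℓ + 1)))
  · obtain ⟨i, hi, hr⟩ := hch'
    refine ⟨2 * ℓ + 2, by omega, Or.inl ⟨fun t => f (i + t), ?_, ?_, ?_⟩⟩
    · intro s t hst ht
      exact fd _ _ (by omega) (by omega)
    · intro t ht
      exact fr _ (by omega)
    · exact h.rs _ _ hr
  push Not at hch hch'
  have g1 : ∀ i, i + 2 * ℓ ≤ a → blue (f i) (f (i + 2 * ℓ)) := by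
    intro i hi
    rcases h.cross _ (fU i (by omega)) _ (fU (i + 2 * ℓ) (by omega)) (fd _ _ (by omega) (by omega)) with h' | h'
    · exact absurd h' (hch i hi)
    · exact h'
  have g2 : ∀ i, i + (2 * ℓ + 1) ≤ a → blue (f i) (f (i + (2 * ℓ + 1))) := by
    intro i hi
    rcases h.cross _ (fU i (by omega)) _ (fU (i + (2 * ℓ + 1)) (by omega)) (fd _ _ (by omega) (by omega)) with h' | h'
    · exact absurd h' (hch' i hi)
    · exact h'
  obtain ⟨d, rfl⟩ : ∃ d, a = d + 2 * ℓ + 1 := ⟨a - 2 * ℓ - 1, by omega⟩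
  have fne : ∀ i j, i ≠ j → i < d + 2 * ℓ + 1 + b → j < d + 2 * ℓ + 1 + b → f i ≠ f j := by
    intro i j hij hi hj
    rcases lt_or_gt_of_ne hij with h' | h'
    · exact fd _ _ h' (by omega)
    · exact (fd _ _ h' (by omega)).symm
  let π : ℕ → ℕ := fun t => if t < 2 * d + 1 then (if t % 2 = 0 then t / 2 else 2 * ℓ + 1 + t / 2)
    else 2 * ℓ + t - d
  refine ⟨d + 2 * ℓ + 1, by omega, Or.inr ⟨fun t => f (π t), ?_, ?_, ?_⟩⟩
  · intro s t hst ht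
    apply fne
    · simp only [π]; split_ifs <;> omega
    · simp only [π]; split_ifs <;> omega
    · simp only [π]; split_ifs <;> omega
  · intro t ht
    simp only
    rcases Nat.lt_or_ge t (2 * d + 1) with h1 | h1
    · rcases Nat.mod_two_eq_zero_or_one t with h2 | h2
      · have e1 : π t = t / 2 := by simp only [π]; split_ifs; omega
        have e2 : π (t + 1) = t / 2 + (2 * ℓ + 1) := by simp only [π]; split_ifs <;> omega
        rw [e1, e2]
        exact g2 _ (by omega)
      · have e1 : π t = t / 2 + 1 + 2 * ℓ := by simp only [π]; split_ifs <;> omega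
        have e2 : π (t + 1) = t / 2 + 1 := by simp only [π]; split_ifs <;> omega
        rw [e1, e2]
        exact h.bs _ _ (g1 _ (by omega))
    · have e1 : π t = 2 * ℓ + t - d := by simp only [π]; split_ifs <;> omega
      have e2 : π (t + 1) = 2 * ℓ + t - d + 1 := by simp only [π]; split_ifs <;> omega
      rw [e1, e2]
      exact fb _ (by omega) (by omega)
  · have e1 : π (d + 2 * ℓ + 1 - 1) = 4 * ℓ := by simp only [π]; split_ifs <;> omega
    have e2 : π 0 = 0 := by simp only [π]; split_ifs <;> omega
    simp only [e1, e2]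
    have := fb (4 * ℓ) (by omega) (by omega)
    rw [← hab, f0] at this
    exact this

lemma long2 {red blue : α → α → Prop} {U : Finset α} (h : BC U red blue) (ℓ a b : ℕ) (hℓ : 3 ≤ ℓ)
    (f : ℕ → α) (hab : a + b = 4 * ℓ + 1) (fU : ∀ t ≤ a + b, f t ∈ U)
    (fd : ∀ s t, s < t → t < a + b → f s ≠ f t) (f0 : f (a + b) = f 0)
    (fr : ∀ t < a, red (f t) (f (t + 1))) (fb : ∀ t, a ≤ t → t < a + b → blue (f t) (f (t + 1))) :
    ∃ κ, 2 * ℓ + 1 ≤ κ ∧ (Cy red κ ∨ Cy blue κ) := by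
  rcases Nat.lt_or_ge a (2 * ℓ + 1) with ha | ha
  swap
  · exact long h ℓ a b hℓ f hab ha fU fd f0 fr fb
  have fne : ∀ i j, i ≠ j → i < a + b → j < a + b → f i ≠ f j := by
    intro i j hij hi hj
    rcases lt_or_gt_of_ne hij with h' | h'
    · exact fd _ _ h' (by omega)
    · exact (fd _ _ h' (by omega)).symm
  have := long h.symm ℓ b a hℓ (fun t => if t < b then f (a + t) else f (t - b)) (by omega) (by omega)
    ?_ ?_ ?_ ?_ ?_
  · obtain ⟨κ, h1, h2⟩ := this
    exact ⟨κ, h1, h2.symm⟩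
  · intro t ht
    split_ifs
    · exact fU _ (by omega)
    · exact fU _ (by omega)
  · intro s t hst ht
    split_ifs
    · exact fne _ _ (by omega) (by omega) (by omega)
    · exact fne _ _ (by omega) (by omega) (by omega)
    · exact fne _ _ (by omega) (by omega) (by omega)
    · exact fne _ _ (by omega) (by omega) (by omega)
  · rw [if_neg (by omega), if_pos (by omega)]
    simp
  · intro t ht
    rw [if_pos (by omega)]
    split_ifs
    · exact fb _ (by omega) (by omega)
    · have := fb (a + t) (by omega) (by omega)
      rw [show a + t + 1 = a + b by omega, f0] at this
      rw [show t + 1 - b = 0 by omega]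
      exact this
  · intro t ht1 ht2
    rw [if_neg (by omega), if_neg (by omega), show t + 1 - b = t - b + 1 by omega]
    exact fr _ (by omega)

theorem bondy_erdos {red blue : α → α → Prop} {U : Finset α} (h : BC U red blue) (ℓ : ℕ) (hℓ : 3 ≤ ℓ)
    (hU : 4 * ℓ + 1 ≤ U.card) : Cy red (2 * ℓ + 1) ∨ Cy blue (2 * ℓ + 1) := by
  obtain ⟨V, hVU, hV⟩ := Finset.exists_subset_card_eq hU
  obtain ⟨x, A, B, h1, h2, h3, h4⟩ := ham h V hVU (Finset.card_pos.1 (by omega))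
  have hlen : A.length + B.length = 4 * ℓ := by
    have : (x :: (A ++ B)).toFinset = V := by ext y; rw [List.mem_toFinset]; exact h4 y
    have h5 := List.toFinset_card_of_nodup h3
    rw [this, hV] at h5
    simp at h5
    omega
  let C := (x :: A) ++ (B.reverse ++ [x])
  have hC : C.length = 4 * ℓ + 2 := by simp [C]; omega
  let f : ℕ → α := fun i => C.getD i x
  have fget : ∀ i (hi : i < C.length), f i = C[i] := by
    intro i hi
    simp only [f]
    rw [List.getD_eq_getElem?_getD, List.getElem?_eq_getElem hi]; rfl
  have hCmem : ∀ y ∈ C, y ∈ V := by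
    intro y hy
    rw [← h4]
    simp [C] at hy ⊢
    tauto
  have fU : ∀ t ≤ 4 * ℓ + 1, f t ∈ U := by
    intro t ht
    rw [fget t (by omega)]
    exact hVU (hCmem _ (List.getElem_mem _))
  have f0 : f 0 = x := by simp [f, C]
  have fN : f (4 * ℓ + 1) = x := by
    rw [fget _ (by omega)]
    simp only [C]
    rw [List.getElem_append_right (by simp; omega), List.getElem_append_right (by simp; omega)]
    simp
  have hnd : ((x :: A) ++ B.reverse).Nodup := by
    have : ((x :: A) ++ B.reverse).Perm (x :: (A ++ B)) := by
      rw [List.cons_append]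
      exact List.Perm.cons _ (List.Perm.append_left _ (List.reverse_perm B))
    exact this.nodup_iff.2 h3
  have fd : ∀ s t, s < t → t < 4 * ℓ + 1 → f s ≠ f t := by
    intro s t hst ht
    have hC' : C = ((x :: A) ++ B.reverse) ++ [x] := by simp [C]
    have hl : ((x :: A) ++ B.reverse).length = 4 * ℓ + 1 := by simp; omega
    have key : ∀ s (hs : s < 4 * ℓ + 1), f s = ((x :: A) ++ B.reverse)[s]'(by rw [hl]; exact hs) := by
      intro s hs
      rw [fget s (by omega)]
      simp only [hC']
      exact List.getElem_append_left (by rw [hl]; exact hs)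
    rw [key s (by omega), key t (by omega)]
    intro he
    have := (List.Nodup.getElem_inj_iff hnd).1 he
    omega
  have fr : ∀ t < A.length, red (f t) (f (t + 1)) := by
    intro t ht
    rw [fget t (by omega), fget (t + 1) (by omega)]
    simp only [C]
    rw [List.getElem_append_left (by simp; omega), List.getElem_append_left (by simp; omega)]
    exact h1.getElem t (by simp; omega)
  have h2r : (B.reverse ++ [x]).IsChain blue := by
    have : (B.reverse ++ [x]) = (x :: B).reverse := by simp
    rw [this, List.isChain_reverse]
    exact h2.imp (fun a b => h.bs a b)
  have fb : ∀ t, A.length + 1 ≤ t → t < 4 * ℓ + 1 → blue (f t) (f (t + 1)) := by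
    intro t ht1 ht2
    have key : ∀ s (hs1 : A.length + 1 ≤ s) (hs : s ≤ 4 * ℓ + 1),
        f s = (B.reverse ++ [x])[s - (A.length + 1)]'(by simp; omega) := by
      intro s hs1 hs
      rw [fget s (by omega)]
      simp only [C]
      exact List.getElem_append_right (by simp; omega)
    rw [key t (by omega) (by omega), key (t + 1) (by omega) (by omega)]
    have := h2r.getElem (t - (A.length + 1)) (by simp; omega)
    have e : t + 1 - (A.length + 1) = t - (A.length + 1) + 1 := by omega
    simp only [e]
    exact this
  have hk : ∃ κ, 2 * ℓ + 1 ≤ κ ∧ (Cy red κ ∨ Cy blue κ) := by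
    have hne : f A.length ≠ f (A.length + 1) := by
      rcases Nat.lt_or_ge A.length (4 * ℓ) with h' | h'
      · exact fd _ _ (by omega) (by omega)
      · have : A.length + 1 = 4 * ℓ + 1 := by omega
        rw [this, fN, ← f0]
        exact (fd _ _ (by omega) (by omega)).symm
    rcases h.cross _ (fU A.length (by omega)) _ (fU (A.length + 1) (by omega)) hne with h' | h'
    · refine long2 h ℓ (A.length + 1) B.length hℓ f (by omega) ?_ ?_ ?_ ?_ ?_
      · intro t ht; exact fU t (by omega)
      · intro s t hst ht; exact fd s t hst (by omega)
      · rw [show A.length + 1 + B.length = 4 * ℓ + 1 by omega, fN, f0]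
      · intro t ht
        rcases Nat.lt_or_ge t A.length with h'' | h''
        · exact fr t h''
        · rw [show t = A.length by omega]; exact h'
      · intro t ht1 ht2
        exact fb t ht1 (by omega)
    · refine long2 h ℓ A.length (B.length + 1) hℓ f (by omega) ?_ ?_ ?_ fr ?_
      · intro t ht; exact fU t (by omega)
      · intro s t hst ht; exact fd s t hst (by omega)
      · rw [show A.length + (B.length + 1) = 4 * ℓ + 1 by omega, fN, f0]
      · intro t ht1 ht2
        rcases Nat.lt_or_ge A.length t with h'' | h''
        · exact fb t h'' (by omega)
        · rw [show t = A.length by omega]; exact h'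
  obtain ⟨κ, h5, h6⟩ := hk
  exact descent_all h ℓ κ hℓ h5 hU h6
end GR

namespace GR
variable {α : Type*} [DecidableEq α]

/-- The relation `u v` is an edge of color `i` inside `W`. -/
def EW {κ : Type*} (c : α → α → κ) (W : Finset α) (i : κ) (u v : α) : Prop :=
  u ∈ W ∧ v ∈ W ∧ u ≠ v ∧ c u v = i

/-- No rainbow triangle. -/
def NR {κ : Type*} (c : α → α → κ) : Prop :=
  ∀ x y z, x ≠ y → y ≠ z → x ≠ z → c x y = c y z ∨ c x y = c x z ∨ c y z = c x z

variable {κ : Type*} {c : α → α → κ}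

lemma conn_mem {W : Finset α} {i : κ} {u v : α} (hu : u ∈ W)
    (h : Relation.ReflTransGen (EW c W i) u v) : v ∈ W := by
  induction h with
  | refl => exact hu
  | tail _ h2 _ => exact h2.2.1

lemma conn_symm (hc : ∀ u v, c u v = c v u) {W : Finset α} {i : κ} {u v : α}
    (h : Relation.ReflTransGen (EW c W i) u v) : Relation.ReflTransGen (EW c W i) v u := by
  induction h with
  | refl => exact Relation.ReflTransGen.refl
  | tail _ h2 ih =>
    exact Relation.ReflTransGen.head ⟨h2.2.1, h2.1, h2.2.2.1.symm, by rw [hc]; exact h2.2.2.2⟩ ih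

lemma conn_homog (hc : ∀ u v, c u v = c v u) (hn : NR c) {W : Finset α} {i : κ} {u u' w : α}
    (h : Relation.ReflTransGen (EW c W i) u u') (hw : w ∈ W)
    (hd : ¬ Relation.ReflTransGen (EW c W i) u w) : c u w = c u' w := by
  induction h with
  | refl => rfl
  | @tail x y h1 h2 ih =>
    rw [ih]
    obtain ⟨hx, hy, hxy, hcxy⟩ := h2
    have hxw : x ≠ w := by rintro rfl; exact hd h1
    have hyw : y ≠ w := by rintro rfl; exact hd (h1.tail ⟨hx, hy, hxy, hcxy⟩)
    have h3 : c x w ≠ i := fun h => hd (h1.tail ⟨hx, hw, hxw, h⟩)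
    have h4 : c y w ≠ i := fun h => hd ((h1.tail ⟨hx, hy, hxy, hcxy⟩).tail ⟨hy, hw, hyw, h⟩)
    rcases hn x y w hxy hyw hxw with h | h | h
    · exact absurd (h.symm.trans hcxy) h4
    · exact absurd (h.symm.trans hcxy) h3
    · exact h.symm

lemma conn_insert {W : Finset α} {v : α} {i : κ} {a x : α} (ha : a ∈ W) (hv : v ∉ W)
    (h : Relation.ReflTransGen (EW c (insert v W) i) a x) :
    (x ∈ W ∧ Relation.ReflTransGen (EW c W i) a x) ∨
      ∃ a' ∈ W, Relation.ReflTransGen (EW c W i) a a' ∧ c a' v = i := by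
  induction h with
  | refl => exact Or.inl ⟨ha, Relation.ReflTransGen.refl⟩
  | @tail x y h1 h2 ih =>
    rcases ih with ⟨hx, ih⟩ | ih
    · obtain ⟨_, hy, hxy, hcxy⟩ := h2
      rcases Finset.mem_insert.1 hy with rfl | hy
      · exact Or.inr ⟨x, hx, ih, hcxy⟩
      · exact Or.inl ⟨hy, ih.tail ⟨hx, hy, hxy, hcxy⟩⟩
    · exact Or.inr ih

lemma conn_insert' {W : Finset α} {v : α} {i : κ} {a : α} (ha : a ∈ W) (hv : v ∉ W)
    (h : Relation.ReflTransGen (EW c (insert v W) i) a v) :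
      ∃ a' ∈ W, Relation.ReflTransGen (EW c W i) a a' ∧ c a' v = i := by
  rcases conn_insert ha hv h with h | h
  · exact absurd h.1 hv
  · exact h

lemma lemG (hc : ∀ u v, c u v = c v u) (hn : NR c) (W : Finset α) :
    ∀ i1 i2 i3 : κ, i1 ≠ i2 → i1 ≠ i3 → i2 ≠ i3 → (∃ u v, EW c W i1 u v) →
      (∃ u v, EW c W i2 u v) → (∃ u v, EW c W i3 u v) →
      ∃ i, (∃ u v, EW c W i u v) ∧ ∃ a ∈ W, ∃ b ∈ W, ¬ Relation.ReflTransGen (EW c W i) a b := by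
  induction W using Finset.induction_on with
  | empty =>
    rintro i1 i2 i3 _ _ _ ⟨u, v, h⟩
    exact absurd h.1 (by simp)
  | insert v W hv IH =>
    intro i1 i2 i3 h12 h13 h23 p1 p2 p3
    by_contra hcon
    have hcon' : ∀ i, (∃ u v', EW c (insert v W) i u v') → ∀ a ∈ insert v W, ∀ b ∈ insert v W,
        Relation.ReflTransGen (EW c (insert v W) i) a b := by
      intro i hi a ha b hb
      by_contra h'
      exact hcon ⟨i, hi, a, ha, b, hb, h'⟩
    have hvW : v ∈ insert v W := Finset.mem_insert_self _ _
    have sub : ∀ a ∈ W, a ∈ insert v W := fun a => Finset.mem_insert_of_mem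
    have link : ∀ i, (∃ u v', EW c (insert v W) i u v') → ∀ a ∈ W,
        ∃ a' ∈ W, Relation.ReflTransGen (EW c W i) a a' ∧ c a' v = i := by
      intro i hi a ha
      exact conn_insert' ha hv (hcon' i hi a (sub a ha) v hvW)
    have hWne : ∃ a, a ∈ W := by
      obtain ⟨x, y, h1, h2, h3, _⟩ := p1
      rcases Finset.mem_insert.1 h1 with rfl | h1
      · rcases Finset.mem_insert.1 h2 with rfl | h2
        · exact absurd rfl h3
        · exact ⟨y, h2⟩
      · exact ⟨x, h1⟩
    -- case where some present color `t` is absent in `W`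
    have caseB : ∀ t s, t ≠ s → (∃ u v', EW c (insert v W) t u v') →
        (∃ u v', EW c (insert v W) s u v') → ∃ u v', EW c W t u v' := by
      intro t s hts ht hs
      by_contra hno
      have all : ∀ a ∈ W, c a v = t := by
        intro a ha
        obtain ⟨a', ha', h1, h2⟩ := link t ht a ha
        rcases Relation.ReflTransGen.cases_head h1 with h | ⟨y, h, _⟩
        · rw [h]; exact h2
        · exact absurd ⟨a, y, h⟩ hno
      obtain ⟨a, ha⟩ := hWne
      obtain ⟨a', ha', h1, h2⟩ := link s hs a ha
      exact hts ((all a' ha').symm.trans h2)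
    obtain ⟨i, hi, a, ha, b, hb, hab⟩ := IH i1 i2 i3 h12 h13 h23 (caseB i1 i2 h12 p1 p2)
      (caseB i2 i1 h12.symm p2 p1) (caseB i3 i1 h13.symm p3 p1)
    have hi' : ∃ u v', EW c (insert v W) i u v' := by
      obtain ⟨x, y, h1, h2, h3⟩ := hi
      exact ⟨x, y, sub _ h1, sub _ h2, h3⟩
    have linki := link i hi'
    have P : ∀ t, t ≠ i → ∀ w ∈ W, c w v = t → ∀ z ∈ W,
        ¬ Relation.ReflTransGen (EW c W i) w z → c w z = t := by
      intro t hti w hw hwt z hz hwz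
      obtain ⟨z', hz', h1, h2⟩ := linki z hz
      have h3 : ¬ Relation.ReflTransGen (EW c W i) w z' :=
        fun h => hwz (h.trans (conn_symm hc h1))
      have hzw : ¬ Relation.ReflTransGen (EW c W i) z w := fun h => hwz (conn_symm hc h)
      have e := conn_homog hc hn h1 hw hzw
      have hne : w ≠ z' := by rintro rfl; exact h3 Relation.ReflTransGen.refl
      have hci : c w z' ≠ i := fun h => h3 (Relation.ReflTransGen.single ⟨hw, hz', hne, h⟩)
      rw [hc w z, e, hc z' w]
      rcases hn w z' v hne (fun h => hv (h ▸ hz')) (fun h => hv (h ▸ hw)) with h | h | h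
      · exact absurd (h.trans h2) hci
      · exact h.trans hwt
      · exact absurd (hwt.symm.trans (h.symm.trans h2)) hti
    have fin : ∀ t t', t ≠ t' → t ≠ i → t' ≠ i → (∃ u v', EW c (insert v W) t u v') →
        (∃ u v', EW c (insert v W) t' u v') → False := by
      intro t t' htt hti hti' ht ht'
      obtain ⟨w, hw, _, hwt⟩ := link t ht a ha
      obtain ⟨w', hw', _, hwt'⟩ := link t' ht' a ha
      by_cases hww : Relation.ReflTransGen (EW c W i) w w'
      · obtain ⟨z, hz, hwz⟩ : ∃ z ∈ W, ¬ Relation.ReflTransGen (EW c W i) w z := by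
          by_cases h : Relation.ReflTransGen (EW c W i) w a
          · exact ⟨b, hb, fun h' => hab ((conn_symm hc h).trans h')⟩
          · exact ⟨a, ha, h⟩
        have e1 := P t hti w hw hwt z hz hwz
        have e2 := P t' hti' w' hw' hwt' z hz (fun h => hwz (hww.trans h))
        have e3 := conn_homog hc hn hww hz hwz
        exact htt (e1.symm.trans (e3.trans e2))
      · have e1 := P t hti w hw hwt w' hw' hww
        have e2 := P t' hti' w' hw' hwt' w hw (fun h => hww (conn_symm hc h))
        rw [hc] at e2
        exact htt (e1.symm.trans e2)
    by_cases q1 : i1 = i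
    · exact fin i2 i3 h23 (fun h => h12 (q1.trans h.symm)) (fun h => h13 (q1.trans h.symm)) p2 p3
    by_cases q2 : i2 = i
    · exact fin i1 i3 h13 q1 (fun h => h23 (q2.trans h.symm)) p1 p3
    · exact fin i1 i2 h12 q1 q2 p1 p2

lemma gallai (hc : ∀ u v, c u v = c v u) (hn : NR c) (n : ℕ) : ∀ W : Finset α, W.card = n →
    2 ≤ W.card → ∃ (part : α → α) (r b : κ), (∃ u ∈ W, ∃ v ∈ W, part u ≠ part v) ∧
      (∀ u ∈ W, ∀ v ∈ W, part u ≠ part v → c u v = r ∨ c u v = b) ∧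
      (∀ u ∈ W, ∀ u' ∈ W, ∀ v ∈ W, part u = part u' → part u ≠ part v → c u v = c u' v) := by
  classical
  induction n using Nat.strong_induction_on with
  | _ n IH =>
  intro W hWn hW2
  by_cases h3 : ∃ i1 i2 i3 : κ, i1 ≠ i2 ∧ i1 ≠ i3 ∧ i2 ≠ i3 ∧ (∃ u v, EW c W i1 u v) ∧
      (∃ u v, EW c W i2 u v) ∧ (∃ u v, EW c W i3 u v)
  · obtain ⟨i1, i2, i3, h12, h13, h23, p1, p2, p3⟩ := h3
    obtain ⟨i, ⟨x, y, hxy⟩, a, ha, b, hb, hab⟩ := lemG hc hn W i1 i2 i3 h12 h13 h23 p1 p2 p3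
    let S : Setoid α := ⟨Relation.ReflTransGen (EW c W i), fun _ => Relation.ReflTransGen.refl,
      fun h => conn_symm hc h, fun h h' => h.trans h'⟩
    let rep : α → α := fun x => (Quotient.mk S x).out
    have hrep : ∀ x, Relation.ReflTransGen (EW c W i) x (rep x) := by
      intro x
      exact conn_symm hc (Quotient.mk_out (s := S) x)
    have repeq : ∀ x y, Relation.ReflTransGen (EW c W i) x y → rep x = rep y := by
      intro x y h
      have : Quotient.mk S x = Quotient.mk S y := Quotient.sound h
      simp only [rep, this]
    have hrW : ∀ x ∈ W, rep x ∈ W := fun x hx => conn_mem hx (hrep x)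
    have hab' : rep a ≠ rep b := by
      intro h
      exact hab ((hrep a).trans (h ▸ conn_symm hc (hrep b)))
    have hlt : (W.image rep).card < W.card := by
      refine lt_of_le_of_ne Finset.card_image_le ?_
      intro h
      have := Finset.card_image_iff.1 h
      exact hxy.2.2.1 (this hxy.1 hxy.2.1 (repeq x y (Relation.ReflTransGen.single hxy)))
    have h2 : 2 ≤ (W.image rep).card := by
      have : 1 < (W.image rep).card := Finset.one_lt_card.2
        ⟨rep a, Finset.mem_image_of_mem _ ha, rep b, Finset.mem_image_of_mem _ hb, hab'⟩
      exact this
    obtain ⟨part, r, b', ⟨u, hu, v, hv, huv⟩, hcr, hh⟩ := IH _ (hWn ▸ hlt) (W.image rep) rfl h2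
    obtain ⟨u', hu', rfl⟩ := Finset.mem_image.1 hu
    obtain ⟨v', hv', rfl⟩ := Finset.mem_image.1 hv
    have im : ∀ u ∈ W, rep u ∈ W.image rep := fun u hu => Finset.mem_image_of_mem _ hu
    have tr : ∀ u ∈ W, ∀ v ∈ W, part (rep u) ≠ part (rep v) → c u v = c (rep u) (rep v) := by
      intro u hu v hv huv
      have h1 : ¬ Relation.ReflTransGen (EW c W i) u v := by
        intro h; exact huv (by rw [repeq u v h])
      have h2 : ¬ Relation.ReflTransGen (EW c W i) v (rep u) := by
        intro h
        exact h1 ((hrep u).trans (conn_symm hc h))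
      rw [conn_homog hc hn (hrep u) hv h1, hc, conn_homog hc hn (hrep v) (hrW u hu) h2, hc]
    refine ⟨fun x => part (rep x), r, b', ⟨u', hu', v', hv', huv⟩, ?_, ?_⟩
    · intro u hu v hv huv
      rw [tr u hu v hv huv]
      exact hcr _ (im u hu) _ (im v hv) huv
    · intro u hu u' hu' v hv h1 h2
      have h3 : part (rep u') ≠ part (rep v) := fun h => h2 (h1.trans h)
      rw [tr u hu v hv h2, tr u' hu' v hv h3]
      exact hh _ (im u hu) _ (im u' hu') _ (im v hv) h1 h2
  · obtain ⟨x, hx, y, hy, hxy⟩ := Finset.one_lt_card.1 (show 1 < W.card from hW2)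
    have : ∃ b, ∀ u ∈ W, ∀ v ∈ W, u ≠ v → c u v = c x y ∨ c u v = b := by
      by_contra hno
      push Not at hno
      obtain ⟨u, hu, v, hv, huv, h1, _⟩ := hno (c x y)
      obtain ⟨u', hu', v', hv', huv', h1', h2'⟩ := hno (c u v)
      exact h3 ⟨c x y, c u v, c u' v', h1.symm, h1'.symm, h2'.symm, ⟨x, y, hx, hy, hxy, rfl⟩,
        ⟨u, v, hu, hv, huv, rfl⟩, ⟨u', v', hu', hv', huv', rfl⟩⟩
    obtain ⟨b, hb⟩ := this
    refine ⟨id, c x y, b, ⟨x, hx, y, hy, hxy⟩, fun u hu v hv h => hb u hu v hv h, ?_⟩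
    rintro u hu u' hu' v hv h _
    simp only [id] at h
    rw [h]
end GR

namespace GR
variable {α : Type*} [DecidableEq α]

open Classical in
/-- Number of consecutive pairs of the list that are not related by `T`. -/
noncomputable def br (T : α → α → Prop) : List α → ℕ
  | [] => 0
  | [_] => 0
  | a :: b :: t => (if T a b then 0 else 1) + br T (b :: t)

lemma br_cons_le (T : α → α → Prop) (a : α) (l : List α) : br T (a :: l) ≤ 1 + br T l := by
  cases l with
  | nil => simp [br]
  | cons b t =>
    rw [br]
    split_ifs <;> omega

lemma br_le (T : α → α → Prop) (a : α) (l : List α) : br T (a :: l) ≤ l.length := by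
  induction l generalizing a with
  | nil => simp [br]
  | cons b t ih =>
    have := br_cons_le T a (b :: t)
    have := ih b
    simp
    omega

lemma ins {T : α → α → Prop} {W J : Finset α} (h1 : ∀ j ∈ J, ∀ w ∈ W, T j w ∧ T w j)
    (t : List α) : ∀ (a : α) (js : List α), (∀ x ∈ a :: t, x ∈ W) → (∀ x ∈ js, x ∈ J) →
    br T (a :: t) ≤ js.length → js.length ≤ t.length →
    ∃ L : List α, L.Perm ((a :: t) ++ js) ∧ L.IsChain T ∧ L.head? = some a ∧
      L.getLast? = (a :: t).getLast? := by
  induction t with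
  | nil =>
    intro a js hw hj hb hl
    have : js = [] := by
      apply List.eq_nil_of_length_eq_zero
      simpa using hl
    subst this
    exact ⟨[a], by simp⟩
  | cons b t ih =>
    intro a js hw hj hb hl
    have hW : ∀ x ∈ b :: t, x ∈ W := fun x hx => hw x (List.mem_cons_of_mem _ hx)
    by_cases hc : T a b ∧ js.length ≤ t.length
    · have hb' : br T (b :: t) ≤ js.length := by
        rw [br] at hb; omega
      obtain ⟨L, hp, hch, hhd, hla⟩ := ih b js hW hj hb' hc.2
      obtain ⟨L', rfl⟩ : ∃ L', L = b :: L' := by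
        cases L with
        | nil => simp at hhd
        | cons x L' => simp at hhd; exact ⟨L', by rw [hhd]⟩
      refine ⟨a :: b :: L', ?_, ?_, by simp, ?_⟩
      · exact List.Perm.cons a hp
      · exact List.isChain_cons_cons.2 ⟨hc.1, hch⟩
      · rw [List.getLast?_cons_cons, List.getLast?_cons_cons]; exact hla
    · obtain ⟨j, js', rfl⟩ : ∃ j js', js = j :: js' := by
        cases js with
        | nil =>
          exfalso
          apply hc
          refine ⟨?_, by simp⟩
          by_contra hT
          rw [br, if_neg hT] at hb
          simp at hb
        | cons j js' => exact ⟨j, js', rfl⟩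
      have hjJ : j ∈ J := hj j (by simp)
      simp only [List.length_cons] at hb hl hc
      have hb' : br T (b :: t) ≤ js'.length := by
        by_cases hT : T a b
        · have : ¬ (js'.length + 1 ≤ t.length) := fun h => hc ⟨hT, h⟩
          have := br_le T b t
          omega
        · rw [br, if_neg hT] at hb; omega
      obtain ⟨L, hp, hch, hhd, hla⟩ := ih b js' hW (fun x hx => hj x (List.mem_cons_of_mem _ hx))
        hb' (by omega)
      obtain ⟨L', rfl⟩ : ∃ L', L = b :: L' := by
        cases L with
        | nil => simp at hhd
        | cons x L' => simp at hhd; exact ⟨L', by rw [hhd]⟩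
      refine ⟨a :: j :: b :: L', ?_, ?_, by simp, ?_⟩
      · refine List.Perm.cons a ?_
        exact (List.Perm.cons j hp).trans List.perm_middle.symm
      · refine List.isChain_cons_cons.2 ⟨(h1 j hjJ a (hw a (by simp))).2, ?_⟩
        exact List.isChain_cons_cons.2 ⟨(h1 j hjJ b (hw b (by simp))).1, hch⟩
      · rw [List.getLast?_cons_cons, List.getLast?_cons_cons, List.getLast?_cons_cons]; exact hla

lemma br_filter {R T : α → α → Prop} {J : Finset α} {φ : α → α}
    (h : ∀ u v, u ∉ J → v ∉ J → R u v → T (φ u) (φ v)) : ∀ l : List α, l.IsChain R →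
    br T ((l.filter (fun x => x ∉ J)).map φ) ≤ (l.filter (fun x => x ∈ J)).length
  | [], _ => by simp [br]
  | [a], _ => by
    by_cases ha : a ∈ J <;> simp [ha, br]
  | a :: b :: t, hl => by
    have hl' := (List.isChain_cons_cons.1 hl)
    have ih1 := br_filter h (b :: t) hl'.2
    have ih2 := br_filter h t hl'.2.tail
    by_cases ha : a ∈ J
    · have e1 : (a :: b :: t).filter (fun x => x ∉ J) = (b :: t).filter (fun x => x ∉ J) :=
        List.filter_cons_of_neg (by simpa using ha)
      have e2 : (a :: b :: t).filter (fun x => x ∈ J) = a :: (b :: t).filter (fun x => x ∈ J) :=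
        List.filter_cons_of_pos (by simpa using ha)
      rw [e1, e2, List.length_cons]
      omega
    · have e1 : (a :: b :: t).filter (fun x => x ∉ J) = a :: (b :: t).filter (fun x => x ∉ J) :=
        List.filter_cons_of_pos (by simpa using ha)
      have e2 : (a :: b :: t).filter (fun x => x ∈ J) = (b :: t).filter (fun x => x ∈ J) :=
        List.filter_cons_of_neg (by simpa using ha)
      rw [e1, e2, List.map_cons]
      by_cases hb : b ∈ J
      · have e3 : (b :: t).filter (fun x => x ∉ J) = t.filter (fun x => x ∉ J) :=
          List.filter_cons_of_neg (by simpa using hb)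
        have e4 : (b :: t).filter (fun x => x ∈ J) = b :: t.filter (fun x => x ∈ J) :=
          List.filter_cons_of_pos (by simpa using hb)
        rw [e3, e4, List.length_cons]
        have := br_cons_le T (φ a) ((t.filter (fun x => x ∉ J)).map φ)
        omega
      · have hT := h a b ha hb hl'.1
        have e3 : (b :: t).filter (fun x => x ∉ J) = b :: t.filter (fun x => x ∉ J) :=
          List.filter_cons_of_pos (by simpa using hb)
        rw [e3, List.map_cons] at ih1 ⊢
        rw [br, if_pos hT]
        omega

lemma exists_fresh (W : Finset α) (S : Finset α) (h : S.card ≤ W.card) :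
    ∃ φ : α → α, (∀ x ∈ W, φ x = x) ∧ (∀ x ∈ S, φ x ∈ W) ∧
      (∀ x ∈ S, ∀ y ∈ S, φ x = φ y → x = y) := by
  classical
  have h1 : (S \ W).card ≤ (W \ S).card := by
    have := Finset.card_sdiff_add_card_inter S W
    have h3 := Finset.card_sdiff_add_card_inter W S
    rw [Finset.inter_comm] at h3
    omega
  have : Nonempty ((S \ W : Finset α) ↪ (W \ S : Finset α)) := by
    apply Function.Embedding.nonempty_of_card_le
    simpa using h1
  obtain ⟨e⟩ := this
  have he : ∀ x, (e x : α) ∈ W \ S := fun x => (e x).2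
  refine ⟨fun x => if hx : x ∈ S \ W then (e ⟨x, hx⟩ : α) else x, ?_, ?_, ?_⟩
  · intro x hx
    simp [hx]
  · intro x hx
    by_cases hw : x ∈ W
    · simp [hw]
    · have : x ∈ S \ W := by simp [hx, hw]
      simp only [this, dif_pos]
      exact (Finset.mem_sdiff.1 (he _)).1
  · intro x hx y hy hxy
    by_cases hxw : x ∈ S \ W <;> by_cases hyw : y ∈ S \ W
    · simp only [hxw, hyw, dif_pos] at hxy
      have := e.injective (Subtype.ext hxy)
      simpa using this
    · simp only [hxw, hyw, dif_pos, dif_neg, not_false_eq_true] at hxy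
      exact absurd hy (hxy ▸ (Finset.mem_sdiff.1 (he _)).2)
    · simp only [hxw, hyw, dif_pos, dif_neg, not_false_eq_true] at hxy
      exact absurd hx (hxy ▸ (Finset.mem_sdiff.1 (he _)).2)
    · simpa only [hxw, hyw, dif_neg, not_false_eq_true] using hxy

lemma realize {R T : α → α → Prop} {W J : Finset α} (ℓ : ℕ) (hWJ : Disjoint W J)
    (hT : ∀ j ∈ J, ∀ w ∈ W, T j w ∧ T w j)
    (hR : ∀ u v, u ∉ J → v ∉ J → R u v → u ∈ W ∧ v ∈ W ∧ T u v)
    (hW : 2 * ℓ + 1 ≤ W.card) (hJ : J.card + 1 ≤ ℓ) (hcy : Cy R (2 * ℓ + 1)) :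
    Cy T (2 * ℓ + 1) := by
  classical
  obtain ⟨l, hlen, hnd, hch, hwrap⟩ := hcy.list (by omega)
  by_cases hj : ∃ j ∈ l, j ∈ J
  · obtain ⟨j, hjl, hjJ⟩ := hj
    obtain ⟨l1, l2, rfl⟩ := List.append_of_mem hjl
    have hperm : (l1 ++ j :: l2).Perm (j :: (l2 ++ l1)) :=
      List.perm_middle.trans (List.Perm.cons j List.perm_append_comm)
    have hnd' : (j :: (l2 ++ l1)).Nodup := hperm.nodup_iff.1 hnd
    have hlen' : (l2 ++ l1).length = 2 * ℓ := by
      simp at hlen ⊢; omega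
    have hch0 : (l2 ++ l1).IsChain R := by
      rw [List.isChain_append] at hch ⊢
      refine ⟨hch.2.1.tail, hch.1, ?_⟩
      intro x hx y hy
      apply hwrap
      · rw [List.getLast?_append_of_ne_nil _ (by simp)]
        cases l2 with
        | nil => simp at hx
        | cons z l2 => rw [List.getLast?_cons_cons]; exact hx
      · cases l1 with
        | nil => simp at hy
        | cons z l1 => simpa using hy
    obtain ⟨φ, hφW, hφS, hφi⟩ := exists_fresh W ((l2 ++ l1).toFinset) (by
      have := List.toFinset_card_le (l2 ++ l1)
      omega)
    generalize hl0 : l2 ++ l1 = l0 at *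
    obtain ⟨hjl0, hnd0⟩ := List.nodup_cons.1 hnd'
    have hbr := br_filter (R := R) (T := T) (J := J) (φ := φ) (by
      intro u v hu hv huv
      obtain ⟨h1, h2, h3⟩ := hR u v hu hv huv
      rw [hφW u h1, hφW v h2]; exact h3) l0 hch0
    have hfl : (l0.filter (fun x => x ∉ J)).length + (l0.filter (fun x => x ∈ J)).length = 2 * ℓ := by
      have := List.length_eq_length_filter_add (l := l0) (fun x => decide (x ∈ J))
      have e : (l0.filter (fun x => x ∉ J)) = l0.filter (fun x => !decide (x ∈ J)) := by
        congr 1; ext x; simp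
      rw [e]
      omega
    have hjs : (l0.filter (fun x => x ∈ J)).length + 1 ≤ J.card := by
      have : (j :: l0.filter (fun x => x ∈ J)).Nodup := by
        rw [List.nodup_cons]
        exact ⟨fun h => hjl0 (List.mem_of_mem_filter h), hnd0.filter _⟩
      rw [← List.length_cons (a := j), ← List.toFinset_card_of_nodup this]
      apply Finset.card_le_card
      intro x hx
      simp at hx
      rcases hx with rfl | hx
      · exact hjJ
      · exact hx.2
    have hjsJ : ∀ x ∈ l0.filter (fun x => x ∈ J), x ∈ J := by
      intro x hx; simpa using (List.mem_filter.1 hx).2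
    have hws : ∀ x ∈ (l0.filter (fun x => x ∉ J)).map φ, x ∈ W := by
      intro x hx
      obtain ⟨y, hy, rfl⟩ := List.mem_map.1 hx
      exact hφS y (by simpa using List.mem_of_mem_filter hy)
    have hwn : ((l0.filter (fun x => x ∉ J)).map φ).Nodup := by
      apply List.Nodup.map_on _ (hnd0.filter _)
      intro x hx y hy hxy
      exact hφi x (by simpa using List.mem_of_mem_filter hx) y
        (by simpa using List.mem_of_mem_filter hy) hxy
    have hwl : ((l0.filter (fun x => x ∉ J)).map φ).length +
        (l0.filter (fun x => x ∈ J)).length = 2 * ℓ := by rw [List.length_map]; exact hfl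
    clear hfl
    generalize (l0.filter (fun x => x ∉ J)).map φ = ws at *
    have hjn : (l0.filter (fun x => x ∈ J)).Nodup := hnd0.filter _
    have hjj : j ∉ l0.filter (fun x => x ∈ J) := fun h => hjl0 (List.mem_of_mem_filter h)
    generalize l0.filter (fun x => x ∈ J) = js at *
    cases ws with
    | nil => simp at hwl; omega
    | cons a t =>
      obtain ⟨L, hp, hLc, hLh, hLl⟩ := ins hT t a js hws hjsJ hbr (by simp at hwl; omega)
      have hlast : ∀ x ∈ L.getLast?, x ∈ W := by
        intro x hx
        rw [hLl] at hx
        exact hws x (List.mem_of_getLast? hx)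
      have hWJ' : ∀ x ∈ W, x ∉ J := fun x hx => Finset.disjoint_left.1 hWJ hx
      refine CyL.cy (l := L ++ [j]) ⟨?_, ?_, ?_⟩ ?_ (by omega)
      · have hp' : (L ++ [j]).Perm (((a :: t) ++ js) ++ [j]) := List.Perm.append_right _ hp
        rw [hp'.nodup_iff, List.nodup_append', List.nodup_append']
        refine ⟨⟨hwn, hjn, ?_⟩, by simp, ?_⟩
        · intro x hx hx'
          exact hWJ' x (hws x hx) (hjsJ x hx')
        · intro x hx hx'
          simp only [List.mem_singleton] at hx'
          subst hx'
          rcases List.mem_append.1 hx with hx | hx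
          · exact hWJ' _ (hws _ hx) hjJ
          · exact hjj hx
      · rw [List.isChain_append]
        refine ⟨hLc, by simp, ?_⟩
        intro x hx y hy
        simp at hy; subst hy
        exact (hT _ hjJ x (hlast x hx)).2
      · intro x hx y hy
        simp at hx; subst hx
        have : y = a := by
          cases L with
          | nil => simp at hLh
          | cons z L => simp at hLh hy; rw [← hy, hLh]
        subst this
        exact (hT _ hjJ _ (hws _ (by simp))).1
      · have := hp.length_eq
        simp at this hwl ⊢
        omega
  · push Not at hj
    refine CyL.cy (l := l) ⟨hnd, ?_, ?_⟩ hlen (by omega)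
    · rw [List.isChain_iff_getElem] at hch ⊢
      intro i hi
      exact (hR _ _ (hj _ (List.getElem_mem _)) (hj _ (List.getElem_mem _)) (hch i hi)).2.2
    · intro x hx y hy
      exact (hR _ _ (hj _ (List.mem_of_getLast? hx)) (hj _ (List.mem_of_head? hy))
        (hwrap x hx y hy)).2.2
end GR

namespace GR
variable {α : Type*} [DecidableEq α] {κ : Type*}

/-- Edges of color `i` inside `W` or between `W` and `J`. -/
def AJ (c : α → α → κ) (W J : Finset α) (i : κ) (u v : α) : Prop :=
  c u v = i ∧ ((u ∈ W ∧ v ∈ W) ∨ (u ∈ W ∧ v ∈ J) ∨ (u ∈ J ∧ v ∈ W))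

lemma AJ.symm {c : α → α → κ} (hc : ∀ u v, c u v = c v u) {W J : Finset α} {i : κ} :
    ∀ u v, AJ c W J i u v → AJ c W J i v u := by
  rintro u v ⟨h1, h2⟩
  refine ⟨by rw [hc]; exact h1, ?_⟩
  tauto

/-- No edge of color `i` inside `W`. -/
def Free (c : α → α → κ) (i : κ) (W : Finset α) : Prop :=
  ∀ u ∈ W, ∀ v ∈ W, u ≠ v → c u v ≠ i

/-- Situation of the induction step with respect to two chosen colors `r`, `b`. -/
structure Cfg (c : α → α → κ) (ℓ N s : ℕ) (W Xr Xb : Finset α) (r b : κ) : Prop where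
  hc : ∀ u v, c u v = c v u
  hℓ : 3 ≤ ℓ
  hN : 2 * ℓ ≤ N
  D0 : ∀ W' ⊆ W, Free c r W' → Free c b W' → W'.card + s ≤ N
  Dr : ∀ W' ⊆ W, ∀ J, Free c b W' → Disjoint J W' → J ⊆ Xr ∪ W → (∀ x ∈ J, ∀ w ∈ W', c x w = r) →
    J.card + 1 ≤ ℓ → W'.card + J.card + s ≤ 2 * N
  Db : ∀ W' ⊆ W, ∀ J, Free c r W' → Disjoint J W' → J ⊆ Xb ∪ W → (∀ x ∈ J, ∀ w ∈ W', c x w = b) →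
    J.card + 1 ≤ ℓ → W'.card + J.card + s ≤ 2 * N
  Drb : ∀ W' ⊂ W, ∀ J J', Disjoint J W' → J ⊆ Xr ∪ W → (∀ x ∈ J, ∀ w ∈ W', c x w = r) →
    J.card + 1 ≤ ℓ → Disjoint J' W' → J' ⊆ Xb ∪ W → (∀ x ∈ J', ∀ w ∈ W', c x w = b) →
    J'.card + 1 ≤ ℓ → W'.card + J.card + J'.card + s ≤ 4 * N
  ncr : ¬ Cy (AJ c W Xr r) (2 * ℓ + 1)
  ncb : ¬ Cy (AJ c W Xb b) (2 * ℓ + 1)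
  xrW : Disjoint Xr W
  xbW : Disjoint Xb W
  xr : ∀ x ∈ Xr, ∀ w ∈ W, c x w = r
  xb : ∀ x ∈ Xb, ∀ w ∈ W, c x w = b
  cr : Xr.card + 1 ≤ ℓ
  cb : Xb.card + 1 ≤ ℓ

variable {c : α → α → κ} {ℓ N s : ℕ} {W Xr Xb : Finset α} {r b : κ}

lemma Cfg.symm (h : Cfg c ℓ N s W Xr Xb r b) : Cfg c ℓ N s W Xb Xr b r where
  hc := h.hc
  hℓ := h.hℓ
  hN := h.hN
  D0 := fun W' h1 h2 h3 => h.D0 W' h1 h3 h2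
  Dr := h.Db
  Db := h.Dr
  Drb := fun W' h1 J J' a1 a2 a3 a4 b1 b2 b3 b4 => by
    have := h.Drb W' h1 J' J b1 b2 b3 b4 a1 a2 a3 a4
    omega
  ncr := h.ncb
  ncb := h.ncr
  xrW := h.xbW
  xbW := h.xrW
  xr := h.xb
  xb := h.xr
  cr := h.cb
  cb := h.cr

lemma Cfg.L1 (h : Cfg c ℓ N s W Xr Xb r b) {P Q : Finset α} (hd : Disjoint P Q)
    (hP : P ⊆ Xr ∪ W) (hQ : Q ⊆ W) (hPQ : ∀ p ∈ P, ∀ q ∈ Q, c p q = r) (h1 : ℓ ≤ P.card)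
    (h2 : ℓ + 1 ≤ Q.card) : Free c r Q := by
  intro u hu v hv huv hcuv
  apply h.ncr
  refine c1 (AJ.symm h.hc) ℓ (by have := h.hℓ; omega) P Q hd ?_ h1 h2 u v hu hv huv
    ⟨hcuv, Or.inl ⟨hQ hu, hQ hv⟩⟩
  intro p hp q hq
  refine ⟨hPQ p hp q hq, ?_⟩
  rcases Finset.mem_union.1 (hP hp) with h' | h'
  · exact Or.inr (Or.inr ⟨h', hQ hq⟩)
  · exact Or.inl ⟨h', hQ hq⟩

lemma Cfg.L2 (h : Cfg c ℓ N s W Xr Xb r b) {P Q : Finset α} (hd : Disjoint P Q)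
    (hP : P ⊆ W) (hQ : Q ⊆ W) (hPQ : ∀ p ∈ P, ∀ q ∈ Q, c p q = r) (h1 : ℓ ≤ P.card)
    (h2 : ℓ ≤ Q.card) : Xr = ∅ := by
  have hl := h.hℓ
  by_contra hne
  obtain ⟨y, hy⟩ := Finset.nonempty_iff_ne_empty.2 hne
  obtain ⟨p, hp⟩ := Finset.card_pos.1 (show 0 < P.card by omega)
  obtain ⟨q, hq⟩ := Finset.card_pos.1 (show 0 < Q.card by omega)
  have hyW : y ∉ W := Finset.disjoint_left.1 h.xrW hy
  apply h.ncr
  refine c2 (AJ.symm h.hc) ℓ (by omega) P Q hd ?_ h1 h2 y p q (fun h' => hyW (hP h'))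
    (fun h' => hyW (hQ h')) hp hq ⟨h.xr y hy p (hP hp), Or.inr (Or.inr ⟨hy, hP hp⟩)⟩
    ⟨h.xr y hy q (hQ hq), Or.inr (Or.inr ⟨hy, hQ hq⟩)⟩
  intro p hp q hq
  exact ⟨hPQ p hp q hq, Or.inl ⟨hP hp, hQ hq⟩⟩

lemma Cfg.L3 (h : Cfg c ℓ N s W Xr Xb r b) {P Q : Finset α} (hd : Disjoint P Q)
    (hP : P ⊆ W) (hQ : Q ⊆ W) (hPQ : ∀ p ∈ P, ∀ q ∈ Q, c p q = r) (h1 : ℓ ≤ P.card)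
    (h2 : ℓ ≤ Q.card) {r1 b1 b2 r2 : α} (hr1 : r1 ∈ Q) (hr2 : r2 ∈ Q) (hb1 : b1 ∈ W) (hb2 : b2 ∈ W)
    (n1 : b1 ∉ P) (n2 : b1 ∉ Q) (n3 : b2 ∉ P) (n4 : b2 ∉ Q) (hbb : b1 ≠ b2)
    (e1 : c r1 b1 = r) (e2 : c b1 b2 = r) (e3 : c r2 b2 = r) : r1 = r2 := by
  have hl := h.hℓ
  by_contra hne
  apply h.ncr
  refine c3 (AJ.symm h.hc) ℓ (by omega) P Q hd ?_ (by omega) h2 r1 b1 b2 r2 hr1 hr2 n1 n2 n3 n4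
    hne hbb ⟨e1, Or.inl ⟨hQ hr1, hb1⟩⟩ ⟨e2, Or.inl ⟨hb1, hb2⟩⟩
    ⟨by rw [h.hc]; exact e3, Or.inl ⟨hb2, hQ hr2⟩⟩
  intro p hp q hq
  exact ⟨hPQ p hp q hq, Or.inl ⟨hP hp, hQ hq⟩⟩

/-- The parts `A`, `R`, `B` of `W`. -/
structure Parts (c : α → α → κ) (ℓ : ℕ) (W A R B : Finset α) (r b : κ) : Prop where
  un : W = A ∪ R ∪ B
  dAR : Disjoint A R
  dAB : Disjoint A B
  dRB : Disjoint R B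
  ar : ∀ x ∈ R, ∀ a ∈ A, c x a = r
  ab : ∀ x ∈ B, ∀ a ∈ A, c x a = b
  rb : ∀ x ∈ R, ∀ y ∈ B, c x y = r ∨ c x y = b
  hA : ℓ + 1 ≤ A.card

variable {A R B : Finset α}

lemma Parts.symm (hc : ∀ u v, c u v = c v u) (h : Parts c ℓ W A R B r b) :
    Parts c ℓ W A B R b r where
  un := by rw [h.un, Finset.union_assoc, Finset.union_comm R B, Finset.union_assoc]
  dAR := h.dAB
  dAB := h.dAR
  dRB := h.dRB.symm
  ar := h.ab
  ab := h.ar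
  rb := fun x hx y hy => by rw [hc]; exact (h.rb y hy x hx).symm
  hA := h.hA

lemma Parts.card (h : Parts c ℓ W A R B r b) : W.card = A.card + R.card + B.card := by
  rw [h.un, Finset.card_union_of_disjoint, Finset.card_union_of_disjoint h.dAR]
  exact Finset.disjoint_union_left.2 ⟨h.dAB, h.dRB⟩

lemma Parts.sA (h : Parts c ℓ W A R B r b) : A ⊆ W := by
  rw [h.un]; intro x hx; simp [hx]
lemma Parts.sR (h : Parts c ℓ W A R B r b) : R ⊆ W := by
  rw [h.un]; intro x hx; simp [hx]
lemma Parts.sB (h : Parts c ℓ W A R B r b) : B ⊆ W := by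
  rw [h.un]; intro x hx; simp [hx]

/-- Data about `Xr ∪ R`. -/
lemma Cfg.PR (h : Cfg c ℓ N s W Xr Xb r b) (p : Parts c ℓ W A R B r b) :
    (Xr ∪ R).card = Xr.card + R.card ∧ Disjoint (Xr ∪ R) A ∧ Xr ∪ R ⊆ Xr ∪ W ∧
      ∀ x ∈ Xr ∪ R, ∀ w ∈ A, c x w = r := by
  refine ⟨?_, ?_, ?_, ?_⟩
  · exact Finset.card_union_of_disjoint (h.xrW.mono_right p.sR)
  · exact Finset.disjoint_union_left.2 ⟨h.xrW.mono_right p.sA, p.dAR.symm⟩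
  · exact Finset.union_subset_union_right p.sR
  · intro x hx w hw
    rcases Finset.mem_union.1 hx with hx | hx
    · exact h.xr x hx w (p.sA hw)
    · exact p.ar x hx w hw

lemma Cfg.caseAlpha' (h : Cfg c ℓ N s W Xr Xb r b) (p : Parts c ℓ W A R B r b)
    (h1 : R.card ≤ ℓ) (h2 : ℓ ≤ Xr.card + R.card) (h3 : Xb.card + B.card + 1 ≤ ℓ) :
    W.card + Xr.card + Xb.card + s ≤ 4 * N := by
  obtain ⟨c1, d1, s1, e1⟩ := h.PR p
  obtain ⟨c2, d2, s2, e2⟩ := h.symm.PR (p.symm h.hc)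
  have := p.card
  have := h.cr
  have := h.hN
  have f := h.L1 d1 s1 p.sA e1 (by omega) p.hA
  have := h.Db A p.sA _ f d2 s2 e2 (by omega)
  omega

lemma Cfg.caseAlpha (h : Cfg c ℓ N s W Xr Xb r b) (p : Parts c ℓ W A R B r b) (hAW : A ≠ W)
    (h1 : R.card ≤ ℓ) (h2 : B.card ≤ ℓ) :
    W.card + Xr.card + Xb.card + s ≤ 4 * N := by
  obtain ⟨c1, d1, s1, e1⟩ := h.PR p
  obtain ⟨c2, d2, s2, e2⟩ := h.symm.PR (p.symm h.hc)
  have := p.card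
  have := h.cr
  have := h.cb
  have := h.hN
  rcases Nat.lt_or_ge (Xr.card + R.card) ℓ with a1 | a1 <;>
    rcases Nat.lt_or_ge (Xb.card + B.card) ℓ with a2 | a2
  · have := h.Drb A (Finset.ssubset_iff_subset_ne.2 ⟨p.sA, hAW⟩) _ _ d1 s1 e1 (by omega) d2 s2 e2
      (by omega)
    omega
  · have := h.symm.caseAlpha' (p.symm h.hc) h2 a2 a1
    omega
  · exact h.caseAlpha' p h1 a1 a2
  · have f := h.L1 d1 s1 p.sA e1 (by omega) p.hA
    have f' := h.symm.L1 d2 s2 p.sA e2 (by omega) p.hA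
    have := h.D0 A p.sA f f'
    omega

/-- Consequences of `R` being large. -/
lemma Cfg.bigR (h : Cfg c ℓ N s W Xr Xb r b) (p : Parts c ℓ W A R B r b) (h1 : ℓ + 1 ≤ R.card) :
    Free c r A ∧ Free c r R ∧ Xr = ∅ := by
  have hA := p.hA
  have s1 : R ⊆ Xr ∪ W := fun x hx => Finset.mem_union_right _ (p.sR hx)
  have s2 : A ⊆ Xr ∪ W := fun x hx => Finset.mem_union_right _ (p.sA hx)
  refine ⟨?_, ?_, ?_⟩
  · exact h.L1 p.dAR.symm s1 p.sA p.ar (by omega) hA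
  · exact h.L1 p.dAR s2 p.sR (fun a ha x hx => by rw [h.hc]; exact p.ar x hx a ha) (by omega) h1
  · exact h.L2 p.dAR.symm p.sR p.sA p.ar (by omega) (by omega)

lemma Cfg.caseBeta (h : Cfg c ℓ N s W Xr Xb r b) (p : Parts c ℓ W A R B r b)
    (h1 : ℓ + 1 ≤ R.card) (h2 : B.card ≤ ℓ) :
    W.card + Xr.card + Xb.card + s ≤ 4 * N := by
  obtain ⟨fA, fR, hX⟩ := h.bigR p h1
  obtain ⟨c2, d2, s2, e2⟩ := h.symm.PR (p.symm h.hc)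
  have := p.card
  have := h.cb
  have := h.hN
  have := h.hℓ
  have hx : Xr.card = 0 := by rw [hX]; rfl
  have q := h.Db R p.sR ∅ fR (by simp) (by simp) (by simp) (by simp; omega)
  simp only [Finset.card_empty] at q
  rcases Nat.lt_or_ge (Xb.card + B.card) ℓ with a2 | a2
  · have := h.Db A p.sA _ fA d2 s2 e2 (by omega)
    omega
  · have f' := h.symm.L1 d2 s2 p.sA e2 (by omega) p.hA
    have := h.D0 A p.sA fA f'
    omega

lemma Cfg.gamma1 (h : Cfg c ℓ N s W Xr Xb r b) (p : Parts c ℓ W A R B r b) (hrb : r ≠ b)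
    (h1 : ℓ + 1 ≤ R.card) (h2 : ℓ + 1 ≤ B.card) {b1 r1 r2 : α} (hb1 : b1 ∈ B) (hr1 : r1 ∈ R)
    (hr2 : r2 ∈ R) (hr : r1 ≠ r2) (hcr : c r1 r2 = b) (hbl : ∀ x ∈ R, c x b1 = b) :
    W.card + Xr.card + Xb.card + s ≤ 4 * N := by
  obtain ⟨fA, fR, hX⟩ := h.bigR p h1
  obtain ⟨fA', fB, hX'⟩ := h.symm.bigR (p.symm h.hc) h2
  have hA := p.hA
  have pc := p.card
  have hl := h.hℓ
  have hdRB := Finset.disjoint_left.1 p.dRB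
  have hdAB := Finset.disjoint_left.1 p.dAB
  have hdAR := Finset.disjoint_left.1 p.dAR
  have arA : ∀ a ∈ A, ∀ x ∈ R, c a x = r := fun a ha x hx => by rw [h.hc]; exact p.ar x hx a ha
  have abA : ∀ a ∈ A, ∀ x ∈ B, c a x = b := fun a ha x hx => by rw [h.hc]; exact p.ab x hx a ha
  -- `r1` and `r2` are red to `B \ {b1}`
  have red1 : ∀ y ∈ B, y ≠ b1 → c r1 y = r ∧ c r2 y = r := by
    intro y hy hyb
    constructor
    · rcases p.rb r1 hr1 y hy with h' | h'
      · exact h'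
      · exfalso
        apply hyb
        exact h.symm.L3 p.dAB p.sA p.sB abA (by omega) (by omega) (r1 := y) (b1 := r1) (b2 := r2)
          hy hb1 (p.sR hr1) (p.sR hr2) (fun q => hdAR q hr1) (fun q => hdRB hr1 q)
          (fun q => hdAR q hr2) (fun q => hdRB hr2 q) hr (by rw [h.hc]; exact h') hcr
          (by rw [h.hc]; exact hbl _ hr2)
    · rcases p.rb r2 hr2 y hy with h' | h'
      · exact h'
      · exfalso
        apply hyb
        exact h.symm.L3 p.dAB p.sA p.sB abA (by omega) (by omega) (r1 := y) (b1 := r2) (b2 := r1)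
          hy hb1 (p.sR hr2) (p.sR hr1) (fun q => hdAR q hr2) (fun q => hdRB hr2 q)
          (fun q => hdAR q hr1) (fun q => hdRB hr1 q) hr.symm (by rw [h.hc]; exact h')
          (by rw [h.hc]; exact hcr) (by rw [h.hc]; exact hbl _ hr1)
  have fB' : Free c r (B.erase b1) := by
    intro u hu v hv huv hcuv
    obtain ⟨hu1, hu2⟩ := Finset.mem_erase.1 hu
    obtain ⟨hv1, hv2⟩ := Finset.mem_erase.1 hv
    apply hr
    exact h.L3 p.dAR p.sA p.sR arA (by omega) (by omega) (r1 := r1) (b1 := u) (b2 := v)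
      hr1 hr2 (p.sB hu2) (p.sB hv2) (fun q => hdAB q hu2) (fun q => hdRB q hu2)
      (fun q => hdAB q hv2) (fun q => hdRB q hv2) huv (red1 u hu2 hu1).1 hcuv (red1 v hv2 hv1).2
  have fB'' : Free c b (B.erase b1) := by
    intro u hu v hv
    exact fB u (Finset.mem_of_mem_erase hu) v (Finset.mem_of_mem_erase hv)
  have fR' : Free c r (insert b1 R) := by
    intro u hu v hv huv hcuv
    rcases Finset.mem_insert.1 hu with rfl | hu' <;> rcases Finset.mem_insert.1 hv with rfl | hv'
    · exact huv rfl
    · rw [h.hc, hbl v hv'] at hcuv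
      exact hrb hcuv.symm
    · rw [hbl u hu'] at hcuv
      exact hrb hcuv.symm
    · exact fR u hu' v hv' huv hcuv
  have q1 := h.D0 A p.sA fA fA'
  have q2 := h.D0 (B.erase b1) ((Finset.erase_subset _ _).trans p.sB) fB' fB''
  have q3 := h.Db (insert b1 R) (Finset.insert_subset (p.sB hb1) p.sR) ∅ fR' (by simp) (by simp)
    (by simp) (by simp; omega)
  rw [Finset.card_erase_of_mem hb1] at q2
  rw [Finset.card_insert_of_notMem (fun q => hdRB q hb1), Finset.card_empty] at q3
  have hx : Xr.card = 0 := by rw [hX]; rfl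
  have hx' : Xb.card = 0 := by rw [hX']; rfl
  omega

lemma Cfg.gamma0 (h : Cfg c ℓ N s W Xr Xb r b) (p : Parts c ℓ W A R B r b)
    (h1 : ℓ + 1 ≤ R.card) (h2 : ℓ + 1 ≤ B.card) (hB : Free c r B) :
    W.card + Xr.card + Xb.card + s ≤ 4 * N := by
  obtain ⟨fA, fR, hX⟩ := h.bigR p h1
  obtain ⟨fA', fB, hX'⟩ := h.symm.bigR (p.symm h.hc) h2
  have pc := p.card
  have hl := h.hℓ
  have q1 := h.D0 A p.sA fA fA'
  have q2 := h.D0 B p.sB hB fB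
  have q3 := h.Db R p.sR ∅ fR (by simp) (by simp) (by simp) (by simp; omega)
  rw [Finset.card_empty] at q3
  have hx : Xr.card = 0 := by rw [hX]; rfl
  have hx' : Xb.card = 0 := by rw [hX']; rfl
  omega

lemma Cfg.gamma (h : Cfg c ℓ N s W Xr Xb r b) (p : Parts c ℓ W A R B r b) (hrb : r ≠ b)
    (h1 : ℓ + 1 ≤ R.card) (h2 : ℓ + 1 ≤ B.card) :
    W.card + Xr.card + Xb.card + s ≤ 4 * N := by
  by_cases hB : Free c r B
  · exact h.gamma0 p h1 h2 hB
  by_cases hR : Free c b R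
  · have := h.symm.gamma0 (p.symm h.hc) h2 h1 hR
    omega
  unfold Free at hB hR
  push Not at hB hR
  obtain ⟨b1, hb1, b2, hb2, hbb, hcb⟩ := hB
  obtain ⟨r1, hr1, r2, hr2, hrr, hcr⟩ := hR
  have hA := p.hA
  have hl := h.hℓ
  have hdRB := Finset.disjoint_left.1 p.dRB
  have hdAB := Finset.disjoint_left.1 p.dAB
  have hdAR := Finset.disjoint_left.1 p.dAR
  have arA : ∀ a ∈ A, ∀ x ∈ R, c a x = r := fun a ha x hx => by rw [h.hc]; exact p.ar x hx a ha
  have abA : ∀ a ∈ A, ∀ x ∈ B, c a x = b := fun a ha x hx => by rw [h.hc]; exact p.ab x hx a ha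
  have K1 : ∀ x ∈ R, ∀ y ∈ R, c x b1 = r → c y b2 = r → x = y := by
    intro x hx y hy e1 e2
    exact h.L3 p.dAR p.sA p.sR arA (by omega) (by omega)
      hx hy (p.sB hb1) (p.sB hb2) (fun q => hdAB q hb1) (fun q => hdRB q hb1)
      (fun q => hdAB q hb2) (fun q => hdRB q hb2) hbb e1 hcb e2
  have K2 : ∀ x ∈ B, ∀ y ∈ B, c r1 x = b → c r2 y = b → x = y := by
    intro x hx y hy e1 e2
    exact h.symm.L3 p.dAB p.sA p.sB abA (by omega) (by omega)
      hx hy (p.sR hr1) (p.sR hr2) (fun q => hdAR q hr1) (fun q => hdRB hr1 q)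
      (fun q => hdAR q hr2) (fun q => hdRB hr2 q) hrr (by rw [h.hc]; exact e1) hcr
      (by rw [h.hc]; exact e2)
  by_cases n1 : ∃ x ∈ R, c x b1 = r
  swap
  · push Not at n1
    exact h.gamma1 p hrb h1 h2 hb1 hr1 hr2 hrr hcr
      (fun x hx => (p.rb x hx b1 hb1).resolve_left (n1 x hx))
  by_cases n2 : ∃ x ∈ R, c x b2 = r
  swap
  · push Not at n2
    exact h.gamma1 p hrb h1 h2 hb2 hr1 hr2 hrr hcr
      (fun x hx => (p.rb x hx b2 hb2).resolve_left (n2 x hx))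
  obtain ⟨x0, hx0, e1⟩ := n1
  obtain ⟨x0', hx0', e2⟩ := n2
  obtain rfl := K1 x0 hx0 x0' hx0' e1 e2
  have bl1 : ∀ x ∈ R, x ≠ x0 → c x b1 = b := fun x hx hne =>
    (p.rb x hx b1 hb1).resolve_left (fun q => hne (K1 x hx x0 hx0 q e2))
  have bl2 : ∀ x ∈ R, x ≠ x0 → c x b2 = b := fun x hx hne =>
    (p.rb x hx b2 hb2).resolve_left (fun q => hne (K1 x0 hx0 x hx e1 q).symm)
  have goal2 : ∀ q1 ∈ R, (∀ y ∈ B, c q1 y = r) → W.card + Xr.card + Xb.card + s ≤ 4 * N := by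
    intro q1 hq1 hall
    have := h.symm.gamma1 (p.symm h.hc) hrb.symm h2 h1 hq1 hb1 hb2 hbb hcb
      (fun y hy => by rw [h.hc]; exact hall y hy)
    omega
  by_cases g1 : r1 = x0
  · have g2 : r2 ≠ x0 := fun q => hrr (g1.trans q.symm)
    apply goal2 r1 hr1
    intro y hy
    refine (p.rb r1 hr1 y hy).resolve_right ?_
    intro q
    have a1 := K2 y hy b1 hb1 q (bl1 r2 hr2 g2)
    have a2 := K2 y hy b2 hb2 q (bl2 r2 hr2 g2)
    exact hbb (a1.symm.trans a2)
  · by_cases g2 : r2 = x0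
    · apply goal2 r2 hr2
      intro y hy
      refine (p.rb r2 hr2 y hy).resolve_right ?_
      intro q
      have a1 := K2 b1 hb1 y hy (bl1 r1 hr1 g1) q
      have a2 := K2 b2 hb2 y hy (bl2 r1 hr1 g1) q
      exact hbb (a1.trans a2.symm)
    · exact absurd (K2 b1 hb1 b2 hb2 (bl1 r1 hr1 g1) (bl2 r2 hr2 g2)) hbb

lemma Cfg.big (h : Cfg c ℓ N s W Xr Xb r b) (p : Parts c ℓ W A R B r b) (hrb : r ≠ b)
    (hAW : A ≠ W) : W.card + Xr.card + Xb.card + s ≤ 4 * N := by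
  rcases Nat.lt_or_ge ℓ R.card with h1 | h1 <;> rcases Nat.lt_or_ge ℓ B.card with h2 | h2
  · exact h.gamma p hrb h1 h2
  · exact h.caseBeta p h1 h2
  · have := h.symm.caseBeta (p.symm h.hc) h2 h1
    omega
  · exact h.caseAlpha p hAW h1 h2
end GR

namespace GR
variable {α : Type*} [DecidableEq α] {κ : Type*}

/-- Auxiliary red relation on `W ∪ P ∪ Q`. -/
def redU (c : α → α → κ) (W P Q : Finset α) (r : κ) (u v : α) : Prop :=
  (u ∈ W ∪ P ∪ Q ∧ v ∈ W ∪ P ∪ Q) ∧ ((u ∈ W ∧ v ∈ W ∧ c u v = r) ∨ u ∈ P ∨ v ∈ P)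

/-- Auxiliary blue relation on `W ∪ P ∪ Q`. -/
def blueU (c : α → α → κ) (W P Q : Finset α) (b : κ) (u v : α) : Prop :=
  (u ∈ W ∪ P ∪ Q ∧ v ∈ W ∪ P ∪ Q) ∧ (u ∉ P ∧ v ∉ P) ∧
    ((u ∈ W ∧ v ∈ W ∧ c u v = b) ∨ u ∈ Q ∨ v ∈ Q)

lemma no_red {c : α → α → κ} (hc : ∀ u v, c u v = c v u) {W P Q : Finset α} {r : κ} {ℓ : ℕ}
    (hd : Disjoint P W) (hx : ∀ x ∈ P, ∀ w ∈ W, c x w = r) (hW : 2 * ℓ + 1 ≤ W.card)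
    (hP : P.card + 1 ≤ ℓ) (hQ : Q ⊆ Q) (h : Cy (redU c W P Q r) (2 * ℓ + 1))
    (hall : ∀ u v, u ∉ P → v ∉ P → redU c W P Q r u v → u ∈ W ∧ v ∈ W) :
    Cy (AJ c W P r) (2 * ℓ + 1) := by
  refine realize ℓ hd.symm ?_ ?_ hW hP h
  · intro j hj w hw
    exact ⟨⟨hx j hj w hw, Or.inr (Or.inr ⟨hj, hw⟩)⟩,
      ⟨by rw [hc]; exact hx j hj w hw, Or.inr (Or.inl ⟨hw, hj⟩)⟩⟩
  · intro u v hu hv huv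
    obtain ⟨h1, h2⟩ := hall u v hu hv huv
    refine ⟨h1, h2, ?_, Or.inl ⟨h1, h2⟩⟩
    obtain ⟨_, h3⟩ := huv
    tauto

lemma no_blue {c : α → α → κ} (hc : ∀ u v, c u v = c v u) {W P Q : Finset α} {b : κ} {ℓ : ℕ}
    (hd : Disjoint Q W) (hx : ∀ x ∈ Q, ∀ w ∈ W, c x w = b) (hW : 2 * ℓ + 1 ≤ W.card)
    (hQ : Q.card + 1 ≤ ℓ) (h : Cy (blueU c W P Q b) (2 * ℓ + 1)) :
    Cy (AJ c W Q b) (2 * ℓ + 1) := by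
  refine realize ℓ hd.symm ?_ ?_ hW hQ h
  · intro j hj w hw
    exact ⟨⟨hx j hj w hw, Or.inr (Or.inr ⟨hj, hw⟩)⟩,
      ⟨by rw [hc]; exact hx j hj w hw, Or.inr (Or.inl ⟨hw, hj⟩)⟩⟩
  · intro u v hu hv huv
    obtain ⟨_, _, h3⟩ := huv
    unfold AJ
    tauto

/-- The structure of the induction. -/
structure St (c : α → α → κ) (ℓ : ℕ) (K : Finset κ) (W : Finset α) (X : κ → Finset α) : Prop where
  col : ∀ u ∈ W, ∀ v ∈ W, u ≠ v → c u v ∈ K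
  xW : ∀ i ∈ K, Disjoint (X i) W
  xc : ∀ i ∈ K, ∀ x ∈ X i, ∀ w ∈ W, c x w = i
  card : ∀ i ∈ K, (X i).card + 1 ≤ ℓ
  nc : ∀ i ∈ K, ¬ Cy (AJ c W (X i) i) (2 * ℓ + 1)

variable {c : α → α → κ} {ℓ : ℕ} {K : Finset κ} {W : Finset α} {X : κ → Finset α}

lemma St.sub (h : St c ℓ K W X) {K' : Finset κ} {W' : Finset α} {X' : κ → Finset α} (hK : K' ⊆ K)
    (hW : W' ⊆ W) (col : ∀ u ∈ W', ∀ v ∈ W', u ≠ v → c u v ∈ K')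
    (xW : ∀ i ∈ K', Disjoint (X' i) W')
    (xs : ∀ i ∈ K', X' i ⊆ X i ∪ W)
    (xc : ∀ i ∈ K', ∀ x ∈ X' i, ∀ w ∈ W', c x w = i)
    (card : ∀ i ∈ K', (X' i).card + 1 ≤ ℓ) : St c ℓ K' W' X' where
  col := col
  xW := xW
  xc := xc
  card := card
  nc := by
    intro i hi hcy
    apply h.nc i (hK hi)
    refine hcy.mono ?_
    rintro u v ⟨h1, h2⟩
    refine ⟨h1, ?_⟩
    have hx : ∀ x ∈ X' i, x ∈ X i ∨ x ∈ W := fun x hx => Finset.mem_union.1 (xs i hi hx)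
    rcases h2 with ⟨h3, h4⟩ | ⟨h3, h4⟩ | ⟨h3, h4⟩
    · exact Or.inl ⟨hW h3, hW h4⟩
    · rcases hx v h4 with h5 | h5
      · exact Or.inr (Or.inl ⟨hW h3, h5⟩)
      · exact Or.inl ⟨hW h3, h5⟩
    · rcases hx u h3 with h5 | h5
      · exact Or.inr (Or.inr ⟨h5, hW h4⟩)
      · exact Or.inl ⟨h5, hW h4⟩

lemma base1 (hc : ∀ u v, c u v = c v u) (hℓ : 3 ≤ ℓ) {i : κ} (h : St c ℓ {i} W X) :
    W.card + (X i).card ≤ 2 * ℓ := by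
  by_contra hlt
  have hi : i ∈ ({i} : Finset κ) := Finset.mem_singleton_self i
  apply h.nc i hi
  have hd := Finset.disjoint_left.1 (h.xW i hi)
  have hcard := h.card i hi
  have hU : (W ∪ X i).card = W.card + (X i).card := Finset.card_union_of_disjoint (h.xW i hi).symm
  let cl : α → Option α := fun x => if x ∈ X i then none else some x
  have hcl : ∀ a, ((W ∪ X i).filter (fun x => cl x = a)).card ≤ ℓ - 1 := by
    intro a
    cases a with
    | none =>
      refine le_trans (Finset.card_le_card (t := X i) ?_) (by omega)
      intro x hx
      by_contra hn
      simp [cl, hn] at hx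
    | some a =>
      refine le_trans (Finset.card_le_card (t := {a}) ?_) (by simp; omega)
      intro x hx
      by_cases hn : x ∈ X i
      · simp [cl, hn] at hx
      · simp [cl, hn] at hx
        simp [hx]
  have hsplit : ∀ a, ((W ∪ X i).filter (fun x => cl x = a)).card +
      ((W ∪ X i).filter (fun x => cl x ≠ a)).card = (W ∪ X i).card := by
    intro a
    exact Finset.card_filter_add_card_filter_not _
  refine lemM (AJ.symm hc) ℓ (by omega) (W ∪ X i) cl ?_ (by omega) ?_ ?_
  · intro u hu v hv huv
    have key : ∀ u ∈ W, ∀ v ∈ X i, c u v = i := fun u hu v hv => by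
      rw [hc]; exact h.xc i hi v hv u hu
    rcases Finset.mem_union.1 hu with hu | hu <;> rcases Finset.mem_union.1 hv with hv | hv
    · refine ⟨?_, Or.inl ⟨hu, hv⟩⟩
      have : u ≠ v := by rintro rfl; exact huv rfl
      simpa using h.col u hu v hv this
    · exact ⟨key u hu v hv, Or.inr (Or.inl ⟨hu, hv⟩)⟩
    · exact ⟨h.xc i hi u hu v hv, Or.inr (Or.inr ⟨hu, hv⟩)⟩
    · exact absurd (by simp [cl, hu, hv]) huv
  · intro a
    have := hsplit a
    have := hcl a
    omega
  · intro a b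
    exact card_two_parts (W ∪ X i) cl (ℓ - 1) hcl (by omega) a b

lemma St.disj (h : St c ℓ K W X) {r b : κ} (hr : r ∈ K) (hb : b ∈ K) (hrb : r ≠ b)
    (hW : 0 < W.card) : Disjoint (X r) (X b) := by
  rw [Finset.disjoint_left]
  intro x h1 h2
  obtain ⟨w, hw⟩ := Finset.card_pos.1 hW
  exact hrb ((h.xc r hr x h1 w hw).symm.trans (h.xc b hb x h2 w hw))

lemma St.cardU (h : St c ℓ K W X) {r b : κ} (hr : r ∈ K) (hb : b ∈ K) (hrb : r ≠ b)
    (hW : 0 < W.card) : (W ∪ X r ∪ X b).card = W.card + (X r).card + (X b).card := by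
  rw [Finset.card_union_of_disjoint, Finset.card_union_of_disjoint (h.xW r hr).symm]
  exact Finset.disjoint_union_left.2 ⟨(h.xW b hb).symm, h.disj hr hb hrb hW⟩

lemma redU.symm (hc : ∀ u v, c u v = c v u) {W P Q : Finset α} {r : κ} :
    ∀ u v, redU c W P Q r u v → redU c W P Q r v u := by
  rintro u v ⟨h1, h2⟩
  rw [redU, hc v u]
  tauto

lemma blueU.symm (hc : ∀ u v, c u v = c v u) {W P Q : Finset α} {r : κ} :
    ∀ u v, blueU c W P Q r u v → blueU c W P Q r v u := by
  rintro u v ⟨h1, h2⟩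
  rw [blueU, hc v u]
  tauto

/-- A red graph with no `X b`-to-`W` red edges. -/
lemma St.two (hc : ∀ u v, c u v = c v u) (h : St c ℓ K W X) {r b : κ} (hr : r ∈ K) (hb : b ∈ K)
    (hW : 2 * ℓ + 1 ≤ W.card)
    (hcy : Cy (redU c W (X r) (X b) r) (2 * ℓ + 1) ∨ Cy (blueU c W (X r) (X b) b) (2 * ℓ + 1)) :
    False := by
  rcases hcy with hcy | hcy
  · apply h.nc r hr
    refine no_red hc (h.xW r hr) (h.xc r hr) hW (h.card r hr) subset_rfl hcy ?_
    rintro u v hu hv ⟨_, h3⟩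
    tauto
  · apply h.nc b hb
    exact no_blue hc (h.xW b hb) (h.xc b hb) hW (h.card b hb) hcy

lemma base2 [DecidableEq κ] (hc : ∀ u v, c u v = c v u) (hℓ : 3 ≤ ℓ) {r b : κ} (hrb : r ≠ b)
    (h : St c ℓ {r, b} W X) : W.card + (X r).card + (X b).card ≤ 4 * ℓ := by
  by_contra hlt
  have hr : r ∈ ({r, b} : Finset κ) := by simp
  have hb : b ∈ ({r, b} : Finset κ) := by simp
  have h1 := h.card r hr
  have h2 := h.card b hb
  have hU := h.cardU hr hb hrb (by omega)
  refine h.two hc hr hb (by omega) (bondy_erdos (U := W ∪ X r ∪ X b)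
    ⟨redU.symm hc, blueU.symm hc, ?_, fun u v h => h.1.1, fun u v h => h.1.1⟩ ℓ hℓ (by omega))
  intro u hu v hv huv
  unfold redU blueU
  by_cases a1 : u ∈ X r
  · tauto
  by_cases a2 : v ∈ X r
  · tauto
  by_cases a3 : u ∈ X b
  · tauto
  by_cases a4 : v ∈ X b
  · tauto
  have hu' : u ∈ W := by simp [a1, a3] at hu; exact hu
  have hv' : v ∈ W := by simp [a2, a4] at hv; exact hv
  have := h.col u hu' v hv' huv
  simp only [Finset.mem_insert, Finset.mem_singleton] at this
  tauto

/-- All parts small. -/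
lemma St.small (hc : ∀ u v, c u v = c v u) (hℓ : 3 ≤ ℓ) (h : St c ℓ K W X) {r b : κ} (hr : r ∈ K)
    (hb : b ∈ K) (hrb : r ≠ b) (part : α → α)
    (hcr : ∀ u ∈ W, ∀ v ∈ W, part u ≠ part v → c u v = r ∨ c u v = b)
    (hh : ∀ u ∈ W, ∀ u' ∈ W, ∀ v ∈ W, part u = part u' → part u ≠ part v → c u v = c u' v)
    (hp : ∀ a, (W.filter (fun x => part x = a)).card ≤ ℓ) (hW : 2 * ℓ + 1 ≤ W.card) :
    W.card + (X r).card + (X b).card ≤ 7 * ℓ + 1 := by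
  by_contra hlt
  have hU := h.cardU hr hb hrb (by omega)
  have dr := Finset.disjoint_left.1 (h.xW r hr)
  have db := Finset.disjoint_left.1 (h.xW b hb)
  let part' : α → α ⊕ α := fun x => if x ∈ W then Sum.inl (part x) else Sum.inr x
  have p1 : ∀ x ∈ W, part' x = Sum.inl (part x) := fun x hx => by simp [part', hx]
  have p2 : ∀ x, x ∉ W → part' x = Sum.inr x := fun x hx => by simp [part', hx]
  have same : ∀ u u', part' u = part' u' → u = u' ∨ (u ∈ W ∧ u' ∈ W ∧ part u = part u') := by
    intro u u' e
    by_cases hu : u ∈ W <;> by_cases hu' : u' ∈ W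
    · rw [p1 u hu, p1 u' hu'] at e
      exact Or.inr ⟨hu, hu', Sum.inl.inj e⟩
    · rw [p1 u hu, p2 u' hu'] at e; cases e
    · rw [p2 u hu, p1 u' hu'] at e; cases e
    · rw [p2 u hu, p2 u' hu'] at e; exact Or.inl (Sum.inr.inj e)
  have diff : ∀ u v, part' u ≠ part' v → u ∈ W → v ∈ W → part u ≠ part v := by
    intro u v e hu hv e'
    rw [p1 u hu, p1 v hv, e'] at e
    exact e rfl
  refine h.two hc hr hb hW (W_lemma (U := W ∪ X r ∪ X b) (part := part')
    ⟨redU.symm hc, blueU.symm hc, ?_, ?_, ?_⟩ (fun u v h => h.1.1) (fun u v h => h.1.1) ℓ ℓ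
    (by omega) le_rfl ?_ (by omega))
  · intro u hu v hv huv
    unfold redU blueU
    by_cases a1 : u ∈ X r
    · tauto
    by_cases a2 : v ∈ X r
    · tauto
    by_cases a3 : u ∈ X b
    · tauto
    by_cases a4 : v ∈ X b
    · tauto
    have hu' : u ∈ W := by simp [a1, a3] at hu; exact hu
    have hv' : v ∈ W := by simp [a2, a4] at hv; exact hv
    have := hcr u hu' v hv' (diff u v huv hu' hv')
    tauto
  · intro u hu u' hu' v hv e1 e2 hred
    rcases same u u' e1 with rfl | ⟨g1, g2, g3⟩
    · exact hred
    · obtain ⟨_, q⟩ := hred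
      refine ⟨⟨hu', hv⟩, ?_⟩
      rcases q with ⟨_, q2, q3⟩ | q | q
      · left
        refine ⟨g2, q2, ?_⟩
        rw [← hh u g1 u' g2 v q2 g3 (diff u v e2 g1 q2)]; exact q3
      · exact absurd g1 (dr q)
      · exact Or.inr (Or.inr q)
  · intro u hu u' hu' v hv e1 e2 hbl
    rcases same u u' e1 with rfl | ⟨g1, g2, g3⟩
    · exact hbl
    · obtain ⟨_, q', q⟩ := hbl
      refine ⟨⟨hu', hv⟩, ⟨fun q => dr q g2, q'.2⟩, ?_⟩
      rcases q with ⟨_, q2, q3⟩ | q | q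
      · left
        refine ⟨g2, q2, ?_⟩
        rw [← hh u g1 u' g2 v q2 g3 (diff u v e2 g1 q2)]; exact q3
      · exact absurd g1 (db q)
      · exact Or.inr (Or.inr q)
  · intro a
    cases a with
    | inl a =>
      refine le_trans (Finset.card_le_card ?_) (hp a)
      intro x hx
      obtain ⟨_, hx2⟩ := Finset.mem_filter.1 hx
      by_cases hxW : x ∈ W
      · rw [p1 x hxW] at hx2
        exact Finset.mem_filter.2 ⟨hxW, Sum.inl.inj hx2⟩
      · rw [p2 x hxW] at hx2; cases hx2
    | inr a =>
      refine le_trans (Finset.card_le_card (t := {a}) ?_) (by simp; omega)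
      intro x hx
      obtain ⟨_, hx2⟩ := Finset.mem_filter.1 hx
      by_cases hxW : x ∈ W
      · rw [p1 x hxW] at hx2; cases hx2
      · rw [p2 x hxW] at hx2
        exact Finset.mem_singleton.2 (Sum.inr.inj hx2)

lemma two_colors [DecidableEq κ] (K : Finset κ) (hK : 2 ≤ K.card) (r b : κ) :
    ∃ r' ∈ K, ∃ b' ∈ K, r' ≠ b' ∧ ∀ x ∈ K, x = r ∨ x = b → x = r' ∨ x = b' := by
  have ex : ∀ a ∈ K, ∃ a' ∈ K, a ≠ a' := by
    intro a _
    obtain ⟨a', h1, h2⟩ := Finset.exists_mem_ne (show 1 < K.card from hK) a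
    exact ⟨a', h1, h2.symm⟩
  by_cases hr : r ∈ K
  · by_cases hb : b ∈ K ∧ r ≠ b
    · exact ⟨r, hr, b, hb.1, hb.2, fun x _ h => h⟩
    · obtain ⟨b', hb', hne⟩ := ex r hr
      refine ⟨r, hr, b', hb', hne, ?_⟩
      rintro x hx (rfl | rfl)
      · exact Or.inl rfl
      · left
        by_contra q
        exact hb ⟨hx, fun e => q e.symm⟩
  · by_cases hb : b ∈ K
    · obtain ⟨b', hb', hne⟩ := ex b hb
      refine ⟨b, hb, b', hb', hne, ?_⟩
      rintro x hx (rfl | rfl)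
      · exact absurd hx hr
      · exact Or.inl rfl
    · obtain ⟨a, ha⟩ := Finset.card_pos.1 (show 0 < K.card by omega)
      obtain ⟨b', hb', hne⟩ := ex a ha
      refine ⟨a, ha, b', hb', hne, ?_⟩
      rintro x hx (rfl | rfl)
      · exact absurd hx hr
      · exact absurd hx hb
end GR

namespace GR
variable {α : Type*} [DecidableEq α] {κ : Type*} [DecidableEq κ]

lemma arith_step (ℓ m s : ℕ) (hℓ : 3 ≤ ℓ) (hm : 1 ≤ m) (hs : s + m ≤ m * ℓ) :
    7 * ℓ + 2 + s ≤ 4 * (ℓ * 2 ^ m) + 1 := by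
  have h1 : m + 1 ≤ 2 ^ m := Nat.lt_two_pow_self
  have h2 : ℓ * (m + 1) ≤ ℓ * 2 ^ m := Nat.mul_le_mul_left ℓ h1
  have h3 : ℓ ≤ m * ℓ := Nat.le_mul_of_pos_left ℓ hm
  have h4 : ℓ * (m + 1) = m * ℓ + ℓ := by ring
  omega

theorem mainT {c : α → α → κ} (hc : ∀ u v, c u v = c v u) (hn : NR c) {ℓ : ℕ} (hℓ : 3 ≤ ℓ) (m : ℕ) :
    1 ≤ m → ∀ (n : ℕ) (K : Finset κ) (W : Finset α) (X : κ → Finset α), K.card = m → W.card = n →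
      St c ℓ K W X → W.card + ∑ i ∈ K, (X i).card ≤ ℓ * 2 ^ m := by
  induction m using Nat.strong_induction_on with
  | _ m IHm =>
  intro hm1 n
  induction n using Nat.strong_induction_on with
  | _ n IHn =>
  intro K W X hK hWn h
  rcases Nat.lt_or_ge m 3 with hm3 | hm3
  · have : m = 1 ∨ m = 2 := by omega
    rcases this with rfl | rfl
    · obtain ⟨i, rfl⟩ := Finset.card_eq_one.1 hK
      have := base1 hc hℓ h
      simp
      omega
    · obtain ⟨r, b, hrb, rfl⟩ := Finset.card_eq_two.1 hK
      have := base2 hc hℓ hrb h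
      rw [Finset.sum_pair hrb]
      omega
  by_contra hlt
  -- every choice of two colors
  obtain ⟨μ, rfl⟩ : ∃ μ, m = μ + 2 := ⟨m - 2, by omega⟩
  have hμ : 1 ≤ μ := by omega
  set N := ℓ * 2 ^ μ with hN
  have e1 : ℓ * 2 ^ (μ + 1) = 2 * N := by rw [hN]; ring
  have e2 : ℓ * 2 ^ (μ + 2) = 4 * N := by rw [hN]; ring
  have hN2 : 2 * ℓ ≤ N := by
    have : 2 ^ 1 ≤ 2 ^ μ := Nat.pow_le_pow_right (by norm_num) hμ
    have := Nat.mul_le_mul_left ℓ this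
    omega
  rw [e2] at hlt
  -- sums
  have sums : ∀ r ∈ K, ∀ b ∈ K, r ≠ b → ((K.erase b).erase r).card = μ ∧
      ∑ i ∈ K, (X i).card = (X r).card + (X b).card + ∑ i ∈ (K.erase b).erase r, (X i).card ∧
      7 * ℓ + 2 + ∑ i ∈ (K.erase b).erase r, (X i).card ≤ 4 * N + 1 := by
    intro r hr b hb hrb
    have hr' : r ∈ K.erase b := Finset.mem_erase.2 ⟨hrb, hr⟩
    have c1 : ((K.erase b).erase r).card = μ := by
      rw [Finset.card_erase_of_mem hr', Finset.card_erase_of_mem hb, hK]; omega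
    refine ⟨c1, ?_, ?_⟩
    · have := Finset.add_sum_erase K (fun i => (X i).card) hb
      have := Finset.add_sum_erase (K.erase b) (fun i => (X i).card) hr'
      omega
    · apply arith_step ℓ μ _ hℓ hμ
      have : ∑ i ∈ (K.erase b).erase r, ((X i).card + 1) ≤ ((K.erase b).erase r).card • ℓ := by
        apply Finset.sum_le_card_nsmul
        intro i hi
        exact h.card i (Finset.mem_of_mem_erase (Finset.mem_of_mem_erase hi))
      rw [Finset.sum_add_distrib, Finset.sum_const, c1] at this
      simpa using this
  have hK2 : 2 ≤ K.card := by omega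
  have hWbig : 2 * ℓ + 1 ≤ W.card := by
    obtain ⟨r, hr, b, hb, hrb⟩ := Finset.one_lt_card.1 (show 1 < K.card from hK2)
    obtain ⟨_, q2, q3⟩ := sums r hr b hb hrb
    have := h.card r hr
    have := h.card b hb
    omega
  obtain ⟨part, r0, b0, ⟨u0, hu0, v0, hv0, huv0⟩, hcr0, hh⟩ :=
    gallai hc hn W.card W rfl (by omega)
  obtain ⟨r, hr, b, hb, hrb, hrb0⟩ := two_colors K hK2 r0 b0
  have hcr : ∀ u ∈ W, ∀ v ∈ W, part u ≠ part v → c u v = r ∨ c u v = b := by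
    intro u hu v hv huv
    apply hrb0 _ (h.col u hu v hv (fun e => huv (by rw [e]))) (hcr0 u hu v hv huv)
  obtain ⟨q1, q2, q3⟩ := sums r hr b hb hrb
  by_cases hp : ∀ a, (W.filter (fun x => part x = a)).card ≤ ℓ
  · have := h.small hc hℓ hr hb hrb part hcr hh hp hWbig
    omega
  push Not at hp
  obtain ⟨a, ha⟩ := hp
  set K0 := (K.erase b).erase r with hK0
  have hK0K : K0 ⊆ K := (Finset.erase_subset _ _).trans (Finset.erase_subset _ _)
  have mem0 : ∀ i, i ∈ K0 ↔ i ≠ r ∧ i ≠ b ∧ i ∈ K := by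
    intro i; simp [hK0]
  have hr0 : r ∉ K0 := fun q => ((mem0 r).1 q).1 rfl
  have hb0 : b ∉ K0 := fun q => ((mem0 b).1 q).2.1 rfl
  have cfg : Cfg c ℓ N (∑ i ∈ K0, (X i).card) W (X r) (X b) r b := by
    have one : ∀ r' b', (r' = r ∧ b' = b) ∨ (r' = b ∧ b' = r) → ∀ W' ⊆ W, ∀ J, Free c b' W' →
        Disjoint J W' → J ⊆ X r' ∪ W → (∀ x ∈ J, ∀ w ∈ W', c x w = r') → J.card + 1 ≤ ℓ →
        W'.card + J.card + ∑ i ∈ K0, (X i).card ≤ 2 * N := by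
      intro r' b' hrb' W' hW' J fb hd hs hx hJ
      have hr'0 : r' ∉ K0 := by rcases hrb' with ⟨rfl, _⟩ | ⟨rfl, _⟩ <;> assumption
      have hr'K : r' ∈ K := by rcases hrb' with ⟨rfl, _⟩ | ⟨rfl, _⟩ <;> assumption
      have col' : ∀ i ∈ K, i ≠ b' → i ∈ insert r' K0 := by
        intro i hi hne
        rw [Finset.mem_insert, mem0]
        rcases hrb' with ⟨rfl, rfl⟩ | ⟨rfl, rfl⟩ <;> tauto
      have hsub : insert r' K0 ⊆ K := Finset.insert_subset hr'K hK0K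
      have st : St c ℓ (insert r' K0) W' (Function.update X r' J) := by
        refine h.sub hsub hW' ?_ ?_ ?_ ?_ ?_
        · intro u hu v hv huv
          exact col' _ (h.col u (hW' hu) v (hW' hv) huv) (fb u hu v hv huv)
        · intro i hi
          by_cases e : i = r'
          · subst e; simpa using hd
          · rw [Function.update_of_ne e]; exact (h.xW i (hsub hi)).mono_right hW'
        · intro i hi
          by_cases e : i = r'
          · subst e; simpa using hs
          · rw [Function.update_of_ne e]; exact Finset.subset_union_left
        · intro i hi
          by_cases e : i = r'
          · subst e; simpa using hx
          · rw [Function.update_of_ne e]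
            exact fun x hx w hw => h.xc i (hsub hi) x hx w (hW' hw)
        · intro i hi
          by_cases e : i = r'
          · subst e; simpa using hJ
          · rw [Function.update_of_ne e]; exact h.card i (hsub hi)
      have hcard : (insert r' K0).card = μ + 1 := by
        rw [Finset.card_insert_of_notMem hr'0, q1]
      have := IHm (μ + 1) (by omega) (by omega) _ _ _ _ hcard rfl st
      rw [e1, Finset.sum_insert hr'0, Function.update_self] at this
      have e : ∑ i ∈ K0, (Function.update X r' J i).card = ∑ i ∈ K0, (X i).card := by
        apply Finset.sum_congr rfl
        intro i hi
        have hne : i ≠ r' := by rintro rfl; exact hr'0 hi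
        rw [Function.update_of_ne hne]
      omega
    refine ⟨hc, hℓ, hN2, ?_, one r b (Or.inl ⟨rfl, rfl⟩), one b r (Or.inr ⟨rfl, rfl⟩), ?_,
      h.nc r hr, h.nc b hb, h.xW r hr, h.xW b hb, h.xc r hr, h.xc b hb, h.card r hr, h.card b hb⟩
    · intro W' hW' fr fb
      have st : St c ℓ K0 W' X := by
        refine h.sub hK0K hW' ?_ ?_ ?_ ?_ ?_
        · intro u hu v hv huv
          exact (mem0 _).2 ⟨fr u hu v hv huv, fb u hu v hv huv, h.col u (hW' hu) v (hW' hv) huv⟩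
        · intro i hi
          exact (h.xW i (hK0K hi)).mono_right hW'
        · intro i hi
          exact Finset.subset_union_left
        · intro i hi
          exact fun x hx w hw => h.xc i (hK0K hi) x hx w (hW' hw)
        · intro i hi
          exact h.card i (hK0K hi)
      exact IHm μ (by omega) (by omega) _ _ _ _ q1 rfl st
    · intro W' hW'' J J' d1 s1 x1 j1 d2 s2 x2 j2
      have hW' := hW''.1
      let X' := Function.update (Function.update X r J) b J'
      have Xb : X' b = J' := by simp [X']
      have Xr : X' r = J := by simp [X', hrb]
      have X0 : ∀ i, i ≠ r → i ≠ b → X' i = X i := by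
        intro i g1 g2; simp [X', g1, g2]
      have st : St c ℓ K W' X' := by
        refine h.sub subset_rfl hW' ?_ ?_ ?_ ?_ ?_
        · intro u hu v hv huv
          exact h.col u (hW' hu) v (hW' hv) huv
        · intro i hi
          by_cases g1 : i = r
          · subst g1; rw [Xr]; exact d1
          by_cases g2 : i = b
          · subst g2; rw [Xb]; exact d2
          rw [X0 i g1 g2]; exact (h.xW i hi).mono_right hW'
        · intro i hi
          by_cases g1 : i = r
          · subst g1; rw [Xr]; exact s1
          by_cases g2 : i = b
          · subst g2; rw [Xb]; exact s2
          rw [X0 i g1 g2]; exact Finset.subset_union_left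
        · intro i hi
          by_cases g1 : i = r
          · subst g1; rw [Xr]; exact x1
          by_cases g2 : i = b
          · subst g2; rw [Xb]; exact x2
          rw [X0 i g1 g2]; exact fun x hx w hw => h.xc i hi x hx w (hW' hw)
        · intro i hi
          by_cases g1 : i = r
          · subst g1; rw [Xr]; exact j1
          by_cases g2 : i = b
          · subst g2; rw [Xb]; exact j2
          rw [X0 i g1 g2]; exact h.card i hi
      have := IHn W'.card (hWn ▸ Finset.card_lt_card hW'') K W' X' hK rfl st
      have f1 := Finset.add_sum_erase K (fun i => (X' i).card) hb
      have f2 := Finset.add_sum_erase (K.erase b) (fun i => (X' i).card)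
        (Finset.mem_erase.2 ⟨hrb, hr⟩)
      have f3 : ∑ i ∈ K0, (X' i).card = ∑ i ∈ K0, (X i).card := by
        apply Finset.sum_congr rfl
        intro i hi
        rw [X0 i ((mem0 i).1 hi).1 ((mem0 i).1 hi).2.1]
      simp only [Xr, Xb] at f1 f2
      rw [← hK0] at f2
      omega
  obtain ⟨a0, ha0⟩ := Finset.card_pos.1 (show 0 < (W.filter (fun x => part x = a)).card by omega)
  obtain ⟨ha0W, ha0a⟩ := Finset.mem_filter.1 ha0
  have parts : Parts c ℓ W (W.filter (fun x => part x = a))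
      (W.filter (fun x => part x ≠ a ∧ c x a0 = r)) (W.filter (fun x => part x ≠ a ∧ c x a0 ≠ r))
      r b := by
    refine ⟨?_, ?_, ?_, ?_, ?_, ?_, ?_, ha⟩
    · ext x; simp only [Finset.mem_union, Finset.mem_filter]; tauto
    · rw [Finset.disjoint_left]; intro x; simp only [Finset.mem_filter]; tauto
    · rw [Finset.disjoint_left]; intro x; simp only [Finset.mem_filter]; tauto
    · rw [Finset.disjoint_left]; intro x; simp only [Finset.mem_filter]; tauto
    · intro x hx y hy
      obtain ⟨hx1, hx2, hx3⟩ := Finset.mem_filter.1 hx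
      obtain ⟨hy1, hy2⟩ := Finset.mem_filter.1 hy
      rw [hc, ← hh a0 ha0W y hy1 x hx1 (ha0a.trans hy2.symm) (fun e => hx2 (e.symm.trans ha0a)), hc]
      exact hx3
    · intro x hx y hy
      obtain ⟨hx1, hx2, hx3⟩ := Finset.mem_filter.1 hx
      obtain ⟨hy1, hy2⟩ := Finset.mem_filter.1 hy
      rw [hc, ← hh a0 ha0W y hy1 x hx1 (ha0a.trans hy2.symm) (fun e => hx2 (e.symm.trans ha0a)), hc]
      exact (hcr x hx1 a0 ha0W (fun e => hx2 (e.trans ha0a))).resolve_left hx3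
    · intro x hx y hy
      obtain ⟨hx1, hx2, hx3⟩ := Finset.mem_filter.1 hx
      obtain ⟨hy1, hy2, hy3⟩ := Finset.mem_filter.1 hy
      apply hcr x hx1 y hy1
      intro e
      apply hy3
      rw [← hh x hx1 y hy1 a0 ha0W e (fun e => hx2 (e.trans ha0a))]
      exact hx3
  have hAW : W.filter (fun x => part x = a) ≠ W := by
    intro e
    have g1 : part u0 = a := by
      have q := hu0
      rw [← e] at q
      exact (Finset.mem_filter.1 q).2
    have g2 : part v0 = a := by
      have q := hv0
      rw [← e] at q
      exact (Finset.mem_filter.1 q).2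
    exact huv0 (g1.trans g2.symm)
  have := cfg.big parts hrb hAW
  omega
end GR

lemma mono_of_cy {n k ℓ : ℕ} (hℓ : 3 ≤ ℓ) (c : Sym2 (Fin n) → Fin k) (i : Fin k)
    (h : GR.Cy (fun u v => c s(u, v) = i) (2 * ℓ + 1)) :
    HasMonoCopy c (cycleGraph (2 * ℓ + 1)) := by
  obtain ⟨g, gd, gs, gw⟩ := h
  have ginj : Function.Injective (fun t : Fin (2 * ℓ + 1) => g t.1) := by
    intro s t hst
    rcases lt_trichotomy s.1 t.1 with h1 | h1 | h1
    · exact absurd hst (gd _ _ h1 t.2)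
    · exact Fin.ext h1
    · exact absurd hst.symm (gd _ _ h1 s.2)
  have key : ∀ u v : Fin (2 * ℓ + 1), u - v = 1 → c s(g u.1, g v.1) = i := by
    intro u v huv
    have huv' : u = v + 1 := by rw [← huv]; abel
    have hv := v.2
    rcases Nat.lt_or_ge (v.1 + 1) (2 * ℓ + 1) with h1 | h1
    · have : u.1 = v.1 + 1 := by
        rw [huv', Fin.val_add]
        have : ((1 : Fin (2 * ℓ + 1)) : ℕ) = 1 := by
          rw [Fin.val_one']; exact Nat.mod_eq_of_lt (by omega)
        rw [this, Nat.mod_eq_of_lt h1]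
      rw [this, Sym2.eq_swap]
      exact gs _ h1
    · have e : v.1 = 2 * ℓ := by omega
      have : u.1 = 0 := by
        rw [huv', Fin.val_add]
        have : ((1 : Fin (2 * ℓ + 1)) : ℕ) = 1 := by
          rw [Fin.val_one']; exact Nat.mod_eq_of_lt (by omega)
        rw [this, e, Nat.mod_self]
      rw [this, e, Sym2.eq_swap]
      exact gw
  refine ⟨i, ⟨_, ginj⟩, ?_⟩
  intro u v huv
  rw [cycleGraph_eq_circulantGraph] at huv
  simp only [circulantGraph, Set.mem_singleton_iff, SimpleGraph.fromRel_adj] at huv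
  rcases huv.2 with h1 | h1
  · exact key u v h1
  · have := key v u h1
    rw [Sym2.eq_swap] at this
    exact this

theorem gallai_ramsey_odd_cycles_upper (ℓ k n : ℕ) (hℓ : 3 ≤ ℓ) (hk : 1 ≤ k)
    (hn : ℓ * 2 ^ k + 1 ≤ n) (c : Sym2 (Fin n) → Fin k) :
    HasRainbowTriangle c ∨ HasMonoCopy c (cycleGraph (2 * ℓ + 1)) := by
  by_contra hcon
  push Not at hcon
  obtain ⟨h1, h2⟩ := hcon
  have hNR : GR.NR (fun u v => c s(u, v)) := by
    intro x y z hxy hyz hxz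
    by_contra hno
    push Not at hno
    exact h1 ⟨x, y, z, hxy, hxz, hyz, hno.2.1, hno.1, hno.2.2.symm⟩
  have hsymm : ∀ u v : Fin n, c s(u, v) = c s(v, u) := fun u v => by rw [Sym2.eq_swap]
  have st : GR.St (fun u v => c s(u, v)) ℓ (Finset.univ : Finset (Fin k))
      (Finset.univ : Finset (Fin n)) (fun _ => ∅) := by
    refine ⟨by simp, by simp, by simp, by simp; omega, ?_⟩
    intro i _ hcy
    exact h2 (mono_of_cy hℓ c i (hcy.mono (fun u v huv => huv.1)))
  have := GR.mainT hsymm hNR hℓ k hk n Finset.univ Finset.univ (fun _ => ∅) (by simp) (by simp) st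
  simp at this
  omega
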